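/- arXiv:1204.4641 — 4 statements merged into one kernel-verified Lean document; each statement's English description precedes it below -/
import Mathlib

section
/- Let d, r be positive integers and G a group such that G/Z(G) is soluble of derived length at most d and has rank at most r. Then the derived subgroup G' has finite rank, and r(G') ≤ (1/2)·d·r·(r-1) + (d-1)·r². -/
/-- A group has rank at most `r` if every finitely generated subgroup can be
generated by at most `r` elements. -/
def HasRankLE (G : Type*) [Group G] (r : ℕ) : Prop :=
  ∀ H : Subgroup G, H.FG → ∃ S : Finset G, S.card ≤ r ∧ Subgroup.closure (S : Set G) = H

open scoped commutatorElement

universe u v w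

/-- Internal rank bound of a subgroup. -/
def SubRank {G : Type*} [Group G] (K : Subgroup G) (r : ℕ) : Prop :=
  ∀ H : Subgroup G, H ≤ K → H.FG →
    ∃ S : Finset G, S.card ≤ r ∧ Subgroup.closure (S : Set G) = H

theorem SubRank.mono {G : Type*} [Group G] {K L : Subgroup G} {r s : ℕ}
    (h : SubRank L r) (hKL : K ≤ L) (hrs : r ≤ s) : SubRank K s := by
  intro H hH hfg
  obtain ⟨S, h1, h2⟩ := h H (hH.trans hKL) hfg
  exact ⟨S, h1.trans hrs, h2⟩

theorem subRank_of_range {G : Type*} [Group G] {H : Subgroup G} {n r : ℕ} (hn : n ≤ r)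
    (x : Fin n → G) (h : Subgroup.closure (Set.range x) = H) :
    ∃ S : Finset G, S.card ≤ r ∧ Subgroup.closure (S : Set G) = H := by
  classical
  refine ⟨Finset.univ.image x, ?_, ?_⟩
  · refine Finset.card_image_le.trans ?_
    simpa using hn
  · simpa using h

theorem lift_fg {C G : Type*} [Group C] [Group G] (φ : C →* G) {K : Subgroup C}
    {H : Subgroup G} (hH : H ≤ K.map φ) (hfg : H.FG) :
    ∃ L : Subgroup C, L ≤ K ∧ L.FG ∧ L.map φ = H := by
  classical
  obtain ⟨S, rfl⟩ := hfg
  have hS : ∀ s : S, ∃ c ∈ K, φ c = s := fun s =>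
    hH (Subgroup.subset_closure s.2)
  choose g hg1 hg2 using hS
  refine ⟨Subgroup.closure (Set.range g), ?_, ?_, ?_⟩
  · rw [Subgroup.closure_le]
    rintro _ ⟨s, rfl⟩
    exact hg1 s
  · exact ⟨Finset.univ.image g, by simp⟩
  · rw [MonoidHom.map_closure]
    congr 1
    ext y
    constructor
    · rintro ⟨_, ⟨s, rfl⟩, rfl⟩
      rw [hg2]; exact s.2
    · intro hy
      exact ⟨_, ⟨⟨y, hy⟩, rfl⟩, hg2 _⟩

theorem fg_map' {C G : Type*} [Group C] [Group G] (φ : C →* G) {L : Subgroup C} (h : L.FG) :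
    (L.map φ).FG := by
  classical
  obtain ⟨S, rfl⟩ := h
  exact ⟨S.image φ, by rw [MonoidHom.map_closure, Finset.coe_image]⟩

theorem lift_gens {C Q : Type*} [Group C] [Group Q] (ψ : C →* Q) {K L : Subgroup C} {r : ℕ}
    (hK : SubRank (K.map ψ) r) (hL : L ≤ K) (hfg : L.FG) :
    ∃ n ≤ r, ∃ x : Fin n → C, (∀ i, x i ∈ L) ∧ L ≤ Subgroup.closure (Set.range x) ⊔ ψ.ker := by
  obtain ⟨S, hS1, hS2⟩ := hK (L.map ψ) (Subgroup.map_mono hL) (fg_map' ψ hfg)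
  have hS : ∀ i : Fin S.card, ∃ c ∈ L, ψ c = (S.equivFin.symm i : Q) := fun i => by
    have : ((S.equivFin.symm i : S) : Q) ∈ L.map ψ := by
      rw [← hS2]; exact Subgroup.subset_closure (S.equivFin.symm i).2
    exact this
  choose x hx1 hx2 using hS
  refine ⟨S.card, hS1, x, hx1, ?_⟩
  have : L.map ψ ≤ (Subgroup.closure (Set.range x)).map ψ := by
    rw [← hS2, MonoidHom.map_closure]
    apply Subgroup.closure_mono
    intro y hy
    exact ⟨_, ⟨S.equivFin ⟨y, hy⟩, rfl⟩, by rw [hx2]; simp⟩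
  rw [Subgroup.map_le_iff_le_comap, Subgroup.comap_map_eq] at this
  exact this

theorem SubRank.transfer {C G Q : Type*} [Group C] [Group G] [Group Q] (φ : C →* G) (ψ : C →* Q)
    {K : Subgroup C} {r : ℕ} (hker : ψ.ker ≤ φ.ker) (hK : SubRank (K.map ψ) r) :
    SubRank (K.map φ) r := by
  intro H hH hfg
  obtain ⟨L, hL, hLfg, rfl⟩ := lift_fg φ hH hfg
  obtain ⟨n, hn, x, hx, hLx⟩ := lift_gens ψ hK hL hLfg
  refine subRank_of_range hn (φ ∘ x) ?_
  rw [Set.range_comp, ← MonoidHom.map_closure]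
  apply le_antisymm
  · apply Subgroup.map_mono
    rw [Subgroup.closure_le]
    rintro _ ⟨i, rfl⟩
    exact hx i
  · rw [Subgroup.map_le_iff_le_comap, Subgroup.comap_map_eq]
    exact hLx.trans (sup_le_sup_left hker _)

theorem SubRank.map {C G : Type*} [Group C] [Group G] (φ : C →* G)
    {K : Subgroup C} {r : ℕ} (hK : SubRank K r) : SubRank (K.map φ) r := by
  refine SubRank.transfer φ (MonoidHom.id C) ?_ (by simpa using hK)
  intro x hx
  have : x = 1 := by simpa [MonoidHom.mem_ker] using hx
  simp [this]

theorem SubRank.of_map {C Q : Type*} [Group C] [Group Q] (ψ : C →* Q)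
    (hψ : Function.Injective ψ)
    {K : Subgroup C} {r : ℕ} (hK : SubRank (K.map ψ) r) : SubRank K r := by
  have := SubRank.transfer (MonoidHom.id C) ψ (by rw [(MonoidHom.ker_eq_bot_iff ψ).2 hψ]; simp) hK
  simpa using this

theorem subRank_top_iff {G : Type*} [Group G] {r : ℕ} :
    SubRank (⊤ : Subgroup G) r ↔ HasRankLE G r :=
  ⟨fun h H => h H le_top, fun h H _ => h H⟩

theorem subRank_top_coe {G : Type*} [Group G] (K : Subgroup G) {r : ℕ} :
    SubRank (⊤ : Subgroup K) r ↔ SubRank K r := by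
  have e : (⊤ : Subgroup K).map K.subtype = K := by
    rw [← MonoidHom.range_eq_map, Subgroup.range_subtype]
  constructor
  · intro h
    have := h.map K.subtype
    rwa [e] at this
  · intro h
    apply SubRank.of_map K.subtype K.subtype_injective
    rwa [e]

theorem SubRank.ext {G Q : Type*} [Group G] [Group Q] (f : G →* Q) {K : Subgroup G} {a b : ℕ}
    (ha : SubRank (K ⊓ f.ker) a) (hb : SubRank (K.map f) b) : SubRank K (a + b) := by
  classical
  intro H hH hfg
  obtain ⟨n, hn, x, hx, hHx⟩ := lift_gens f hb hH hfg
  obtain ⟨T, hT⟩ := hfg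
  have hd : ∀ t : T, ∃ y ∈ Subgroup.closure (Set.range x), ∃ z ∈ f.ker, y * z = t := fun t => by
    have : (t : G) ∈ Subgroup.closure (Set.range x) ⊔ f.ker :=
      hHx (by rw [← hT]; exact Subgroup.subset_closure t.2)
    exact Subgroup.mem_sup_of_normal_right.1 this
  choose y hy z hz hyz using hd
  have hxH : Subgroup.closure (Set.range x) ≤ H := by
    rw [Subgroup.closure_le]
    rintro _ ⟨i, rfl⟩
    exact hx i
  have hzH : ∀ t, z t ∈ H := fun t => by
    have : z t = (y t)⁻¹ * t := by rw [← hyz]; group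
    rw [this]
    exact H.mul_mem (H.inv_mem (hxH (hy t))) (by rw [← hT]; exact Subgroup.subset_closure t.2)
  obtain ⟨S, hS1, hS2⟩ := ha (Subgroup.closure (Set.range z))
    (by
      rw [Subgroup.closure_le]
      rintro _ ⟨t, rfl⟩
      exact ⟨hH (hzH t), hz t⟩) ⟨Finset.univ.image z, by simp⟩
  refine ⟨S ∪ Finset.univ.image x, ?_, ?_⟩
  · refine (Finset.card_union_le _ _).trans (add_le_add hS1 (Finset.card_image_le.trans ?_))
    simpa using hn
  · rw [Finset.coe_union, Subgroup.closure_union, hS2, Finset.coe_image, Finset.coe_univ,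
      Set.image_univ]
    apply le_antisymm
    · refine sup_le ?_ hxH
      rw [Subgroup.closure_le]
      rintro _ ⟨t, rfl⟩
      exact hzH t
    · conv_lhs => rw [← hT]
      rw [Subgroup.closure_le]
      intro t ht
      have := hyz ⟨t, ht⟩
      change t ∈ _
      change _ = t at this
      rw [← this]
      exact Subgroup.mul_mem _ (Subgroup.mem_sup_right (hy _))
        (Subgroup.mem_sup_left (Subgroup.subset_closure ⟨_, rfl⟩))

theorem SubRank.sup {G : Type*} [Group G] {K L : Subgroup G} {a b : ℕ}
    (hc : ∀ k ∈ K, ∀ l ∈ L, k * l = l * k) (hK : SubRank K a) (hL : SubRank L b) :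
    SubRank (K ⊔ L) (a + b) := by
  have h1 : SubRank (⊤ : Subgroup (K × L)) (a + b) := by
    apply SubRank.ext (MonoidHom.snd K L)
    · refine SubRank.mono ((((subRank_top_coe K).2 hK).map (MonoidHom.inl K L))) ?_ le_rfl
      rintro ⟨k, l⟩ ⟨-, hl⟩
      have : l = 1 := hl
      subst this
      exact ⟨k, trivial, rfl⟩
    · exact SubRank.mono ((subRank_top_coe L).2 hL) le_top le_rfl
  have h2 := h1.map (MonoidHom.noncommCoprod K.subtype L.subtype
    (fun k l => (hc k k.2 l l.2 : Commute (k : G) (l : G))))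
  refine h2.mono (sup_le ?_ ?_) le_rfl
  · intro k hk
    exact ⟨(⟨k, hk⟩, 1), trivial, mul_one k⟩
  · intro l hl
    exact ⟨(1, ⟨l, hl⟩), trivial, one_mul l⟩

theorem SubRank.finset_sup {ι G : Type*} [Group G] (s : Finset ι) (M : ι → Subgroup G)
    (C : Subgroup G) (hC : ∀ x ∈ C, ∀ y ∈ C, x * y = y * x) (hM : ∀ i, M i ≤ C) {a : ℕ}
    (h : ∀ i, SubRank (M i) a) : SubRank (s.sup M) (s.card * a) := by
  classical
  induction s using Finset.induction_on with
  | empty =>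
    intro H hH _
    refine ⟨∅, by simp, ?_⟩
    have : H = ⊥ := by simpa using hH
    simp [this]
  | insert i s hi ih =>
    rw [Finset.sup_insert, Finset.card_insert_of_notMem hi]
    refine SubRank.mono (SubRank.sup ?_ (h i) ih) le_rfl (by rw [add_mul, one_mul, add_comm])
    intro k hk l hl
    exact hC k (hM i hk) l ((Finset.sup_le fun j _ => hM j : s.sup M ≤ C) hl)

theorem subRank_zpowers {G : Type*} [Group G] (g : G) : SubRank (Subgroup.zpowers g) 1 := by
  intro H hH _
  have : IsCyclic H := Subgroup.isCyclic_of_le hH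
  obtain ⟨k, hk⟩ := (Subgroup.isCyclic_iff_exists_zpowers_eq_top H).1 this
  exact ⟨{k}, by simp, by simpa [Subgroup.zpowers_eq_closure] using hk⟩

theorem exists_fg_commutator {G : Type*} [Group G] {B H : Subgroup G} (hH : H ≤ ⁅B, B⁆)
    (hfg : H.FG) : ∃ L ≤ B, L.FG ∧ H ≤ ⁅L, L⁆ := by
  classical
  have key : ∀ g ∈ ⁅B, B⁆, ∃ L ≤ B, L.FG ∧ g ∈ ⁅L, L⁆ := by
    intro g hg
    rw [Subgroup.commutator_def] at hg
    induction hg using Subgroup.closure_induction with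
    | mem g hg =>
      obtain ⟨a, ha, b, hb, rfl⟩ := hg
      refine ⟨Subgroup.closure ({a, b} : Finset G), ?_, ⟨_, rfl⟩, ?_⟩
      · rw [Subgroup.closure_le]
        intro t ht
        simp at ht
        rcases ht with rfl | rfl <;> assumption
      · exact Subgroup.commutator_mem_commutator (Subgroup.subset_closure (by simp))
          (Subgroup.subset_closure (by simp))
    | one => exact ⟨⊥, bot_le, Subgroup.FG.bot, one_mem _⟩
    | mul x y _ _ hx hy =>
      obtain ⟨L, h1, h2, h3⟩ := hx
      obtain ⟨M, g1, g2, g3⟩ := hy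
      exact ⟨L ⊔ M, sup_le h1 g1, h2.sup g2, mul_mem
        (Subgroup.commutator_mono le_sup_left le_sup_left h3)
        (Subgroup.commutator_mono le_sup_right le_sup_right g3)⟩
    | inv x _ hx =>
      obtain ⟨L, h1, h2, h3⟩ := hx
      exact ⟨L, h1, h2, inv_mem h3⟩
  obtain ⟨S, rfl⟩ := hfg
  have hS : ∀ g ∈ S, g ∈ ⁅B, B⁆ := fun g hg => hH (Subgroup.subset_closure hg)
  clear hH
  induction S using Finset.induction_on with
  | empty => exact ⟨⊥, bot_le, Subgroup.FG.bot, by simp⟩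
  | insert s S hs ih =>
    obtain ⟨L, h1, h2, h3⟩ := ih fun g hg => hS g (Finset.mem_insert_of_mem hg)
    obtain ⟨M, g1, g2, g3⟩ := key s (hS s (Finset.mem_insert_self _ _))
    refine ⟨L ⊔ M, sup_le h1 g1, h2.sup g2, ?_⟩
    rw [Subgroup.closure_le]
    intro t ht
    rcases Finset.mem_insert.1 ht with rfl | ht
    · exact Subgroup.commutator_mono le_sup_right le_sup_right g3
    · exact Subgroup.commutator_mono le_sup_left le_sup_left (h3 (Subgroup.subset_closure ht))

theorem card_pairs (n : ℕ) :
    (Finset.univ.sigma fun j : Fin n => Finset.Iio j).card = n * (n - 1) / 2 := by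
  rw [Finset.card_sigma]
  simp only [Fin.card_Iio]
  rw [Fin.sum_univ_eq_sum_range (fun i => i), Finset.sum_range_id]

/-- The class two step. -/
theorem subRank_class_two {G Q : Type*} [Group G] [Group Q] (f : G →* Q) (B : Subgroup G) {r : ℕ}
    (hf : f.ker ≤ Subgroup.center G) (hB : ⁅B, B⁆ ≤ Subgroup.center G)
    (hr : SubRank (B.map f) r) : SubRank ⁅B, B⁆ (r * (r - 1) / 2) := by
  intro H hH hfg
  obtain ⟨L, hL, hLfg, hHL⟩ := exists_fg_commutator hH hfg
  obtain ⟨n, hn, x, hx, hLx⟩ := lift_gens f hr hL hLfg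
  let s := Finset.univ.sigma fun j : Fin n => Finset.Iio j
  let M : (Σ _ : Fin n, Fin n) → Subgroup G := fun p => Subgroup.zpowers ⁅x p.2, x p.1⁆
  have hM : ∀ p, M p ≤ ⁅B, B⁆ := fun p => by
    rw [Subgroup.zpowers_le]
    exact Subgroup.commutator_mem_commutator (hL (hx _)) (hL (hx _))
  have hMs : SubRank (s.sup M) (s.card * 1) :=
    SubRank.finset_sup s M ⁅B, B⁆
      (fun a ha b _ => ((Subgroup.mem_center_iff.1 (hB ha)) b).symm) hM
      (fun p => subRank_zpowers _)
  set W := s.sup M with hW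
  have hWc : W ≤ Subgroup.center G := (Finset.sup_le fun p _ => hM p).trans hB
  have hWn : W.Normal := ⟨fun w hw g => by
    rw [Subgroup.mem_center_iff.1 (hWc hw) g, mul_inv_cancel_right]; exact hw⟩
  have hlt : ∀ i j : Fin n, i < j → ⁅x i, x j⁆ ∈ W := fun i j hij => by
    have : M ⟨j, i⟩ ≤ W := Finset.le_sup (f := M) (by simp [s, hij])
    exact this (Subgroup.mem_zpowers _)
  have hall : ∀ i j : Fin n, ⁅x i, x j⁆ ∈ W := fun i j => by
    rcases lt_trichotomy i j with h | h | h
    · exact hlt i j h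
    · subst h; simp
    · rw [← commutatorElement_inv]; exact inv_mem (hlt j i h)
  have hLW : ⁅L, L⁆ ≤ W := by
    -- everything in `L` commutes modulo `W`
    have h1 : ∀ a ∈ Subgroup.closure (Set.range x) ⊔ f.ker, ∀ i, ⁅a, x i⁆ ∈ W := by
      intro a ha i
      have : Subgroup.closure (Set.range x) ⊔ f.ker ≤
          (Subgroup.centralizer {QuotientGroup.mk' W (x i)}).comap (QuotientGroup.mk' W) := by
        refine sup_le ?_ ?_
        · rw [Subgroup.closure_le]
          rintro _ ⟨j, rfl⟩
          rw [SetLike.mem_coe, Subgroup.mem_comap, Subgroup.mem_centralizer_singleton_iff]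
          have := (QuotientGroup.eq_one_iff _).2 (hall j i)
          exact commutatorElement_eq_one_iff_mul_comm.1 this
        · intro z hz
          rw [Subgroup.mem_comap, Subgroup.mem_centralizer_singleton_iff, ← map_mul, ← map_mul,
            Subgroup.mem_center_iff.1 (hf hz)]
      have h := this ha
      rw [Subgroup.mem_comap, Subgroup.mem_centralizer_singleton_iff] at h
      exact (QuotientGroup.eq_one_iff _).1 (commutatorElement_eq_one_iff_mul_comm.2 h)
    rw [Subgroup.commutator_le]
    intro a ha b hb
    have : Subgroup.closure (Set.range x) ⊔ f.ker ≤
        (Subgroup.centralizer {QuotientGroup.mk' W a}).comap (QuotientGroup.mk' W) := by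
      refine sup_le ?_ ?_
      · rw [Subgroup.closure_le]
        rintro _ ⟨j, rfl⟩
        rw [SetLike.mem_coe, Subgroup.mem_comap, Subgroup.mem_centralizer_singleton_iff]
        have := (QuotientGroup.eq_one_iff _).2 (h1 a (hLx ha) j)
        exact (commutatorElement_eq_one_iff_mul_comm.1 this).symm
      · intro z hz
        rw [Subgroup.mem_comap, Subgroup.mem_centralizer_singleton_iff, ← map_mul, ← map_mul,
          Subgroup.mem_center_iff.1 (hf hz)]
    have h := this (hLx hb)
    rw [Subgroup.mem_comap, Subgroup.mem_centralizer_singleton_iff] at h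
    exact (QuotientGroup.eq_one_iff _).1 (commutatorElement_eq_one_iff_mul_comm.2 h.symm)
  refine hMs.mono le_rfl ?_ H (hHL.trans hLW) hfg
  rw [mul_one, card_pairs]
  exact Nat.div_le_div_right (Nat.mul_le_mul hn (Nat.sub_le_sub_right hn 1))

/-- The commutator with a fixed element as a homomorphism on an abelian normal subgroup. -/
def commHom {G : Type*} [Group G] (C : Subgroup G) (hn : C.Normal)
    (hC : ∀ x ∈ C, ∀ y ∈ C, x * y = y * x) (g : G) : C →* G where
  toFun c := ⁅(c : G), g⁆
  map_one' := by simp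
  map_mul' a b := by
    have h1 : ⁅(b : G), g⁆ ∈ C := by
      rw [commutatorElement_def, mul_assoc, mul_assoc]
      refine C.mul_mem b.2 ?_
      rw [← mul_assoc]
      exact hn.conj_mem _ (C.inv_mem b.2) g
    have h2 := hC a a.2 _ h1
    have h3 : g * (a : G)⁻¹ * g⁻¹ ∈ C := hn.conj_mem _ (C.inv_mem a.2) g
    have h4 := hC _ h1 _ (C.mul_mem a.2 h3)
    calc ⁅((a * b : C) : G), g⁆ = a * ⁅(b : G), g⁆ * (g * (a : G)⁻¹ * g⁻¹) := by
          simp only [commutatorElement_def, Subgroup.coe_mul]; group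
      _ = ⁅(b : G), g⁆ * (a * (g * (a : G)⁻¹ * g⁻¹)) := by rw [h2, mul_assoc]
      _ = (a * (g * (a : G)⁻¹ * g⁻¹)) * ⁅(b : G), g⁆ := h4
      _ = _ := by simp only [commutatorElement_def]; group

theorem subRank_abelian_comm {G Q : Type*} [Group G] [Group Q] (f : G →* Q) (C : Subgroup G)
    (hn : C.Normal) (hC : ∀ x ∈ C, ∀ y ∈ C, x * y = y * x) {r n : ℕ}
    (hf : f.ker ≤ Subgroup.center G) (hr : SubRank (C.map f) r) (x : Fin n → G)
    (hx : ⊤ ≤ Subgroup.closure (Set.range x) ⊔ f.ker) :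
    SubRank ⁅C, (⊤ : Subgroup G)⁆ (n * r) := by
  let M : Fin n → Subgroup G := fun i => (commHom C hn hC (x i)).range
  have hM : ∀ i, M i ≤ C := by
    rintro i _ ⟨b, rfl⟩
    change ⁅(b : G), x i⁆ ∈ C
    rw [commutatorElement_def, mul_assoc, mul_assoc]
    refine C.mul_mem b.2 ?_
    rw [← mul_assoc]
    exact hn.conj_mem _ (C.inv_mem b.2) _
  have hMr : ∀ i, SubRank (M i) r := by
    intro i
    have : M i = (⊤ : Subgroup C).map (commHom C hn hC (x i)) := MonoidHom.range_eq_map _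
    rw [this]
    apply SubRank.transfer _ (f.comp C.subtype)
    · intro c hc
      have hc' : (c : G) ∈ f.ker := hc
      change ⁅(c : G), x i⁆ = 1
      exact commutatorElement_eq_one_iff_mul_comm.2 (Subgroup.mem_center_iff.1 (hf hc') _).symm
    · rw [← Subgroup.map_map, ← MonoidHom.range_eq_map, Subgroup.range_subtype]
      exact hr
  have hs := SubRank.finset_sup Finset.univ M C hC hM hMr
  rw [Finset.card_univ, Fintype.card_fin] at hs
  refine hs.mono ?_ le_rfl
  set W := Finset.univ.sup M with hW
  have key : ∀ g : G, ∀ c ∈ C, ⁅c, g⁆ ∈ W := by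
    intro g
    have hg : g ∈ Subgroup.closure (Set.range x ∪ f.ker) := by
      rw [Subgroup.closure_union, Subgroup.closure_eq]; exact hx trivial
    induction hg using Subgroup.closure_induction with
    | mem g hg =>
      intro c hc
      rcases hg with ⟨i, rfl⟩ | hg
      · exact (Finset.le_sup (Finset.mem_univ i) : M i ≤ W) ⟨⟨c, hc⟩, rfl⟩
      · rw [commutatorElement_eq_one_iff_mul_comm.2 (Subgroup.mem_center_iff.1 (hf hg) c)]
        exact one_mem _
    | one => intro c _; simp
    | mul g h _ _ hg hh =>
      intro c hc
      have e : ⁅c, g * h⁆ = ⁅c, h⁆ * ⁅h * c * h⁻¹, g⁆ := by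
        simp only [commutatorElement_def]; group
      rw [e]
      exact mul_mem (hh c hc) (hg _ (hn.conj_mem c hc h))
    | inv g _ hg =>
      intro c hc
      have e : ⁅c, g⁻¹⁆ = ⁅g⁻¹ * c * g⁻¹⁻¹, g⁆⁻¹ := by
        simp only [commutatorElement_def]; group
      rw [e]
      exact inv_mem (hg _ (hn.conj_mem c hc g⁻¹))
  rw [Subgroup.commutator_le]
  exact fun c hc g _ => key g c hc

theorem map_center_le {G G' : Type*} [Group G] [Group G'] (p : G →* G')
    (hp : Function.Surjective p) {Z : Subgroup G} (hZ : Z ≤ Subgroup.center G) :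
    Z.map p ≤ Subgroup.center G' := by
  rintro _ ⟨z, hz, rfl⟩
  rw [Subgroup.mem_center_iff]
  intro g
  obtain ⟨g, rfl⟩ := hp g
  rw [← map_mul, ← map_mul, Subgroup.mem_center_iff.1 (hZ hz)]

theorem subRank_step {G Q : Type*} [Group G] [Group Q] (f : G →* Q) (B : Subgroup G)
    (hn : B.Normal) (hB : ⁅B, B⁆ ≤ f.ker) {r : ℕ}
    (hf : f.ker ≤ Subgroup.center G) (hG : (⊤ : Subgroup G).FG) (hr : SubRank (⊤ : Subgroup Q) r) :
    SubRank ⁅B, (⊤ : Subgroup G)⁆ (r * (r - 1) / 2 + r ^ 2) := by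
  obtain ⟨n, hnr, x, -, hx⟩ := lift_gens f (hr.mono (le_top : (⊤ : Subgroup G).map f ≤ ⊤) le_rfl)
    le_rfl hG
  let D : Subgroup G := ⁅B, B⁆
  have hD : D.Normal := Subgroup.commutator_normal B B
  let p := QuotientGroup.mk' D
  have hp : Function.Surjective p := QuotientGroup.mk'_surjective D
  have hpk : p.ker = D := QuotientGroup.ker_mk' D
  let fb : G ⧸ D →* Q := QuotientGroup.lift D f hB
  have hfb : ∀ g, fb (p g) = f g := fun g => rfl
  have hkb : fb.ker = f.ker.map p := by
    ext y
    obtain ⟨g, rfl⟩ := hp y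
    constructor
    · intro h
      exact ⟨g, h, rfl⟩
    · rintro ⟨g', hg', h⟩
      rw [← h]
      exact hg'
  apply SubRank.ext p
  · refine (subRank_class_two f B hf (hB.trans hf) (hr.mono le_top le_rfl)).mono ?_ le_rfl
    rw [hpk]; exact inf_le_right
  · rw [Subgroup.map_commutator, ← MonoidHom.range_eq_map, MonoidHom.range_eq_top.2 hp]
    refine SubRank.mono (subRank_abelian_comm fb (B.map p) (hn.map p hp) ?_ ?_
      (hr.mono le_top le_rfl) (p ∘ x) ?_) le_rfl (r := n * r) ?_
    · rintro _ ⟨a, ha, rfl⟩ _ ⟨b, hb, rfl⟩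
      have : p ⁅a, b⁆ = 1 := by
        rw [← MonoidHom.mem_ker, hpk]; exact Subgroup.commutator_mem_commutator ha hb
      rw [map_commutatorElement] at this
      exact commutatorElement_eq_one_iff_mul_comm.1 this
    · rw [hkb]; exact map_center_le p hp hf
    · rw [hkb, Set.range_comp, ← MonoidHom.map_closure, ← Subgroup.map_sup,
        top_le_iff.1 hx, ← MonoidHom.range_eq_map, MonoidHom.range_eq_top.2 hp]
    · rw [sq]; exact Nat.mul_le_mul_right r hnr

theorem subRank_main (r d : ℕ) : ∀ (G : Type u) (Q : Type v) [Group G] [Group Q] (f : G →* Q),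
    (⊤ : Subgroup G).FG → f.ker ≤ Subgroup.center G → derivedSeries Q (d + 1) = ⊥ →
    SubRank (⊤ : Subgroup Q) r →
    SubRank (commutator G) ((d + 1) * (r * (r - 1) / 2) + d * r ^ 2) := by
  induction d with
  | zero =>
    intro G Q _ _ f hG hf hd hr
    have : ⁅(⊤ : Subgroup G), (⊤ : Subgroup G)⁆ ≤ f.ker := by
      rw [← Subgroup.map_eq_bot_iff, Subgroup.map_commutator, eq_bot_iff, ← hd]
      simp only [zero_add, derivedSeries_succ, derivedSeries_zero]
      exact Subgroup.commutator_mono le_top le_top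
    refine (subRank_class_two f ⊤ hf (this.trans hf) (hr.mono le_top le_rfl)).mono le_rfl ?_
    simp
  | succ d ih =>
    intro G Q _ _ f hG hf hd hr
    let A : Subgroup Q := derivedSeries Q (d + 1)
    have hA : A.Normal := derivedSeries_normal Q (d + 1)
    let B := A.comap f
    have hB : B.Normal := hA.comap f
    have hBB : ⁅B, B⁆ ≤ f.ker := by
      rw [← Subgroup.map_eq_bot_iff, Subgroup.map_commutator, eq_bot_iff, ← hd,
        derivedSeries_succ Q (d + 1)]
      exact Subgroup.commutator_mono (Subgroup.map_comap_le _ _) (Subgroup.map_comap_le _ _)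
    have h1 := subRank_step f B hB hBB hf hG hr
    let N : Subgroup G := ⁅B, (⊤ : Subgroup G)⁆
    have hN : N.Normal := Subgroup.commutator_normal _ _
    have hNB : N ≤ B := Subgroup.commutator_le_left B ⊤
    let p := QuotientGroup.mk' N
    have hp : Function.Surjective p := QuotientGroup.mk'_surjective N
    have hpk : p.ker = N := QuotientGroup.ker_mk' N
    let q := QuotientGroup.mk' A
    have hq : Function.Surjective q := QuotientGroup.mk'_surjective A
    let fb : G ⧸ N →* Q ⧸ A := QuotientGroup.map N A f hNB
    have h2 := ih (G ⧸ N) (Q ⧸ A) fb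
      (by
        have := fg_map' p hG
        rwa [← MonoidHom.range_eq_map, MonoidHom.range_eq_top.2 hp] at this)
      (by
        intro y hy
        obtain ⟨g, rfl⟩ := hp y
        have hg : g ∈ B := (QuotientGroup.eq_one_iff (f g)).1 hy
        rw [Subgroup.mem_center_iff]
        intro z
        obtain ⟨z, rfl⟩ := hp z
        have : p ⁅g, z⁆ = 1 := by
          rw [← MonoidHom.mem_ker, hpk]
          exact Subgroup.commutator_mem_commutator hg (Subgroup.mem_top z)
        rw [map_commutatorElement] at this
        exact (commutatorElement_eq_one_iff_mul_comm.1 this).symm)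
      (by
        rw [← map_derivedSeries_eq hq, Subgroup.map_eq_bot_iff, QuotientGroup.ker_mk'])
      (by
        have := hr.map q
        rwa [← MonoidHom.range_eq_map, MonoidHom.range_eq_top.2 hq] at this)
    have h3 : SubRank (commutator G) _ := SubRank.ext p (h1.mono (by rw [hpk]; exact inf_le_right) le_rfl)
      (b := (d + 1) * (r * (r - 1) / 2) + d * r ^ 2)
      (h2.mono (by
        rw [commutator_def, Subgroup.map_commutator, commutator_def]
        exact Subgroup.commutator_mono le_top le_top) le_rfl)
    exact h3.mono le_rfl (le_of_eq (by ring))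

/-- If `G/Z(G)` is soluble of derived length at most `d` and has rank at
most `r` (with `d, r ≥ 1`), then `G'` has rank at most `d·r·(r-1)/2 + (d-1)·r²`. -/
theorem rank_derived_of_solvable_central_quotient
    (G : Type*) [Group G] (d r : ℕ) (hd : 0 < d) (hr : 0 < r)
    (hsol : derivedSeries (G ⧸ Subgroup.center G) d = ⊥)
    (hrank : HasRankLE (G ⧸ Subgroup.center G) r) :
    HasRankLE (commutator G) (d * r * (r - 1) / 2 + (d - 1) * r ^ 2) := by
  obtain ⟨d, rfl⟩ : ∃ e, d = e + 1 := ⟨d - 1, by omega⟩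
  rw [← subRank_top_iff, subRank_top_coe]
  intro H hH hfg
  obtain ⟨L, -, hL, hHL⟩ := exists_fg_commutator (B := ⊤) hH hfg
  have h1 := subRank_main r d L (G ⧸ Subgroup.center G)
    ((QuotientGroup.mk' (Subgroup.center G)).comp L.subtype)
    ((Group.fg_iff_subgroup_fg L).2 hL).out
    (by
      intro z hz
      have hz' : (z : G) ∈ Subgroup.center G := (QuotientGroup.eq_one_iff (z : G)).1 hz
      rw [Subgroup.mem_center_iff]
      intro g
      exact Subtype.ext (Subgroup.mem_center_iff.1 hz' g))
    hsol (subRank_top_iff.2 hrank)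
  have h2 := h1.map L.subtype
  rw [commutator_def, Subgroup.map_commutator, ← MonoidHom.range_eq_map,
    Subgroup.range_subtype] at h2
  refine h2.mono le_rfl (le_of_eq ?_) H hHL hfg
  have h2 : 2 ∣ r * (r - 1) := (Nat.even_mul_pred_self r).two_dvd
  rw [mul_assoc (d + 1), Nat.mul_div_assoc _ h2]
  simp
end

section
/- If G is a finite nilpotent group such that G/Z(G) has rank r, then the rank of the derived subgroup G' is bounded by a function of r only. -/
namespace RankDer

open Subgroup
open scoped commutatorElement

section Basic
variable {G : Type*} [Group G]

lemma mem_sup_normal {A B : Subgroup G} [B.Normal] {x : G} (hx : x ∈ A ⊔ B) :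
    ∃ a ∈ A, ∃ b ∈ B, a * b = x := by
  have : x ∈ ((A ⊔ B : Subgroup G) : Set G) := hx
  rw [Subgroup.mul_normal] at this
  exact Set.mem_mul.mp this

/-- Commutator subgroups are generated by commutators of generators, modulo `U`. -/
lemma commutator_le_of_gens {H K U : Subgroup G} {S T : Set G} (hS : closure S = H)
    (hT : closure T = K) (hHK : ⁅H, K⁆ ≤ H) (hU : ∀ s ∈ S, ∀ t ∈ T, ⁅s, t⁆ ∈ U)
    (h3 : ⁅H, ⁅H, K⁆⁆ ≤ U) : ⁅H, K⁆ ≤ U := by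
  have hTK : ∀ t ∈ T, t ∈ K := fun t ht => hT ▸ subset_closure ht
  have step1 : ∀ t ∈ T, ∀ h ∈ H, ⁅h, t⁆ ∈ U := by
    intro t ht h hh
    have h3' : ∀ a ∈ H, ∀ b ∈ H, ⁅a, ⁅b, t⁆⁆ ∈ U := fun a ha b hb =>
      h3 (commutator_mem_commutator ha (commutator_mem_commutator hb (hTK t ht)))
    have : h ∈ closure S := hS ▸ hh
    induction this using closure_induction with
    | mem x hx => exact hU x hx t ht
    | one => simp
    | mul a b ha hb iha ihb =>
      rw [hS] at ha hb
      have e : ⁅a * b, t⁆ = ⁅a, ⁅b, t⁆⁆ * ⁅b, t⁆ * ⁅a, t⁆ := by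
        simp only [commutatorElement_def]; group
      rw [e]
      exact U.mul_mem (U.mul_mem (h3' a ha b hb) (ihb hb)) (iha ha)
    | inv a ha iha =>
      rw [hS] at ha
      have e' : ⁅a⁻¹, t⁆ = ⁅a, ⁅a⁻¹, t⁆⁆⁻¹ * ⁅a, t⁆⁻¹ := by
        simp only [commutatorElement_def]; group
      rw [e']
      exact U.mul_mem (U.inv_mem (h3' a ha _ (H.inv_mem ha))) (U.inv_mem (iha ha))
  have step2 : ∀ k ∈ K, ∀ h ∈ H, ⁅h, k⁆ ∈ U := by
    intro k hk
    have : k ∈ closure T := hT ▸ hk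
    induction this using closure_induction with
    | mem x hx => exact step1 x hx
    | one => simp
    | mul a b ha hb iha ihb =>
      intro h hh
      rw [hT] at ha hb
      have e : ⁅h, a * b⁆ = ⁅h, a⁆ * ⁅⁅h, b⁆, a⁆⁻¹ * ⁅h, b⁆ := by
        simp only [commutatorElement_def]; group
      rw [e]
      exact U.mul_mem (U.mul_mem (iha ha h hh)
        (U.inv_mem (iha ha _ (hHK (commutator_mem_commutator hh hb))))) (ihb hb h hh)
    | inv a ha iha =>
      intro h hh
      rw [hT] at ha
      have e : ⁅h, a⁻¹⁆ = (⁅h, a⁆ * ⁅⁅h, a⁻¹⁆, a⁆⁻¹)⁻¹ := by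
        simp only [commutatorElement_def]; group
      rw [e]
      exact U.inv_mem (U.mul_mem (iha ha h hh)
        (U.inv_mem (iha ha _ (hHK (commutator_mem_commutator hh (K.inv_mem ha))))))
  exact commutator_le.mpr fun h hh k hk => step2 k hk h hh

lemma commutator_pow_of_commute (x g : G) (h : Commute ⁅x, g⁆ x) (n : ℕ) :
    ⁅x ^ n, g⁆ = ⁅x, g⁆ ^ n := by
  set c := ⁅x, g⁆ with hc
  have e : g * x * g⁻¹ = c⁻¹ * x := by rw [hc, commutatorElement_def]; group
  have e2 : g * x ^ n * g⁻¹ = (c ^ n)⁻¹ * x ^ n := by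
    rw [← conj_pow, e, h.inv_left.mul_pow, inv_pow]
  have e3 : ⁅x ^ n, g⁆ = x ^ n * (g * x ^ n * g⁻¹)⁻¹ := by
    rw [commutatorElement_def]; group
  rw [e3, e2, mul_inv_rev, inv_inv, mul_inv_cancel_left]

lemma commute_mk {K : Subgroup G} [K.Normal] {x y : G} (h : ⁅x, y⁆ ∈ K) :
    Commute (QuotientGroup.mk' K x) (QuotientGroup.mk' K y) := by
  rw [← commutatorElement_eq_one_iff_commute, ← map_commutatorElement]
  exact (QuotientGroup.eq_one_iff _).mpr h

lemma commutator_pow_mem {K : Subgroup G} [K.Normal] {x g : G} (h : ⁅⁅x, g⁆, x⁆ ∈ K) {n : ℕ}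
    (h2 : ⁅x, g⁆ ^ n ∈ K) : ⁅x ^ n, g⁆ ∈ K := by
  have := commutator_pow_of_commute (QuotientGroup.mk' K x) (QuotientGroup.mk' K g)
    (by rw [← map_commutatorElement]; exact commute_mk h) n
  rw [← map_pow, ← map_commutatorElement, ← map_commutatorElement, ← map_pow] at this
  rw [← QuotientGroup.eq_one_iff] at h2 ⊢
  exact this.trans h2

/-- The subgroup of elements centralizing `N` modulo `K`. -/
def cmod (N K : Subgroup G) [K.Normal] : Subgroup G :=
  (centralizer ((N.map (QuotientGroup.mk' K) : Subgroup (G ⧸ K)) : Set (G ⧸ K))).comap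
    (QuotientGroup.mk' K)

lemma mem_cmod {N K : Subgroup G} [K.Normal] {x : G} :
    x ∈ cmod N K ↔ ∀ n ∈ N, ⁅x, n⁆ ∈ K := by
  constructor
  · intro hx n hn
    have := mem_centralizer_iff.mp hx (QuotientGroup.mk' K n) (mem_map_of_mem _ hn)
    have h2 : Commute (QuotientGroup.mk' K x) (QuotientGroup.mk' K n) := this.symm
    rw [← commutatorElement_eq_one_iff_commute, ← map_commutatorElement] at h2
    exact (QuotientGroup.eq_one_iff _).mp h2
  · intro hx
    refine mem_centralizer_iff.mpr ?_
    rintro _ ⟨n, hn, rfl⟩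
    exact (commute_mk (hx n hn)).symm

lemma le_cmod {H N K : Subgroup G} [K.Normal] : H ≤ cmod N K ↔ ⁅H, N⁆ ≤ K := by
  rw [commutator_le]
  exact ⟨fun h x hx => mem_cmod.mp (h hx), fun h x hx => mem_cmod.mpr (h x hx)⟩

lemma commutator_sup_le {A B N K : Subgroup G} [K.Normal] (h1 : ⁅A, N⁆ ≤ K) (h2 : ⁅B, N⁆ ≤ K) :
    ⁅A ⊔ B, N⁆ ≤ K :=
  le_cmod.mp (sup_le (le_cmod.mpr h1) (le_cmod.mpr h2))

/-- Subgroup generated by `p`-th powers. -/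
def pw (p : ℕ) (H : Subgroup G) : Subgroup G := closure ((fun x => x ^ p) '' (H : Set G))

lemma pow_mem_pw {p : ℕ} {H : Subgroup G} {x : G} (hx : x ∈ H) : x ^ p ∈ pw p H :=
  subset_closure ⟨x, hx, rfl⟩

lemma pw_le {p : ℕ} {H K : Subgroup G} (h : ∀ x ∈ H, x ^ p ∈ K) : pw p H ≤ K := by
  refine (closure_le _).mpr ?_
  rintro _ ⟨x, hx, rfl⟩
  exact h x hx

instance pw_normal (p : ℕ) (H : Subgroup G) [H.Normal] : (pw p H).Normal := by
  constructor
  intro n hn g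
  have : pw p H ≤ (pw p H).comap (MulAut.conj g).toMonoidHom := by
    refine pw_le fun x hx => ?_
    have h2 : (g * x * g⁻¹) ^ p ∈ pw p H := pow_mem_pw (Normal.conj_mem inferInstance x hx g)
    rw [conj_pow] at h2
    simpa using h2
  simpa using this hn

/-- One step of the filtration. -/
def st (p : ℕ) (N H : Subgroup G) : Subgroup G := pw p H ⊔ ⁅H, N⁆

instance st_normal (p : ℕ) (N H : Subgroup G) [H.Normal] [N.Normal] : (st p N H).Normal := by
  unfold st; infer_instance

lemma st_le (p : ℕ) (N H : Subgroup G) [H.Normal] : st p N H ≤ H :=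
  sup_le (pw_le fun _ hx => H.pow_mem hx p) (commutator_le_left _ _)

lemma pow_mem_st {p : ℕ} {N H : Subgroup G} {x : G} (hx : x ∈ H) : x ^ p ∈ st p N H :=
  (le_sup_left : pw p H ≤ _) (pow_mem_pw hx)

lemma comm_le_st {p : ℕ} {N H : Subgroup G} : ⁅H, N⁆ ≤ st p N H := le_sup_right

lemma commutator_st_le {p : ℕ} {H N K : Subgroup G} [K.Normal] (hHN : H ≤ N)
    (h1 : ∀ x ∈ H, ∀ n ∈ N, ⁅x, n⁆ ^ p ∈ K) (h2 : ⁅⁅H, N⁆, N⁆ ≤ K) : ⁅st p N H, N⁆ ≤ K := by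
  refine commutator_sup_le ?_ h2
  refine le_cmod.mp (pw_le fun x hx => mem_cmod.mpr fun n hn => ?_)
  exact commutator_pow_mem
    (h2 (commutator_mem_commutator (commutator_mem_commutator hx hn) (hHN hx))) (h1 x hx n hn)

end Basic
end RankDer
namespace RankDer

open Subgroup
open scoped commutatorElement

section Count
variable {G : Type*} [Group G]

/-- The filtration. -/
def L (p : ℕ) (N H : Subgroup G) : ℕ → Subgroup G
  | 0 => H
  | i + 1 => st p N (L p N H i)

instance L_normal (p : ℕ) (N H : Subgroup G) [H.Normal] [N.Normal] (i : ℕ) :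
    (L p N H i).Normal := by
  induction i with
  | zero => simpa [L]
  | succ i ih => unfold L; infer_instance

lemma L_succ_le (p : ℕ) (N H : Subgroup G) [H.Normal] [N.Normal] (i : ℕ) :
    L p N H (i + 1) ≤ L p N H i := st_le p N _

lemma L_le (p : ℕ) (N H : Subgroup G) [H.Normal] [N.Normal] (i : ℕ) :
    L p N H i ≤ H := by
  induction i with
  | zero => exact le_rfl
  | succ i ih => exact (L_succ_le p N H i).trans ih

lemma L_comm (p : ℕ) (N H : Subgroup G) [H.Normal] [N.Normal] (hHN : H ≤ N)
    (h : ⁅H, N⁆ ≤ L p N H 2) (i : ℕ) : ⁅L p N H i, N⁆ ≤ L p N H (i + 2) := by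
  induction i with
  | zero => exact h
  | succ i ih =>
    refine commutator_st_le ((L_le p N H i).trans hHN) ?_ ?_
    · intro x hx n hn
      exact pow_mem_st (ih (commutator_mem_commutator hx hn))
    · exact (commutator_mono ih le_rfl).trans comm_le_st

lemma L_comm_comm (p : ℕ) (N : Subgroup G) [N.Normal] (i : ℕ) :
    ⁅L p N N i, N⁆ ≤ L p N ⁅N, N⁆ i := by
  induction i with
  | zero => exact le_rfl
  | succ i ih =>
    refine commutator_st_le (L_le p N N i) ?_ ?_
    · intro x hx n hn
      exact pow_mem_st (ih (commutator_mem_commutator hx hn))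
    · exact (commutator_mono ih le_rfl).trans comm_le_st

/-- Counting step. -/
lemma count_step [Finite G] {p : ℕ} {N A : Subgroup G} [N.Normal] [A.Normal] (hAN : A ≤ N)
    (h : ⁅A, N⁆ ≤ st p N (st p N A)) {E : Subgroup G} (hE : ∀ x ∈ E, x ^ p = 1)
    (hB : Nat.card (E ⊓ st p N A : Subgroup G) ≤ (st p N (st p N A)).relIndex (st p N A)) :
    Nat.card (E ⊓ A : Subgroup G) ≤ (st p N A).relIndex A := by
  set B := st p N A with hBdef
  set C := st p N B with hCdef
  have hBA : B ≤ A := st_le p N A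
  let f : A →* G ⧸ C :=
    { toFun := fun x => QuotientGroup.mk' C ((x : G) ^ p)
      map_one' := by simp
      map_mul' := by
        intro x y
        have hc : Commute (QuotientGroup.mk' C (x : G)) (QuotientGroup.mk' C (y : G)) :=
          commute_mk (h (commutator_mem_commutator x.2 (hAN y.2)))
        rw [Subgroup.coe_mul, map_pow, map_mul, hc.mul_pow, map_pow, map_pow] }
  have hf : ∀ x : A, f x = QuotientGroup.mk' C ((x : G) ^ p) := fun _ => rfl
  -- the kernel, as a subgroup of `G`
  set Kf : Subgroup G := f.ker.map A.subtype with hKf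
  have hKfA : Kf ≤ A := map_subtype_le _
  have hKmem : ∀ x ∈ A, x ^ p ∈ C → x ∈ Kf := by
    intro x hx hxp
    refine ⟨⟨x, hx⟩, ?_, rfl⟩
    exact (QuotientGroup.eq_one_iff _).mpr hxp
  have hBK : B ≤ Kf := fun x hx => hKmem x (hBA hx) (pow_mem_st hx)
  have hEK : E ⊓ A ≤ Kf := fun x hx => hKmem x hx.2 (by rw [hE x hx.1]; exact C.one_mem)
  have hKidx : Kf.relIndex A = Nat.card f.range := by
    rw [← index_ker, hKf, relIndex]
    congr 1
    ext x
    simp [mem_subgroupOf]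
  have hCB : C.relIndex B ≤ Kf.relIndex A := by
    have e : C.relIndex B = Nat.card (B.map (QuotientGroup.mk' C)) := by
      rw [← relIndex_ker, QuotientGroup.ker_mk']
    rw [e, hKidx]
    have hle : B.map (QuotientGroup.mk' C) ≤ f.range := by
      rw [map_le_iff_le_comap]
      refine sup_le (pw_le fun x hx => ⟨⟨x, hx⟩, rfl⟩) (h.trans fun x hx => ?_)
      have : QuotientGroup.mk' C x = 1 := (QuotientGroup.eq_one_iff _).mpr hx
      rw [mem_comap, this]
      exact one_mem _
    exact Nat.card_le_card_of_injective _ (inclusion_injective hle)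
  have hEB : Nat.card (E ⊓ A : Subgroup G) = Nat.card (E ⊓ B : Subgroup G) * B.relIndex (E ⊓ A) := by
    have h1 : E ⊓ B = B ⊓ (E ⊓ A) := by
      rw [inf_comm E B, ← inf_assoc, inf_right_comm, inf_of_le_left hBA]
    rw [h1, ← inf_relIndex_right, ← relIndex_bot_left, ← relIndex_bot_left,
      relIndex_mul_relIndex _ _ _ bot_le inf_le_right]
  calc Nat.card (E ⊓ A : Subgroup G) = Nat.card (E ⊓ B : Subgroup G) * B.relIndex (E ⊓ A) := hEB
    _ ≤ Kf.relIndex A * B.relIndex Kf := by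
        refine Nat.mul_le_mul (hB.trans hCB) ?_
        exact relIndex_le_of_le_right hEK (by simp [relIndex, index_ne_zero_of_finite])
    _ = B.relIndex A := by rw [mul_comm]; exact relIndex_mul_relIndex _ _ _ hBK hKfA

/-- In a nilpotent group, `A ≤ [A,G] T` implies `A ≤ T`. -/
lemma le_of_le_comm_sup [hG : Group.IsNilpotent G] {A T : Subgroup G} [T.Normal]
    (h : A ≤ ⁅A, (⊤ : Subgroup G)⁆ ⊔ T) : A ≤ T := by
  obtain ⟨n, hn⟩ := Subgroup.nilpotent_iff_lowerCentralSeries.mp hG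
  have key : ∀ k, A ≤ (⊤ : Subgroup G).lowerCentralSeries k ⊔ T := by
    intro k
    induction k with
    | zero => simp
    | succ k ih =>
      refine h.trans (sup_le ?_ le_sup_right)
      refine (commutator_mono ih le_rfl).trans ?_
      refine commutator_sup_le ?_ ((commutator_le_left _ _).trans le_sup_right)
      rw [Subgroup.lowerCentralSeries_succ]
      exact le_sup_left
  have := key n
  rwa [hn, bot_sup_eq] at this

/-- A finite nilpotent group generated by `p`-th powers has order prime to `p`. -/
lemma not_dvd_card_of_pw [Finite G] [hG : Group.IsNilpotent G] {p : ℕ} [hp : Fact p.Prime]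
    (h : pw p (⊤ : Subgroup G) = ⊤) : ¬ p ∣ Nat.card G := by
  intro hdvd
  have hs := ((Group.isNilpotent_of_finite_tfae (G := G)).out 0 4).mp hG
  obtain ⟨e⟩ := hs
  let P : Sylow p G := default
  have hpm : p ∈ (Nat.card G).primeFactors :=
    Nat.mem_primeFactors.mpr ⟨hp.out, hdvd, Nat.card_pos.ne'⟩
  let g1 : G →* P :=
    ((Pi.evalMonoidHom (fun Q : Sylow p G => (Q : Subgroup G)) P).comp
      (Pi.evalMonoidHom (fun q : (Nat.card G).primeFactors =>
        ∀ Q : Sylow q G, (Q : Subgroup G)) ⟨p, hpm⟩)).comp e.symm.toMonoidHom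
  have hg1 : Function.Surjective g1 := by
    have s1 : Function.Surjective (Pi.evalMonoidHom (fun Q : Sylow p G => (Q : Subgroup G)) P) :=
      Function.surjective_eval _
    have s2 : Function.Surjective (Pi.evalMonoidHom (fun q : (Nat.card G).primeFactors =>
        ∀ Q : Sylow q G, (Q : Subgroup G)) ⟨p, hpm⟩) := Function.surjective_eval _
    intro y
    obtain ⟨y1, h1⟩ := s1 y
    obtain ⟨y2, h2⟩ := s2 y1
    refine ⟨e y2, ?_⟩
    rw [← h1, ← h2]
    simp [g1]
  let g : G →* Abelianization P := Abelianization.of.comp g1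
  have hg : Function.Surjective g := by
    intro y
    obtain ⟨y1, h1⟩ := QuotientGroup.mk'_surjective _ y
    obtain ⟨y2, h2⟩ := hg1 y1
    refine ⟨y2, ?_⟩
    rw [← h1, ← h2]
    rfl
  have hPn : Nontrivial P := by
    rw [← Finite.one_lt_card_iff_nontrivial]
    have h1 := P.dvd_card_of_dvd_card hdvd
    exact lt_of_lt_of_le hp.out.one_lt (Nat.le_of_dvd Nat.card_pos h1)
  have hPnil : Group.IsNilpotent P := P.isPGroup'.isNilpotent
  have hQn : Nontrivial (Abelianization P) := by
    have := Group.IsSolvable.commutator_lt_top_of_nontrivial P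
    exact QuotientGroup.nontrivial_iff.mpr this.ne
  have hQp : IsPGroup p (Abelianization P) := P.isPGroup'.to_quotient _
  have hsurj : Function.Surjective (powMonoidHom p : Abelianization P →* Abelianization P) := by
    have h1 : pw p (⊤ : Subgroup G) ≤
        (powMonoidHom p : Abelianization P →* Abelianization P).range.comap g :=
      pw_le fun x _ => ⟨g x, by simp⟩
    rw [h] at h1
    intro y
    obtain ⟨x, rfl⟩ := hg y
    exact h1 (mem_top x)
  have hinj := Finite.injective_iff_surjective.mpr hsurj
  have hdQ : p ∣ Nat.card (Abelianization P) := by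
    obtain ⟨n, hn⟩ := IsPGroup.iff_card.mp hQp
    have h1 := Finite.one_lt_card_iff_nontrivial.mpr hQn
    rcases n with _ | n
    · simp [hn] at h1
    · rw [hn]; exact dvd_pow_self p (Nat.succ_ne_zero n)
  obtain ⟨x, hx⟩ := exists_prime_orderOf_dvd_card' p hdQ
  have hx1 : x = 1 := hinj (by simp [← hx, pow_orderOf_eq_one])
  rw [hx1, orderOf_one] at hx
  exact hp.out.one_lt.ne hx

lemma inf_eq_bot_of_stable [Finite G] [hG : Group.IsNilpotent G] {p : ℕ} [hp : Fact p.Prime]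
    {A N E : Subgroup G} [A.Normal] (h : A ≤ st p N A)
    (hE : ∀ x ∈ E, x ^ p = 1) : E ⊓ A = ⊥ := by
  have h1 : A ≤ pw p A := by
    refine le_of_le_comm_sup (h.trans ?_)
    unfold st
    rw [sup_comm]
    exact sup_le_sup_right (commutator_mono le_rfl le_top) _
  have h2 : pw p (⊤ : Subgroup A) = ⊤ := by
    rw [eq_top_iff, ← Subgroup.map_le_map_iff_of_injective A.subtype_injective]
    refine le_trans ?_ (h1.trans (pw_le ?_))
    · exact map_subtype_le _
    · intro x hx
      exact ⟨⟨x, hx⟩ ^ p, pow_mem_pw (mem_top _), rfl⟩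
  have h3 := not_dvd_card_of_pw h2
  rw [eq_bot_iff]
  intro x hx
  by_contra hne
  have ho : orderOf x = p := orderOf_eq_prime (hE x hx.1) hne
  apply h3
  rw [← ho, ← Subgroup.orderOf_mk x hx.2]
  exact orderOf_dvd_natCard _

lemma count [Finite G] [hG : Group.IsNilpotent G] {p : ℕ} [hp : Fact p.Prime]
    {N H E : Subgroup G} [N.Normal] [H.Normal] (hHN : H ≤ N)
    (h : ⁅H, N⁆ ≤ L p N H 2) (hE : ∀ x ∈ E, x ^ p = 1) :
    Nat.card (E ⊓ H : Subgroup G) ≤ (st p N H).relIndex H := by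
  have hanti : Antitone (L p N H) := antitone_nat_of_succ_le (L_succ_le p N H)
  obtain ⟨n, hn⟩ := WellFoundedGT.monotone_chain_condition
    (⟨fun i => OrderDual.toDual (L p N H i), hanti⟩ : ℕ →o (Subgroup G)ᵒᵈ)
  have hn1 : L p N H n = L p N H (n + 1) := hn (n + 1) (Nat.le_succ n)
  have key : ∀ k ≤ n, Nat.card (E ⊓ L p N H (n - k) : Subgroup G) ≤
      (L p N H (n - k + 1)).relIndex (L p N H (n - k)) := by
    intro k
    induction k with
    | zero =>
      intro _
      have := inf_eq_bot_of_stable (A := L p N H n) (N := N) (E := E) hn1.le hE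
      rw [Nat.sub_zero, this, card_bot]
      exact Nat.one_le_iff_ne_zero.mpr (by simp [relIndex, index_ne_zero_of_finite])
    | succ k ih =>
      intro hk
      have hk2 : n - k = n - (k + 1) + 1 := by omega
      have ih2 := ih (by omega)
      rw [hk2] at ih2
      exact count_step ((L_le p N H _).trans hHN) (L_comm p N H hHN h _) hE ih2
  have := key n le_rfl
  rw [Nat.sub_self] at this
  exact this

end Count
end RankDer
namespace RankDer

open Subgroup
open scoped commutatorElement

section Sections
variable {G : Type*} [Group G]

lemma three_subgroups {A B C K : Subgroup G} [K.Normal] (h1 : ⁅⁅B, C⁆, A⁆ ≤ K)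
    (h2 : ⁅⁅C, A⁆, B⁆ ≤ K) : ⁅⁅A, B⁆, C⁆ ≤ K := by
  have hm : ∀ X : Subgroup G, X ≤ K ↔ X.map (QuotientGroup.mk' K) = ⊥ := fun X => by
    rw [Subgroup.map_eq_bot_iff, QuotientGroup.ker_mk']
  rw [hm, map_commutator, map_commutator] at *
  exact commutator_commutator_eq_bot_of_rotate h1 h2

/-- Iterated commutator of `A` with the whole group. -/
def cc : ℕ → Subgroup G → Subgroup G
  | 0, A => A
  | n + 1, A => cc n ⁅A, (⊤ : Subgroup G)⁆

lemma cc_succ (n : ℕ) (A : Subgroup G) : cc (n + 1) A = ⁅cc n A, (⊤ : Subgroup G)⁆ := by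
  induction n generalizing A with
  | zero => rfl
  | succ n ih => exact ih _

lemma cc_mono (n : ℕ) {A B : Subgroup G} (h : A ≤ B) : cc n A ≤ cc n B := by
  induction n generalizing A B with
  | zero => exact h
  | succ n ih => exact ih (commutator_mono h le_rfl)

instance cc_normal (n : ℕ) (A : Subgroup G) [A.Normal] : (cc n A).Normal := by
  induction n with
  | zero => assumption
  | succ n ih => rw [cc_succ]; infer_instance

lemma comm_lcs_le_cc (n : ℕ) (A : Subgroup G) [A.Normal] :
    ⁅A, (⊤ : Subgroup G).lowerCentralSeries n⁆ ≤ cc (n + 1) A := by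
  induction n generalizing A with
  | zero => exact le_rfl
  | succ n ih =>
    rw [Subgroup.lowerCentralSeries_succ, commutator_comm]
    refine three_subgroups ?_ ?_
    · rw [commutator_comm ⊤ A]
      exact ih ⁅A, ⊤⁆
    · rw [cc_succ]
      exact commutator_mono (ih A) le_rfl

lemma cc_le_of_dvd [Finite G] [Group.IsNilpotent G] {p : ℕ} (hp : p.Prime) (k : ℕ)
    {A B : Subgroup G} [A.Normal] [B.Normal] (hBA : B ≤ A) (h : B.relIndex A ∣ p ^ k) :
    cc k A ≤ B := by
  induction k generalizing A with
  | zero =>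
    rw [pow_zero, Nat.dvd_one, relIndex_eq_one] at h
    exact h
  | succ k ih =>
    by_cases hA : A ≤ ⁅A, (⊤ : Subgroup G)⁆ ⊔ B
    · have h1 : A ≤ B := le_of_le_comm_sup hA
      have h2 : cc (k + 1) A ≤ A := by
        clear h ih hA h1
        generalize k + 1 = m
        induction m with
        | zero => exact le_rfl
        | succ m ihm => rw [cc_succ]; exact (commutator_le_left _ _).trans ihm
      exact h2.trans h1
    · have hle : ⁅A, (⊤ : Subgroup G)⁆ ⊔ B ≤ A := sup_le (commutator_le_left _ _) hBA
      have hmul := relIndex_mul_relIndex B _ A le_sup_right hle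
      have hne : (⁅A, (⊤ : Subgroup G)⁆ ⊔ B).relIndex A ≠ 1 := by
        rw [Ne, relIndex_eq_one]; exact hA
      have hd : B.relIndex (⁅A, (⊤ : Subgroup G)⁆ ⊔ B) ∣ p ^ k := by
        obtain ⟨i, hi, hi2⟩ := (Nat.dvd_prime_pow hp).mp ((Dvd.intro _ hmul).trans h)
        obtain ⟨j, hj, hj2⟩ := (Nat.dvd_prime_pow hp).mp ((Dvd.intro_left _ hmul).trans h)
        rw [hi2]
        refine pow_dvd_pow p ?_
        have hj0 : j ≠ 0 := by
          rintro rfl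
          exact hne (by simpa using hj2)
        rw [← hmul, hi2, hj2, ← pow_add, Nat.pow_dvd_pow_iff_le_right hp.one_lt] at h
        omega
      exact (cc_mono k le_sup_left).trans (ih le_sup_right hd)

lemma map_eq_closure {A B : Subgroup G} [B.Normal] {S : Finset G} (hSA : (S : Set G) ⊆ A)
    (hA : A ≤ closure (S : Set G) ⊔ B) :
    A.map (QuotientGroup.mk' B) = closure (QuotientGroup.mk' B '' (S : Set G)) := by
  rw [← MonoidHom.map_closure]
  apply le_antisymm
  · refine (map_mono hA).trans ?_
    rw [Subgroup.map_sup]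
    refine sup_le le_rfl ?_
    have : B.map (QuotientGroup.mk' B) = ⊥ := by
      rw [Subgroup.map_eq_bot_iff, QuotientGroup.ker_mk']
    rw [this]
    exact bot_le
  · exact map_mono ((closure_le _).mpr hSA)

lemma map_comm {A B : Subgroup G} [B.Normal] (hc : ⁅A, A⁆ ≤ B)
    (x y : A.map (QuotientGroup.mk' B)) : x * y = y * x := by
  obtain ⟨_, ⟨x, hx, rfl⟩⟩ := x
  obtain ⟨_, ⟨y, hy, rfl⟩⟩ := y
  exact Subtype.ext (commute_mk (hc (commutator_mem_commutator hx hy)))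

lemma relIndex_dvd_pow [Finite G] {A B : Subgroup G} [B.Normal] {p n : ℕ} {S : Finset G}
    (hSA : (S : Set G) ⊆ A) (hA : A ≤ closure (S : Set G) ⊔ B) (hS : S.card ≤ n)
    (hc : ⁅A, A⁆ ≤ B) (hpw : ∀ x ∈ A, x ^ p ∈ B) : B.relIndex A ∣ p ^ n := by
  classical
  have e : B.relIndex A = Nat.card (A.map (QuotientGroup.mk' B)) := by
    rw [← relIndex_ker, QuotientGroup.ker_mk']
  rw [e]
  let _ : CommGroup (A.map (QuotientGroup.mk' B)) :=
    { (inferInstance : Group (A.map (QuotientGroup.mk' B))) with mul_comm := map_comm hc }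
  have h1 : Nat.card (A.map (QuotientGroup.mk' B)) ∣
      p ^ Group.rank (A.map (QuotientGroup.mk' B)) := by
    refine card_dvd_exponent_pow_rank' _ ?_
    rintro ⟨_, ⟨x, hx, rfl⟩⟩
    refine Subtype.ext ?_
    have : QuotientGroup.mk' B (x ^ p) = 1 := (QuotientGroup.eq_one_iff _).mpr (hpw x hx)
    rw [map_pow] at this
    exact this
  refine h1.trans (pow_dvd_pow p ?_)
  have h2 : Group.rank (closure ((S.image (QuotientGroup.mk' B) : Finset (G ⧸ B)) : Set (G ⧸ B)))
      ≤ (S.image (QuotientGroup.mk' B)).card := Subgroup.rank_closure_finset_le_card _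
  have h3 : A.map (QuotientGroup.mk' B) =
      closure ((S.image (QuotientGroup.mk' B) : Finset (G ⧸ B)) : Set (G ⧸ B)) := by
    rw [map_eq_closure hSA hA, Finset.coe_image]
  have h4 : Group.rank (A.map (QuotientGroup.mk' B)) = Group.rank (closure
      ((S.image (QuotientGroup.mk' B) : Finset (G ⧸ B)) : Set (G ⧸ B))) :=
    Group.rank_congr (MulEquiv.subgroupCongr h3)
  exact (h4.le.trans h2).trans (Finset.card_image_le.trans hS)

/-- `RS A B n`: the section `A B / B` has rank at most `n`. -/
def RS (A B : Subgroup G) (n : ℕ) : Prop :=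
  ∀ H ≤ A, ∃ S : Finset G, S.card ≤ n ∧ (S : Set G) ⊆ H ∧ H ≤ closure (S : Set G) ⊔ B

lemma RS.mono {A A' B : Subgroup G} {n : ℕ} (h : RS A B n) (hA : A' ≤ A) : RS A' B n :=
  fun H hH => h H (hH.trans hA)

lemma RS.trans {A B C : Subgroup G} [B.Normal] {m n : ℕ} (h1 : RS A B m)
    (h2 : RS (A ⊓ B) C n) : RS A C (m + n) := by
  classical
  intro H hH
  obtain ⟨S, hS, hSH, hS2⟩ := h1 H hH
  obtain ⟨T, hT, hTH, hT2⟩ := h2 (H ⊓ B) (inf_le_inf_right B hH)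
  refine ⟨S ∪ T, (Finset.card_union_le S T).trans (add_le_add hS hT), ?_, ?_⟩
  · rw [Finset.coe_union]
    exact Set.union_subset hSH (hTH.trans inf_le_left)
  · intro x hx
    obtain ⟨a, ha, b, hb, rfl⟩ := mem_sup_normal (hS2 hx)
    have haH : a ∈ H := (closure_le H).mpr hSH ha
    have hbH : b ∈ H := (H.mul_mem_cancel_left haH).mp hx
    have hb2 := hT2 ⟨hbH, hb⟩
    have e1 : closure (S : Set G) ≤ closure ((S ∪ T : Finset G) : Set G) :=
      closure_mono (by simp)
    have e2 : closure (T : Set G) ≤ closure ((S ∪ T : Finset G) : Set G) :=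
      closure_mono (by simp)
    exact mul_mem ((e1.trans le_sup_left) ha) (sup_le_sup_right e2 C hb2)

lemma lift_gens {H K : Subgroup G} [K.Normal] (T : Finset (G ⧸ K))
    (hT : closure (T : Set (G ⧸ K)) = H.map (QuotientGroup.mk' K)) :
    ∃ S : Finset G, S.card ≤ T.card ∧ (S : Set G) ⊆ H ∧ H ≤ closure (S : Set G) ⊔ K := by
  classical
  have hex : ∀ t : G ⧸ K, ∃ s : G, t ∈ T → s ∈ H ∧ QuotientGroup.mk' K s = t := by
    intro t
    by_cases ht : t ∈ T
    · have : t ∈ H.map (QuotientGroup.mk' K) := hT ▸ subset_closure ht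
      obtain ⟨s, hs, hst⟩ := this
      exact ⟨s, fun _ => ⟨hs, hst⟩⟩
    · exact ⟨1, fun h => absurd h ht⟩
  choose g hg using hex
  refine ⟨T.image g, Finset.card_image_le, ?_, ?_⟩
  · intro x hx
    obtain ⟨t, ht, rfl⟩ := Finset.mem_image.mp hx
    exact (hg t ht).1
  · have h1 : closure (T : Set (G ⧸ K)) ≤
        (closure ((T.image g : Finset G) : Set G)).map (QuotientGroup.mk' K) := by
      refine (closure_le _).mpr fun t ht => ?_
      exact ⟨g t, subset_closure (Finset.mem_image_of_mem g ht), (hg t ht).2⟩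
    rw [hT, map_le_iff_le_comap, comap_map_eq, QuotientGroup.ker_mk'] at h1
    exact h1

lemma RS_of_hasRankLE [Finite G] {K : Subgroup G} [K.Normal] {r : ℕ} (h : HasRankLE (G ⧸ K) r) :
    RS ⊤ K r := by
  intro H _
  obtain ⟨T, hT, hT2⟩ := h (H.map (QuotientGroup.mk' K)) ((Group.fg_iff_subgroup_fg _).mp inferInstance)
  obtain ⟨S, hS, h1, h2⟩ := lift_gens T hT2
  exact ⟨S, hS.trans hT, h1, h2⟩

lemma eq_closure_union {H Z : Subgroup G} [Z.Normal] {S : Finset G} (hS : (S : Set G) ⊆ H)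
    (h : H ≤ closure (S : Set G) ⊔ Z) :
    closure ((S : Set G) ∪ ((H ⊓ Z : Subgroup G) : Set G)) = H := by
  apply le_antisymm
  · exact (closure_le _).mpr (Set.union_subset hS inf_le_left)
  · intro x hx
    obtain ⟨a, ha, b, hb, rfl⟩ := mem_sup_normal (h hx)
    have haH : a ∈ H := (closure_le H).mpr hS ha
    have hbH : b ∈ H := (H.mul_mem_cancel_left haH).mp hx
    exact mul_mem (closure_mono Set.subset_union_left ha)
      (subset_closure (Or.inr ⟨hbH, hb⟩))

lemma commutator_gens {r : ℕ} (h : RS ⊤ (center G) r) {H K B : Subgroup G} [H.Normal]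
    (hB : ⁅H, ⁅H, K⁆⁆ ≤ B) :
    ∃ S : Finset G, S.card ≤ r * r ∧ (S : Set G) ⊆ (⁅H, K⁆ : Subgroup G) ∧
      ⁅H, K⁆ ≤ closure (S : Set G) ⊔ B := by
  classical
  obtain ⟨S, hS, hSH, hS2⟩ := h H le_top
  obtain ⟨T, hT, hTK, hT2⟩ := h K le_top
  refine ⟨(S ×ˢ T).image (fun q => ⁅q.1, q.2⁆), ?_, ?_, ?_⟩
  · refine Finset.card_image_le.trans ?_
    rw [Finset.card_product]
    exact Nat.mul_le_mul hS hT
  · intro x hx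
    obtain ⟨q, hq, rfl⟩ := Finset.mem_image.mp hx
    rw [Finset.mem_product] at hq
    exact commutator_mem_commutator (hSH hq.1) (hTK hq.2)
  · refine commutator_le_of_gens (eq_closure_union hSH hS2) (eq_closure_union hTK hT2)
      (commutator_le_left _ _) ?_ (hB.trans le_sup_right)
    intro s hs t ht
    have hone : ∀ z ∈ center G, ∀ y : G, ⁅z, y⁆ = 1 ∧ ⁅y, z⁆ = 1 := by
      intro z hz y
      rw [commutatorElement_eq_one_iff_commute, commutatorElement_eq_one_iff_commute]
      exact ⟨(mem_center_iff.mp hz y).symm, mem_center_iff.mp hz y⟩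
    rcases hs with hs | hs
    · rcases ht with ht | ht
      · refine (le_sup_left : _ ≤ Subgroup.closure _ ⊔ B) (subset_closure ?_)
        exact Finset.mem_coe.mpr (Finset.mem_image.mpr ⟨(s, t), Finset.mem_product.mpr ⟨hs, ht⟩, rfl⟩)
      · rw [(hone t ht.2 s).2]; exact one_mem _
    · rw [(hone s hs.2 t).1]; exact one_mem _

lemma addcomm_rank {M : Type*} [AddCommGroup M] (S : Finset M)
    (hS : Submodule.span ℤ (S : Set M) = ⊤) (N : Submodule ℤ M) :
    ∃ T : Finset M, T.card ≤ S.card ∧ Submodule.span ℤ (T : Set M) = N := by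
  let f : (S → ℤ) →ₗ[ℤ] M := Fintype.linearCombination ℤ (fun s : S => (s : M))
  have hf : LinearMap.range f = ⊤ := by
    rw [Fintype.range_linearCombination]
    simpa using hS
  have hN : (N.comap f).map f = N := Submodule.map_comap_eq_of_le (by rw [hf]; exact le_top)
  have hfg : (N.comap f).FG := IsNoetherian.noetherian _
  have h1 : N.spanFinrank ≤ S.card := by
    rw [← hN]
    refine (Submodule.spanFinrank_map_le_of_fg f hfg).trans ?_
    rw [← Submodule.spanFinrank_top, ← Module.finrank_eq_spanFinrank_of_free]
    refine (Submodule.finrank_le _).trans ?_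
    simp
  have hNfg : N.FG := by rw [← hN]; exact hfg.map f
  obtain ⟨T, hT, hT2⟩ := hNfg.exists_span_finset_card_eq_spanFinrank
  exact ⟨T, hT ▸ h1, hT2⟩

lemma comm_rank {M : Type*} [CommGroup M] (S : Finset M)
    (hS : closure (S : Set M) = ⊤) (N : Subgroup M) :
    ∃ T : Finset M, T.card ≤ S.card ∧ closure (T : Set M) = N := by
  have key : ∀ T : Set M, (Submodule.span ℤ (Additive.toMul ⁻¹' T)).toAddSubgroup
      = (closure T).toAddSubgroup := by
    intro T
    rw [Submodule.span_int_eq_addSubgroupClosure, Subgroup.toAddSubgroup_closure]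
  obtain ⟨T, hT, hT2⟩ := addcomm_rank (M := Additive M) (S.map Additive.ofMul.toEmbedding)
    (by
      apply Submodule.toAddSubgroup_injective
      have : ((S.map Additive.ofMul.toEmbedding : Finset (Additive M)) : Set (Additive M))
        = Additive.toMul ⁻¹' (S : Set M) := by
        ext x; simp
      rw [this, key, hS]
      rfl) (AddSubgroup.toIntSubmodule N.toAddSubgroup)
  refine ⟨T.map Additive.toMul.toEmbedding, by simpa using hT, ?_⟩
  apply Subgroup.toAddSubgroup.injective
  rw [← key]
  have : Additive.toMul ⁻¹' ((T.map Additive.toMul.toEmbedding : Finset M) : Set M)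
    = (T : Set (Additive M)) := by
    ext x; simp
  rw [this, hT2]
  rfl

lemma RS_of_comm {A B : Subgroup G} [B.Normal] {n : ℕ} {S : Finset G}
    (hSA : (S : Set G) ⊆ A) (hA : A ≤ closure (S : Set G) ⊔ B) (hS : S.card ≤ n)
    (hc : ⁅A, A⁆ ≤ B) : RS A B n := by
  classical
  intro H hH
  let Q := A.map (QuotientGroup.mk' B)
  let _ : CommGroup Q := { (inferInstance : Group Q) with mul_comm := map_comm hc }
  have hgen : ∃ S' : Finset Q, S'.card ≤ n ∧ closure (S' : Set Q) = ⊤ := by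
    refine ⟨(S.image (QuotientGroup.mk' B)).subtype (· ∈ Q), ?_, ?_⟩
    · rw [Finset.card_subtype]
      exact (Finset.card_filter_le _ _).trans (Finset.card_image_le.trans hS)
    · apply Subgroup.map_injective Q.subtype_injective
      rw [MonoidHom.map_closure, ← MonoidHom.range_eq_map, range_subtype]
      have e := map_eq_closure hSA hA
      refine Eq.trans ?_ e.symm
      congr 1
      ext x
      simp only [Set.mem_image, Finset.mem_coe, Finset.mem_subtype, Finset.mem_image]
      constructor
      · rintro ⟨y, hy, rfl⟩
        exact hy
      · rintro ⟨y, hy, rfl⟩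
        exact ⟨⟨_, mem_map_of_mem _ (hSA hy)⟩, ⟨y, hy, rfl⟩, rfl⟩
  obtain ⟨S', hS', hS'2⟩ := hgen
  obtain ⟨T, hT, hT2⟩ := comm_rank S' hS'2 ((H.map (QuotientGroup.mk' B)).subgroupOf Q)
  obtain ⟨R, hR, hR1, hR2⟩ := lift_gens (H := H) (K := B) (T.image Subtype.val) (by
    rw [Finset.coe_image]
    have := MonoidHom.map_closure Q.subtype (T : Set Q)
    rw [hT2, subgroupOf_map_subtype, inf_of_le_left (map_mono hH)] at this
    exact this.symm)
  exact ⟨R, hR.trans (Finset.card_image_le.trans (hT.trans hS')), hR1, hR2⟩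

end Sections
end RankDer
namespace RankDer

open Subgroup
open scoped commutatorElement

section Abelian
variable {M : Type*} [CommGroup M]

/-- The subgroup of `p`-th powers. -/
def Dp (p : ℕ) (M : Type*) [CommGroup M] : Subgroup M := (powMonoidHom p : M →* M).range

lemma pow_mem_Dp (p : ℕ) (x : M) : x ^ p ∈ Dp p M := ⟨x, rfl⟩

lemma card_quot_Dp [Finite M] (p : ℕ) :
    Nat.card (M ⧸ Dp p M) = Nat.card (powMonoidHom p : M →* M).ker := by
  have h1 := card_mul_index (powMonoidHom p : M →* M).ker
  have h2 := card_mul_index (powMonoidHom p : M →* M).range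
  rw [index_ker, mul_comm] at h1
  have h3 := h1.trans h2.symm
  exact (Nat.eq_of_mul_eq_mul_left Nat.card_pos h3).symm

lemma elem_gens [Finite M] {p k : ℕ} [hp : Fact p.Prime] (h1 : ∀ x : M, x ^ p = 1)
    (h2 : Nat.card M ≤ p ^ k) : ∃ y : Fin k → M, closure (Set.range y) = ⊤ := by
  let _ : Module (ZMod p) (Additive M) := AddCommGroup.zmodModule (n := p) (fun x => h1 x.toMul)
  have hcard : Nat.card (Additive M) = p ^ Module.finrank (ZMod p) (Additive M) := by
    have := Module.natCard_eq_pow_finrank (K := ZMod p) (V := Additive M)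
    rwa [Nat.card_zmod] at this
  have hle : Module.finrank (ZMod p) (Additive M) ≤ k := by
    have h3 : Nat.card (Additive M) ≤ p ^ k := h2
    rw [hcard] at h3
    exact (Nat.pow_le_pow_iff_right hp.out.one_lt).mp h3
  let b := Module.finBasis (ZMod p) (Additive M)
  let y : Fin k → M := fun i =>
    if h : (i : ℕ) < Module.finrank (ZMod p) (Additive M) then (b ⟨i, h⟩).toMul else 1
  refine ⟨y, ?_⟩
  let C := AddSubgroup.toZModSubmodule p (closure (Set.range y)).toAddSubgroup
  have hC : C = ⊤ := by
    rw [eq_top_iff, ← b.span_eq, Submodule.span_le]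
    rintro _ ⟨i, rfl⟩
    have : y ⟨i, i.2.trans_le hle⟩ = (b i).toMul := by simp [y]
    change (b i).toMul ∈ closure (Set.range y)
    rw [← this]
    exact subset_closure ⟨_, rfl⟩
  rw [eq_top_iff]
  intro x _
  have : Additive.ofMul x ∈ C := by rw [hC]; trivial
  exact this

lemma mod_gens [Finite M] {p k : ℕ} [hp : Fact p.Prime]
    (h2 : Nat.card (powMonoidHom p : M →* M).ker ≤ p ^ k) :
    ∃ y : Fin k → M, closure (Set.range y) ⊔ Dp p M = ⊤ := by
  obtain ⟨z, hz⟩ := elem_gens (M := M ⧸ Dp p M) (p := p) (k := k)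
    (by
      intro x
      obtain ⟨x, rfl⟩ := QuotientGroup.mk'_surjective _ x
      rw [← map_pow]
      exact (QuotientGroup.eq_one_iff _).mpr (pow_mem_Dp p x))
    (by rw [card_quot_Dp]; exact h2)
  choose y hy using fun i => QuotientGroup.mk'_surjective (Dp p M) (z i)
  refine ⟨y, ?_⟩
  have h1 : (closure (Set.range y)).map (QuotientGroup.mk' (Dp p M)) = ⊤ := by
    rw [MonoidHom.map_closure, ← hz, ← Set.range_comp]
    congr 1
    congr 1
    funext i
    exact hy i
  have h3 := congrArg (Subgroup.comap (QuotientGroup.mk' (Dp p M))) h1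
  rwa [comap_map_eq, QuotientGroup.ker_mk', comap_top] at h3

lemma mem_of_coprime {W : Subgroup M} {a p : ℕ} (hap : Nat.Coprime a p) (hW : Dp p M ≤ W) {z : M}
    (hz : z ^ a ∈ W) : z ∈ W := by
  have h : IsCoprime (a : ℤ) (p : ℤ) := Nat.isCoprime_iff_coprime.mpr hap
  obtain ⟨u, v, huv⟩ := h
  have e : z = (z ^ a) ^ u * (z ^ p) ^ v := by
    rw [← zpow_natCast, ← zpow_natCast, ← zpow_mul, ← zpow_mul, ← zpow_add,
      mul_comm (a : ℤ) u, mul_comm (p : ℤ) v, huv, zpow_one]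
  rw [e]
  exact W.mul_mem (W.zpow_mem hz u) (W.zpow_mem (hW (pow_mem_Dp p z)) v)

lemma multi_gens [Finite M] {k : ℕ}
    (h : ∀ p : ℕ, p.Prime → Nat.card (powMonoidHom p : M →* M).ker ≤ p ^ k)
    (s : Finset ℕ) (hs : ∀ p ∈ s, p.Prime) :
    ∃ x : Fin k → M, ∀ p ∈ s, closure (Set.range x) ⊔ Dp p M = ⊤ := by
  classical
  induction s using Finset.induction_on with
  | empty => exact ⟨fun _ => 1, by simp⟩
  | insert q s hq ih =>
    obtain ⟨x, hx⟩ := ih (fun p hp => hs p (Finset.mem_insert_of_mem hp))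
    have hqp : q.Prime := hs q (Finset.mem_insert_self q s)
    have : Fact q.Prime := ⟨hqp⟩
    obtain ⟨y, hy⟩ := mod_gens (h q hqp)
    set c := ∏ p ∈ s, p with hc
    refine ⟨fun j => x j ^ q * y j ^ c, ?_⟩
    set x' : Fin k → M := fun j => x j ^ q * y j ^ c with hx'
    intro p hp
    set W := closure (Set.range x') ⊔ Dp p M with hW
    have hDW : Dp p M ≤ W := le_sup_right
    have hxW : ∀ j, x j ^ q * y j ^ c ∈ W := fun j =>
      (le_sup_left : _ ≤ W) (subset_closure ⟨j, rfl⟩)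
    rw [eq_top_iff]
    rcases Finset.mem_insert.mp hp with rfl | hps
    · rw [← hy]
      refine sup_le ((closure_le _).mpr ?_) hDW
      rintro _ ⟨j, rfl⟩
      have h1 : y j ^ c ∈ W := (W.mul_mem_cancel_left (hDW (pow_mem_Dp p _))).mp (hxW j)
      refine mem_of_coprime ?_ hDW h1
      refine Nat.Coprime.prod_left fun t ht => ?_
      refine (Nat.coprime_primes (hs t (Finset.mem_insert_of_mem ht)) hqp).mpr ?_
      rintro rfl
      exact hq ht
    · rw [← hx p hps]
      refine sup_le ((closure_le _).mpr ?_) hDW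
      rintro _ ⟨j, rfl⟩
      obtain ⟨d, hd⟩ : p ∣ c := Finset.dvd_prod_of_mem _ hps
      have h0 : y j ^ c ∈ W := by
        rw [hd, mul_comm, pow_mul]; exact hDW (pow_mem_Dp p _)
      have h1 : x j ^ q ∈ W := (W.mul_mem_cancel_right h0).mp (hxW j)
      refine mem_of_coprime ?_ hDW h1
      refine (Nat.coprime_primes hqp (hs p hp)).mpr ?_
      rintro rfl
      exact hq hps

lemma abelian_gens [Finite M] {k : ℕ}
    (h : ∀ p : ℕ, p.Prime → Nat.card (powMonoidHom p : M →* M).ker ≤ p ^ k) :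
    ∃ x : Fin k → M, closure (Set.range x) = ⊤ := by
  obtain ⟨x, hx⟩ := multi_gens h (Nat.card M).primeFactors
    (fun p hp => Nat.prime_of_mem_primeFactors hp)
  refine ⟨x, ?_⟩
  set C := closure (Set.range x) with hC
  by_contra hne
  have hidx : C.index ≠ 1 := fun h1 => hne (index_eq_one.mp h1)
  obtain ⟨p, hp, hpd⟩ := Nat.exists_prime_and_dvd hidx
  have : Fact p.Prime := ⟨hp⟩
  have hpm : p ∈ (Nat.card M).primeFactors :=
    Nat.mem_primeFactors.mpr ⟨hp, hpd.trans C.index_dvd_card, Nat.card_pos.ne'⟩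
  have htop := hx p hpm
  have hsurj : Function.Surjective (powMonoidHom p : M ⧸ C →* M ⧸ C) := by
    intro y
    obtain ⟨y, rfl⟩ := QuotientGroup.mk'_surjective _ y
    have hy : y ∈ C ⊔ Dp p M := by rw [htop]; trivial
    obtain ⟨a, ha, _, ⟨b, rfl⟩, rfl⟩ := mem_sup_normal hy
    refine ⟨QuotientGroup.mk' C b, ?_⟩
    have : QuotientGroup.mk' C a = 1 := (QuotientGroup.eq_one_iff _).mpr ha
    rw [map_mul, this, one_mul]
    simp
  have hinj := Finite.injective_iff_surjective.mpr hsurj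
  obtain ⟨z, hz⟩ := exists_prime_orderOf_dvd_card' (G := M ⧸ C) p hpd
  have hz1 : z = 1 := hinj (by simp [← hz, pow_orderOf_eq_one])
  rw [hz1, orderOf_one] at hz
  exact hp.one_lt.ne hz

end Abelian

section Final
variable {G : Type*} [Group G]

/-- Rank of a finite central subgroup via its `p`-torsion. -/
lemma RS_central [Finite G] {A : Subgroup G} (hA : A ≤ center G) {k : ℕ}
    (h : ∀ p : ℕ, p.Prime → ∀ E ≤ A, (∀ x ∈ E, x ^ p = 1) → Nat.card E ≤ p ^ k) : RS A ⊥ k := by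
  classical
  intro H hH
  let _ : CommGroup H := { (inferInstance : Group H) with
    mul_comm := fun x y => Subtype.ext (mem_center_iff.mp (hA (hH y.2)) x) }
  obtain ⟨x, hx⟩ := abelian_gens (M := H) (k := k) (by
    intro p hp
    have h1 := h p hp ((powMonoidHom p : H →* H).ker.map H.subtype)
      ((map_subtype_le _).trans hH) (by
        rintro _ ⟨x, hx, rfl⟩
        have : x ^ p = 1 := hx
        simpa using congrArg Subtype.val this)
    refine le_trans (le_of_eq ?_) h1
    exact Nat.card_congr
      ((powMonoidHom p : H →* H).ker.equivMapOfInjective _ H.subtype_injective).toEquiv)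
  refine ⟨Finset.univ.image (fun i => (x i : G)), ?_, ?_, ?_⟩
  · exact Finset.card_image_le.trans (by simp)
  · intro y hy
    simp only [Finset.coe_image, Finset.coe_univ, Set.image_univ, Set.mem_range] at hy
    obtain ⟨i, rfl⟩ := hy
    exact (x i).2
  · rw [sup_bot_eq]
    have h1 := MonoidHom.map_closure H.subtype (Set.range x)
    rw [hx, ← MonoidHom.range_eq_map, range_subtype, ← Set.range_comp] at h1
    refine h1.le.trans (closure_mono ?_)
    rintro _ ⟨i, rfl⟩
    simp

lemma relIndex_st_dvd [Finite G] {r : ℕ} (h : RS ⊤ (center G) r) {p : ℕ} {N X : Subgroup G}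
    [N.Normal] [X.Normal] (hXN : X ≤ N) :
    (st p N X ⊔ center G).relIndex (X ⊔ center G) ∣ p ^ r := by
  obtain ⟨S, hS, hSX, hS2⟩ := h X le_top
  have h1 : (st p N X ⊔ center G).relIndex X ∣ p ^ r := by
    refine relIndex_dvd_pow hSX ?_ hS ?_ ?_
    · exact hS2.trans (sup_le_sup_left le_sup_right _)
    · exact (commutator_mono le_rfl hXN).trans (comm_le_st.trans le_sup_left)
    · intro x hx
      exact (le_sup_left : st p N X ≤ _) (pow_mem_st hx)
  have h2 : X ⊔ center G ≤ X ⊔ (st p N X ⊔ center G) := sup_le_sup_left le_sup_right _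
  have h3 : X ⊔ (st p N X ⊔ center G) = X ⊔ center G := by
    rw [← sup_assoc, sup_of_le_left (st_le p N X)]
  rw [← relIndex_sup_right, h3] at h1
  exact h1

lemma main [Finite G] [Group.IsNilpotent G] {r : ℕ} (h : RS ⊤ (center G) r) :
    RS (commutator G) ⊥ (2 * r * (r * r) + (r * r + (r + r * r))) := by
  set N := (⊤ : Subgroup G).lowerCentralSeries (2 * r) with hN
  set P := ⁅N, N⁆ with hP
  have hPN : P ≤ N := commutator_le_left _ _
  -- the bottom piece
  have hbot : RS (P ⊓ center G) ⊥ (r * r) := by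
    refine RS_central inf_le_right ?_
    intro p hp E hE hEp
    have : Fact p.Prime := ⟨hp⟩
    have hPc : P ≤ L p N N 2 ⊔ center G := by
      have h1 : (L p N N 2 ⊔ center G).relIndex (N ⊔ center G) ∣ p ^ (2 * r) := by
        rw [← relIndex_mul_relIndex (L p N N 2 ⊔ center G) (L p N N 1 ⊔ center G) (N ⊔ center G)
          (sup_le_sup_right (L_succ_le p N N 1) _) (sup_le_sup_right (L_succ_le p N N 0) _),
          two_mul, pow_add]
        exact Nat.mul_dvd_mul (relIndex_st_dvd h (L_le p N N 1)) (relIndex_st_dvd h le_rfl)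
      have h2 : cc (2 * r) (N ⊔ center G) ≤ L p N N 2 ⊔ center G :=
        cc_le_of_dvd hp _ (sup_le_sup_right (L_le p N N 2) _) h1
      have h3 := comm_lcs_le_cc (2 * r) (N ⊔ center G)
      rw [← hN, cc_succ] at h3
      calc P ≤ ⁅N ⊔ center G, N⁆ := commutator_mono le_sup_left le_rfl
        _ ≤ _ := h3
        _ ≤ cc (2 * r) (N ⊔ center G) := commutator_le_left _ _
        _ ≤ _ := h2
    have hP2 : ⁅P, N⁆ ≤ L p N P 2 := by
      refine (commutator_mono hPc le_rfl).trans (commutator_sup_le (L_comm_comm p N 2) ?_)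
      rw [commutator_le]
      intro z hz n _
      have : ⁅z, n⁆ = 1 := by
        rw [commutatorElement_eq_one_iff_commute]
        exact (mem_center_iff.mp hz n).symm
      rw [this]
      exact one_mem _
    have hcount := count hPN hP2 hEp
    rw [inf_of_le_left (hE.trans inf_le_left)] at hcount
    refine hcount.trans (Nat.le_of_dvd (pow_pos hp.pos _) ?_)
    obtain ⟨S, hS, hSP, hS2⟩ := commutator_gens (H := N) (K := N) (B := st p N P) h
      (by rw [commutator_comm]; exact comm_le_st)
    exact relIndex_dvd_pow hSP hS2 hS ((commutator_mono le_rfl hPN).trans comm_le_st)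
      (fun x hx => pow_mem_st hx)
  have hPr : RS P ⊥ (r + r * r) := (h.mono le_top).trans hbot
  -- the layer `[N, G] / [N, N]`
  have hlay : RS ((⊤ : Subgroup G).lowerCentralSeries (2 * r + 1)) ⊥ (r * r + (r + r * r)) := by
    refine RS.trans (B := P) ?_ (hPr.mono inf_le_right)
    rw [Subgroup.lowerCentralSeries_succ]
    obtain ⟨S, hS, hSP, hS2⟩ := commutator_gens (H := N) (K := ⊤) (B := P) h
      (commutator_mono le_rfl (commutator_le_left _ _))
    exact RS_of_comm hSP hS2 hS (commutator_mono (commutator_le_left _ _) (commutator_le_left _ _))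
  -- the lower central layers
  have hdown : ∀ k ≤ 2 * r, RS ((⊤ : Subgroup G).lowerCentralSeries (2 * r + 1 - k)) ⊥
      (k * (r * r) + (r * r + (r + r * r))) := by
    intro k
    induction k with
    | zero => intro _; simpa using hlay
    | succ k ih =>
      intro hk
      obtain ⟨m, hm⟩ : ∃ m, 2 * r + 1 - (k + 1) = m + 1 := ⟨2 * r - (k + 1), by omega⟩
      have hm2 : 2 * r + 1 - k = m + 1 + 1 := by omega
      have ih2 := ih (by omega)
      rw [hm2] at ih2
      rw [hm]
      have e : (k + 1) * (r * r) + (r * r + (r + r * r)) =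
          r * r + (k * (r * r) + (r * r + (r + r * r))) := by ring
      rw [e]
      refine RS.trans (B := (⊤ : Subgroup G).lowerCentralSeries (m + 1 + 1)) ?_
        (ih2.mono inf_le_right)
      have hsucc := Subgroup.lowerCentralSeries_succ (⊤ : Subgroup G) (m + 1)
      have hsucc2 := Subgroup.lowerCentralSeries_succ (⊤ : Subgroup G) m
      obtain ⟨S, hS, hSP, hS2⟩ := commutator_gens
        (H := (⊤ : Subgroup G).lowerCentralSeries m) (K := ⊤)
        (B := (⊤ : Subgroup G).lowerCentralSeries (m + 1 + 1)) h
        (by rw [hsucc, ← hsucc2, commutator_comm]; exact commutator_mono le_rfl le_top)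
      rw [← hsucc2] at hSP hS2
      exact RS_of_comm hSP hS2 hS (by rw [hsucc]; exact commutator_mono le_rfl le_top)
  have := hdown (2 * r) le_rfl
  have e : 2 * r + 1 - 2 * r = 1 := by omega
  rw [e, Subgroup.top_lowerCentralSeries_one] at this
  exact this

end Final
end RankDer

/-- If `G` is a finite nilpotent group with `G/Z(G)` of rank `r`, then
the rank of `G'` is bounded in terms of `r` only. -/
theorem rank_derived_of_nilpotent_bounded :
    ∃ f : ℕ → ℕ, ∀ (G : Type) [Group G] [Fintype G], Group.IsNilpotent G →
      ∀ r : ℕ, HasRankLE (G ⧸ Subgroup.center G) r →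
        HasRankLE (commutator G) (f r) := by
  classical
  refine ⟨fun r => 2 * r * (r * r) + (r * r + (r + r * r)), ?_⟩
  intro G _ _ hG r hr H _
  have h := RankDer.main (RankDer.RS_of_hasRankLE hr)
  obtain ⟨S, hS, hSH, hS2⟩ := h (H.map (commutator G).subtype) (Subgroup.map_subtype_le _)
  rw [sup_bot_eq] at hS2
  refine ⟨S.subtype (· ∈ commutator G), ?_, ?_⟩
  · rw [Finset.card_subtype]
    exact (Finset.card_filter_le _ _).trans hS
  · apply Subgroup.map_injective (commutator G).subtype_injective
    rw [MonoidHom.map_closure]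
    have e : (commutator G).subtype '' ((S.subtype (· ∈ commutator G) : Finset (commutator G)) :
        Set (commutator G)) = (S : Set G) := by
      ext x
      simp only [Set.mem_image, Finset.mem_coe, Finset.mem_subtype]
      constructor
      · rintro ⟨y, hy, rfl⟩
        exact hy
      · intro hx
        exact ⟨⟨x, Subgroup.map_subtype_le _ (hSH hx)⟩, hx, rfl⟩
    rw [e]
    exact le_antisymm ((Subgroup.closure_le _).mpr hSH) hS2
end

section
/- Let G be a finite soluble group of rank r. Then the derived length of G/F(G), where F(G) is the Fitting subgroup of G, is bounded by a function of r only. -/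
theorem derivedSeries_le_ker_of_card {G P : Type*} [Group G] [Group P] [Finite P]
    (hG : Group.IsSolvable G) (φ : G →* P) (M : ℕ) (hM : Nat.card P ≤ M) :
    derivedSeries G M ≤ φ.ker := by
  have hmono : ∀ i, (derivedSeries G (i+1)).map φ ≤ (derivedSeries G i).map φ := fun i =>
    Subgroup.map_mono (derivedSeries_antitone G (Nat.le_succ i))
  have key : ∀ i, (derivedSeries G i).map φ = ⊥ ∨ Nat.card ((derivedSeries G i).map φ) + i ≤ Nat.card P := by
    intro i
    induction i with
    | zero => exact Or.inr (Subgroup.card_le_card_group ((derivedSeries G 0).map φ))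
    | succ i ih =>
      by_cases hb : (derivedSeries G (i+1)).map φ = ⊥
      · exact Or.inl hb
      right
      rcases ih with h | h
      · exact absurd (le_bot_iff.mp (h ▸ hmono i)) hb
      have hne : (derivedSeries G (i+1)).map φ ≠ (derivedSeries G i).map φ := by
        intro he
        have hst : ∀ j, (derivedSeries G (i+j)).map φ = (derivedSeries G i).map φ := by
          intro j
          induction j with
          | zero => rfl
          | succ j ihj =>
            rw [← add_assoc, derivedSeries_succ, Subgroup.map_commutator, ihj,
              ← Subgroup.map_commutator, ← derivedSeries_succ, he]
        obtain ⟨n, hn⟩ := hG.solvable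
        have h1 : derivedSeries G (i+n) = ⊥ :=
          le_bot_iff.mp (hn ▸ derivedSeries_antitone G (Nat.le_add_left n i))
        apply hb
        rw [he, ← hst n, h1, Subgroup.map_bot]
      have hlt : Nat.card ((derivedSeries G (i+1)).map φ) < Nat.card ((derivedSeries G i).map φ) := by
        by_contra hc
        exact hne (Subgroup.eq_of_le_of_card_ge (hmono i) (not_lt.mp hc))
      omega
  have : (derivedSeries G M).map φ = ⊥ := by
    rcases key M with h | h
    · exact h
    · have := Nat.card_pos (α := (derivedSeries G M).map φ)
      omega
  exact (Subgroup.map_eq_bot_iff _).mp this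

theorem derivedSeries_add_le {G : Type*} [Group G] (H : Subgroup G) (a b : ℕ)
    (h : derivedSeries G a ≤ H) : derivedSeries G (a + b) ≤ (derivedSeries H b).map H.subtype := by
  induction b with
  | zero => simpa [← MonoidHom.range_eq_map] using h
  | succ b ih =>
    rw [← add_assoc, derivedSeries_succ, derivedSeries_succ, Subgroup.map_commutator]
    exact Subgroup.commutator_mono ih ih

section
variable {K U G : Type*} [Field K] [AddCommGroup U] [Module K U] [Group G]

def wtSpace (σ : G →* Module.End K U) (A : Subgroup G) (χ : A → K) : Submodule K U :=
  ⨅ a : A, (σ a).eigenspace (χ a)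

theorem mem_wtSpace {σ : G →* Module.End K U} {A : Subgroup G} {χ : A → K} {u : U} :
    u ∈ wtSpace σ A χ ↔ ∀ a : A, σ a u = χ a • u := by
  simp [wtSpace]

theorem hom_inv_apply (σ : G →* Module.End K U) (g : G) (u : U) : σ g⁻¹ (σ g u) = u := by
  rw [← Module.End.mul_apply, ← map_mul]; simp

theorem hom_apply_inv (σ : G →* Module.End K U) (g : G) (u : U) : σ g (σ g⁻¹ u) = u := by
  rw [← Module.End.mul_apply, ← map_mul]; simp

theorem wtSpace_indep (σ : G →* Module.End K U) (A : Subgroup G)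
    (hA : ∀ a ∈ A, ∀ b ∈ A, σ a * σ b = σ b * σ a) : iSupIndep (wtSpace σ A) := by
  have := Module.End.independent_iInf_maxGenEigenspace_of_forall_mapsTo
    (fun a : A => σ a) (fun i j φ => Module.End.mapsTo_maxGenEigenspace_of_comm
      (hA j j.2 i i.2) φ)
  refine this.mono fun χ => iInf_mono fun a => ?_
  exact (Module.End.genEigenspace _ _).mono le_top

/-- conjugate weight -/
def conjWt (A : Subgroup G) (hA : A.Normal) (g : G) (χ : A → K) : A → K :=
  fun a => χ ⟨g⁻¹ * a * g, by simpa using hA.conj_mem a a.2 g⁻¹⟩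

theorem map_mem_wtSpace (σ : G →* Module.End K U) (A : Subgroup G) (hA : A.Normal) (χ : A → K)
    (g : G) {u : U} (hu : u ∈ wtSpace σ A χ) : σ g u ∈ wtSpace σ A (conjWt A hA g χ) := by
  rw [mem_wtSpace] at hu ⊢
  intro a
  have h := hu ⟨g⁻¹ * a * g, by simpa using hA.conj_mem a a.2 g⁻¹⟩
  rw [conjWt, ← map_smul, ← h, ← Module.End.mul_apply, ← Module.End.mul_apply, ← map_mul, ← map_mul]
  congr 2
  group

theorem wtSpace_stable [FiniteDimensional K U] (hG : Group.IsSolvable G)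
    (σ : G →* Module.End K U) (A : Subgroup G)
    (hN : A.Normal)
    (hA : ∀ a ∈ A, ∀ b ∈ A, σ a * σ b = σ b * σ a) (N : ℕ) (hfin : Module.finrank K U ≤ N)
    (χ : A → K) (g : G) (hg : g ∈ derivedSeries G (N.factorial)) (u : U)
    (hu : u ∈ wtSpace σ A χ) : σ g u ∈ wtSpace σ A χ := by
  by_cases hb : wtSpace σ A χ = ⊥
  · rw [hb, Submodule.mem_bot] at hu
    simp [hu]
  have hind := wtSpace_indep σ A hA
  have : Finite {χ // wtSpace σ A χ ≠ ⊥} := WellFoundedGT.finite_ne_bot_of_iSupIndep hind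
  have := Fintype.ofFinite {χ // wtSpace σ A χ ≠ ⊥}
  let act : MulAction G {χ // wtSpace σ A χ ≠ ⊥} :=
    { smul := fun g χ => ⟨conjWt A hN g χ.1, by
        obtain ⟨u, hu, h0⟩ := Submodule.exists_mem_ne_zero_of_ne_bot χ.2
        intro hbot
        have := map_mem_wtSpace σ A hN χ.1 g hu
        rw [hbot, Submodule.mem_bot] at this
        apply h0
        rw [← hom_inv_apply σ g u, this, map_zero]⟩
      one_smul := by
        intro χ
        apply Subtype.ext
        funext a
        show χ.1 _ = χ.1 _
        simp
      mul_smul := by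
        intro g h χ
        apply Subtype.ext
        funext a
        show χ.1 _ = χ.1 _
        simp [mul_assoc] }
  have hle := derivedSeries_le_ker_of_card hG (MulAction.toPermHom G {χ // wtSpace σ A χ ≠ ⊥})
    N.factorial (by
      rw [Nat.card_perm, Nat.card_eq_fintype_card]
      exact Nat.factorial_le (hind.subtype_ne_bot_le_finrank.trans hfin))
  have h1 := hle hg
  rw [MonoidHom.mem_ker] at h1
  have h2 : (g • (⟨χ, hb⟩ : {χ // wtSpace σ A χ ≠ ⊥})) = ⟨χ, hb⟩ := by
    have := congrArg (fun e => e ⟨χ, hb⟩) h1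
    simpa using this
  have h3 : conjWt A hN g χ = χ := congrArg Subtype.val h2
  have := map_mem_wtSpace σ A hN χ g hu
  rwa [h3] at this

/-- common eigenvector -/
theorem exists_wt [IsAlgClosed K] [FiniteDimensional K U] [Nontrivial U]
    (σ : G →* Module.End K U) (A : Subgroup G)
    (hA : ∀ a ∈ A, ∀ b ∈ A, σ a * σ b = σ b * σ a) : ∃ χ : A → K, wtSpace σ A χ ≠ ⊥ := by
  obtain ⟨W, ⟨hW0, hWA⟩, hmin⟩ := wellFounded_lt.has_min
    {W : Submodule K U | W ≠ ⊥ ∧ ∀ a ∈ A, ∀ w ∈ W, σ a w ∈ W} ⟨⊤, top_ne_bot, by simp⟩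
  have hex : ∀ a : A, ∃ c : K, ∀ w ∈ W, σ a w = c • w := by
    intro a
    have : Nontrivial W := Submodule.nontrivial_iff_ne_bot.mpr hW0
    obtain ⟨c, hc⟩ := Module.End.exists_eigenvalue ((σ a).restrict (hWA a a.2))
    obtain ⟨v, hv⟩ := hc.exists_hasEigenvector
    have hv1 : σ a v = c • (v : U) := congrArg Subtype.val hv.apply_eq_smul
    refine ⟨c, ?_⟩
    have hWW : ¬ (W ⊓ (σ a).eigenspace c < W) := by
      apply hmin
      refine ⟨?_, ?_⟩
      · intro hb
        have : (v : U) ∈ W ⊓ (σ a).eigenspace c :=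
          ⟨v.2, Module.End.mem_eigenspace_iff.mpr hv1⟩
        rw [hb, Submodule.mem_bot] at this
        exact hv.2 (Subtype.ext this)
      · rintro b hb w ⟨hw, hw2⟩
        refine ⟨hWA b hb w hw, ?_⟩
        have hw2 := Module.End.mem_eigenspace_iff.mp hw2
        refine Module.End.mem_eigenspace_iff.mpr ?_
        rw [← Module.End.mul_apply, hA a a.2 b hb, Module.End.mul_apply, hw2, map_smul]
    have : W ≤ (σ a).eigenspace c := by
      by_contra hc
      exact hWW (lt_of_le_of_ne inf_le_left (fun h => hc (inf_eq_left.mp h)))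
    exact fun w hw => Module.End.mem_eigenspace_iff.mp (this hw)
  choose χ hχ using hex
  refine ⟨χ, fun hb => hW0 ?_⟩
  rw [← le_bot_iff, ← hb]
  exact fun w hw => mem_wtSpace.mpr fun a => hχ a w hw
end

open scoped commutatorElement

/-- Solvable groups acting on spaces of dimension at most `n` have derived length at most `d`
modulo the kernel. -/
def SolvBound (n d : ℕ) : Prop :=
  ∀ (K V G : Type) [Field K] [IsAlgClosed K] [AddCommGroup V] [Module K V]
    [FiniteDimensional K V] [Group G], Group.IsSolvable G → ∀ ρ : G →* Module.End K V,
    Module.finrank K V ≤ n → ∀ g ∈ derivedSeries G d, ρ g = 1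

section
variable {K V G : Type} [Field K] [IsAlgClosed K] [AddCommGroup V] [Module K V]
    [FiniteDimensional K V] [Group G]

theorem SolvBound.sub {n d : ℕ} (h : SolvBound n d) (hG : Group.IsSolvable G)
    (ρ : G →* Module.End K V) (a : ℕ) (W : Submodule K V)
    (hW : ∀ g ∈ derivedSeries G a, ∀ w ∈ W, ρ g w ∈ W) (hn : Module.finrank K W ≤ n)
    (g : G) (hg : g ∈ derivedSeries G (a + d)) (w : V) (hw : w ∈ W) : ρ g w = w := by
  let τ : derivedSeries G a →* Module.End K W :=
    { toFun := fun x => (ρ x).restrict (hW x x.2)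
      map_one' := by ext w; simp
      map_mul' := by intro x y; ext w; simp }
  obtain ⟨x, hx, rfl⟩ := derivedSeries_add_le (derivedSeries G a) a d le_rfl hg
  have hs : Group.IsSolvable (derivedSeries G a) := inferInstance
  have h1 := h K W (derivedSeries G a) hs τ hn x hx
  have h2 := congrArg (fun e : Module.End K W => ((e ⟨w, hw⟩ : W) : V)) h1
  simpa [τ] using h2

theorem SolvBound.quot {n d : ℕ} (h : SolvBound n d) (hG : Group.IsSolvable G)
    (ρ : G →* Module.End K V) (W : Submodule K V)
    (hW : ∀ g, ∀ w ∈ W, ρ g w ∈ W) (hn : Module.finrank K (V ⧸ W) ≤ n)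
    (g : G) (hg : g ∈ derivedSeries G d) (v : V) : ρ g v - v ∈ W := by
  let τ : G →* Module.End K (V ⧸ W) :=
    { toFun := fun x => W.mapQ W (ρ x) (hW x)
      map_one' := by ext w; simp
      map_mul' := by intro x y; ext w; simp }
  have h1 := h K (V ⧸ W) G hG τ hn g hg
  have h2 := congrArg (fun e : Module.End K (V ⧸ W) => e (W.mkQ v)) h1
  rw [← Submodule.Quotient.eq]
  simpa [τ] using h2

set_option linter.unusedSectionVars false in
theorem eq_one_of_comm (ρ : G →* Module.End K V) (H : Subgroup G)
    (hH : ∀ x ∈ H, ∀ y ∈ H, ρ x * ρ y = ρ y * ρ x) (g : G) (hg : g ∈ ⁅H, H⁆) : ρ g = 1 := by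
  have : ⁅H, H⁆ ≤ ρ.ker := by
    rw [Subgroup.commutator_le]
    intro x hx y hy
    rw [MonoidHom.mem_ker, commutatorElement_def, mul_assoc, mul_assoc, ← mul_assoc, map_mul,
      map_mul, hH x hx y hy, ← map_mul, ← map_mul]
    simp
  exact this hg

/-- reducible case -/
theorem reducible_case {n d : ℕ} (h : SolvBound n d) (hG : Group.IsSolvable G)
    (ρ : G →* Module.End K V) (hV : Module.finrank K V ≤ n + 1) (W : Submodule K V)
    (h0 : W ≠ ⊥) (h1 : W ≠ ⊤) (hW : ∀ g, ∀ w ∈ W, ρ g w ∈ W) :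
    ∀ g ∈ derivedSeries G (d + 1), ρ g = 1 := by
  have hlt := Submodule.finrank_lt (lt_top_iff_ne_top.mpr h1).ne
  have hadd := Submodule.finrank_quotient_add_finrank W
  have hpos : 0 < Module.finrank K W := by
    rw [Module.finrank_pos_iff]
    exact Submodule.nontrivial_iff_ne_bot.mpr h0
  intro g hg
  refine eq_one_of_comm ρ (derivedSeries G d) ?_ g hg
  have e1 : ∀ x ∈ derivedSeries G d, ∀ w ∈ W, ρ x w = w := fun x hx w hw =>
    h.sub hG ρ 0 W (fun g _ => hW g) (by omega) x (by simpa using hx) w hw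
  have e2 : ∀ x ∈ derivedSeries G d, ∀ v, ρ x v - v ∈ W := fun x hx v =>
    h.quot hG ρ W hW (by omega) x hx v
  have key : ∀ x ∈ derivedSeries G d, ∀ y ∈ derivedSeries G d, ∀ v,
      ρ x (ρ y v) = ρ x v + ρ y v - v := by
    intro x hx y hy v
    have := e1 x hx _ (e2 y hy v)
    rw [map_sub] at this
    rw [sub_eq_iff_eq_add] at this
    rw [this]; abel
  intro x hx y hy
  ext v
  rw [Module.End.mul_apply, Module.End.mul_apply, key x hx y hy, key y hy x hx]
  abel

/-- imprimitive case -/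
theorem imprimitive_case {n d : ℕ} (h : SolvBound n d) (hG : Group.IsSolvable G)
    (ρ : G →* Module.End K V) (hV : Module.finrank K V ≤ n + 1) [Nontrivial V]
    (hirr : ∀ W : Submodule K V, W ≠ ⊥ → (∀ g, ∀ w ∈ W, ρ g w ∈ W) → W = ⊤)
    (A : Subgroup G) (hN : A.Normal)
    (hA : ∀ a ∈ A, ∀ b ∈ A, ρ a * ρ b = ρ b * ρ a)
    (a : G) (ha : a ∈ A) (hns : ¬ ∃ c : K, ∀ v, ρ a v = c • v) :
    ∀ g ∈ derivedSeries G ((n+1).factorial + d), ρ g = 1 := by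
  intro g hg
  have htop : (⨆ χ, wtSpace ρ A χ) = ⊤ := by
    apply hirr
    · obtain ⟨χ, hχ⟩ := exists_wt ρ A hA
      intro hb
      exact hχ (le_bot_iff.mp (hb ▸ le_iSup (wtSpace ρ A) χ))
    · intro x w hw
      have : (⨆ χ, wtSpace ρ A χ) ≤ (⨆ χ, wtSpace ρ A χ).comap (ρ x) := by
        refine iSup_le fun χ u hu => ?_
        exact Submodule.mem_iSup_of_mem _ (map_mem_wtSpace ρ A hN χ x hu)
      exact this hw
  have hle : (⨆ χ, wtSpace ρ A χ) ≤ LinearMap.eqLocus (ρ g) (1 : Module.End K V) := by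
    refine iSup_le fun χ u hu => ?_
    have hne : wtSpace ρ A χ ≠ ⊤ := by
      intro ht
      refine hns ⟨χ ⟨a, ha⟩, fun v => ?_⟩
      have : v ∈ wtSpace ρ A χ := ht ▸ Submodule.mem_top
      exact mem_wtSpace.mp this ⟨a, ha⟩
    have hlt := Submodule.finrank_lt (lt_top_iff_ne_top.mpr hne).ne
    exact h.sub hG ρ _ (wtSpace ρ A χ)
      (fun x hx w hw => wtSpace_stable hG ρ A hN hA (n+1) hV χ x hx w hw) (by omega) g hg u hu
  rw [htop] at hle
  ext v
  exact hle Submodule.mem_top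

/-- conjugation representation on the endomorphism algebra -/
def conjRep (ρ : G →* Module.End K V) : G →* Module.End K (Module.End K V) where
  toFun g := LinearMap.mulLeft K (ρ g) * LinearMap.mulRight K (ρ g⁻¹)
  map_one' := by ext; simp
  map_mul' x y := by ext; simp

set_option linter.unusedSectionVars false in
theorem conjRep_apply (ρ : G →* Module.End K V) (g : G) (T : Module.End K V) :
    conjRep ρ g T = ρ g * T * ρ g⁻¹ := by
  simp [conjRep, mul_assoc]

/-- primitive case -/
theorem primitive_case {n : ℕ} (hG : Group.IsSolvable G)
    (ρ : G →* Module.End K V) (hV : Module.finrank K V ≤ n)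
    (hsc : ∀ A : Subgroup G, A.Normal → (∀ a ∈ A, ∀ b ∈ A, ρ a * ρ b = ρ b * ρ a) →
      ∀ a ∈ A, ∃ c : K, ρ a = c • 1) :
    ∀ g ∈ derivedSeries G ((n * n).factorial + 2), ρ g = 1 := by
  classical
  have hex : ∃ j, ∀ x ∈ derivedSeries G j, ∀ y ∈ derivedSeries G j, ρ x * ρ y = ρ y * ρ x := by
    obtain ⟨j, hj⟩ := hG.solvable
    refine ⟨j, fun x hx y hy => ?_⟩
    rw [hj, Subgroup.mem_bot] at hx hy
    rw [hx, hy]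
  set m := (n * n).factorial with hm
  suffices hj : Nat.find hex ≤ m + 1 by
    intro g hg
    refine eq_one_of_comm ρ _ (Nat.find_spec hex) g ?_
    exact derivedSeries_antitone G (Nat.succ_le_succ hj) hg
  by_contra hc
  push Not at hc
  obtain ⟨k, hk⟩ : ∃ k, Nat.find hex = k + 1 := ⟨Nat.find hex - 1, by omega⟩
  have hnc := Nat.find_min hex (m := k) (by omega)
  have hsp := Nat.find_spec hex
  rw [hk] at hsp
  have hDn : (derivedSeries G k).Normal := derivedSeries_normal G k
  -- the commutators of `D` are scalars
  have hDs : ∀ x ∈ derivedSeries G k, ∀ y ∈ derivedSeries G k,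
      ∃ c : K, ρ y * ρ x * ρ y⁻¹ = c • ρ x := by
    intro x hx y hy
    obtain ⟨c, hc⟩ := hsc _ (derivedSeries_normal G (k+1)) hsp ⁅y, x⁆
      (Subgroup.commutator_mem_commutator hy hx)
    refine ⟨c, ?_⟩
    have : y * x * y⁻¹ = ⁅y, x⁆ * x := by simp [commutatorElement_def]
    rw [← map_mul, ← map_mul, this, map_mul, hc]
    simp
  -- centralising elements are scalars
  let Z : Subgroup G :=
    { carrier := {z | z ∈ derivedSeries G k ∧ ∀ y ∈ derivedSeries G k, ρ (y * z) = ρ (z * y)}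
      one_mem' := ⟨one_mem _, by simp⟩
      mul_mem' := by
        rintro a b ⟨ha, ha2⟩ ⟨hb, hb2⟩
        refine ⟨mul_mem ha hb, fun y hy => ?_⟩
        rw [← mul_assoc, map_mul, ha2 y hy, ← map_mul, mul_assoc, map_mul, hb2 y hy, ← map_mul,
          mul_assoc]
      inv_mem' := by
        rintro a ⟨ha, ha2⟩
        refine ⟨inv_mem ha, fun y hy => ?_⟩
        have e1 : y * a⁻¹ = a⁻¹ * (a * y) * a⁻¹ := by group
        have e2 : a⁻¹ * y = a⁻¹ * (y * a) * a⁻¹ := by group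
        rw [e1, e2, map_mul ρ _ a⁻¹, map_mul ρ _ (a * y), map_mul ρ _ a⁻¹, map_mul ρ _ (y * a), ha2 y hy] }
  have hZn : Z.Normal := by
    refine ⟨fun z hz g => ⟨hDn.conj_mem z hz.1 g, fun y hy => ?_⟩⟩
    have h1 := hz.2 (g⁻¹ * y * g) (by simpa using hDn.conj_mem y hy g⁻¹)
    have e1 : y * (g * z * g⁻¹) = g * (g⁻¹ * y * g * z) * g⁻¹ := by group
    have e2 : g * z * g⁻¹ * y = g * (z * (g⁻¹ * y * g)) * g⁻¹ := by group
    rw [e1, e2, map_mul ρ _ g⁻¹, map_mul ρ g, map_mul ρ _ g⁻¹, map_mul ρ g, h1]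
  have hZs : ∀ z ∈ Z, ∃ c : K, ρ z = c • 1 := by
    refine hsc Z hZn fun a ha b hb => ?_
    rw [← map_mul, ← map_mul, hb.2 a ha.1]
  -- conjugation action of D on End V is commutative
  have hcomm : ∀ a ∈ derivedSeries G k, ∀ b ∈ derivedSeries G k,
      conjRep ρ a * conjRep ρ b = conjRep ρ b * conjRep ρ a := by
    intro a ha b hb
    obtain ⟨c, hc⟩ := hsc _ (derivedSeries_normal G (k+1)) hsp ⁅a, b⁆
      (Subgroup.commutator_mem_commutator ha hb)
    have hone : conjRep ρ ⁅a, b⁆ = 1 := by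
      ext1 T
      have ht : ρ ⁅a, b⁆ * T = T * ρ ⁅a, b⁆ := by rw [hc]; simp
      rw [conjRep_apply, ht, mul_assoc, ← map_mul, mul_inv_cancel]
      simp
    have e : a * b = ⁅a, b⁆ * (b * a) := by rw [commutatorElement_def]; group
    rw [← map_mul, e, map_mul, hone, one_mul, map_mul]
  -- elements of `derivedSeries G m` preserve lines
  have hline : ∀ g ∈ derivedSeries G m, ∀ x ∈ derivedSeries G k,
      ∃ c : K, ρ g * ρ x * ρ g⁻¹ = c • ρ x := by
    intro g hg x hx
    choose χ hχ using fun y : derivedSeries G k => hDs x hx y y.2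
    have hmem : ρ x ∈ wtSpace (conjRep ρ) (derivedSeries G k) χ := by
      rw [mem_wtSpace]
      intro a
      rw [conjRep_apply, hχ a]
    have hst := wtSpace_stable hG (conjRep ρ) _ hDn hcomm (n * n) (by
      rw [Module.finrank_linearMap]
      exact Nat.mul_le_mul hV hV) χ g hg _ hmem
    rw [mem_wtSpace] at hst
    simp only [conjRep_apply] at hst
    have hzZ : (g * x * g⁻¹) * x⁻¹ ∈ Z := by
      refine ⟨mul_mem (hDn.conj_mem x hx g) (inv_mem hx), fun y hy => ?_⟩
      have h1 := hst ⟨y, hy⟩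
      have h2 := hχ ⟨y, hy⟩
      simp only [← map_mul] at h1 h2
      -- compare y z x and z y x
      have h3 : ρ (y * (g * x * g⁻¹)) = χ ⟨y, hy⟩ • ρ (g * x * g⁻¹ * y) := by
        have : y * (g * x * g⁻¹) = y * (g * x * g⁻¹) * y⁻¹ * y := by group
        rw [this, map_mul, h1, smul_mul_assoc, ← map_mul]
      have h4 : ρ (y * x) = χ ⟨y, hy⟩ • ρ (x * y) := by
        have : y * x = y * x * y⁻¹ * y := by group
        rw [this, map_mul, h2, smul_mul_assoc, ← map_mul]
      have e1 : y * (g * x * g⁻¹ * x⁻¹) = y * (g * x * g⁻¹) * x⁻¹ := by group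
      have e2 : g * x * g⁻¹ * x⁻¹ * y = g * x * g⁻¹ * x⁻¹ * (y * x) * x⁻¹ := by group
      have e3 : g * x * g⁻¹ * y = g * x * g⁻¹ * x⁻¹ * (x * y) := by group
      rw [e1, map_mul, h3, e2, map_mul ρ _ x⁻¹, map_mul ρ _ (y * x), h4, mul_smul_comm, ← map_mul,
        ← e3]
    obtain ⟨c, hc⟩ := hZs _ hzZ
    refine ⟨c, ?_⟩
    have : g * x * g⁻¹ = g * x * g⁻¹ * x⁻¹ * x := by group
    rw [← map_mul, ← map_mul, this, map_mul, hc]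
    simp
  -- commutators of such centralise D
  have hcent : ∀ z ∈ derivedSeries G (m+1), ∀ x ∈ derivedSeries G k, conjRep ρ z (ρ x) = ρ x := by
    intro z hz x hx
    let S : Subgroup G :=
      { carrier := {z | conjRep ρ z (ρ x) = ρ x}
        one_mem' := by simp
        mul_mem' := by
          intro a b ha hb
          simp only [Set.mem_ofPred_eq] at ha hb ⊢
          rw [map_mul, Module.End.mul_apply, hb, ha]
        inv_mem' := by
          intro a ha
          simp only [Set.mem_ofPred_eq] at ha ⊢
          conv_lhs => rw [← ha]
          exact hom_inv_apply _ _ _ }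
    have hS : derivedSeries G (m+1) ≤ S := by
      rw [derivedSeries_succ, Subgroup.commutator_le]
      intro a ha b hb
      show conjRep ρ ⁅a, b⁆ (ρ x) = ρ x
      -- pass to inverses: the line of `ρ x` is preserved by `a⁻¹` and `b⁻¹` too
      obtain ⟨c₂, hc₂⟩ := hline a⁻¹ (inv_mem ha) x hx
      obtain ⟨e₂, he₂⟩ := hline b⁻¹ (inv_mem hb) x hx
      rw [← conjRep_apply] at hc₂ he₂
      have h2 : conjRep ρ (a⁻¹ * b⁻¹) (ρ x) = conjRep ρ (b⁻¹ * a⁻¹) (ρ x) := by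
        rw [map_mul, map_mul, Module.End.mul_apply, Module.End.mul_apply, hc₂, he₂, map_smul,
          map_smul, hc₂, he₂, smul_smul, smul_smul, mul_comm]
      have h3 : ⁅a, b⁆ = (a * b) * (a⁻¹ * b⁻¹) := by simp [commutatorElement_def, mul_assoc]
      have h4 : (a * b) * (b⁻¹ * a⁻¹) = 1 := by group
      rw [h3, map_mul, Module.End.mul_apply, h2, ← Module.End.mul_apply, ← map_mul, h4]
      simp
    exact hS hz
  apply hnc
  intro x hx y hy
  have h1 := hcent x (derivedSeries_antitone G (by omega) hx) y hy
  rw [conjRep_apply] at h1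
  have h2 : ρ x * ρ y = ρ x * ρ y * ρ x⁻¹ * ρ x := by
    rw [mul_assoc (ρ x * ρ y), ← map_mul ρ x⁻¹ x, inv_mul_cancel, map_one, mul_one]
  rw [h2, h1]

theorem solvBound_exists (n : ℕ) : ∃ d, SolvBound n d := by
  induction n with
  | zero =>
    refine ⟨0, ?_⟩
    intro K V G _ _ _ _ _ _ hG ρ hV g _
    have : Subsingleton V := Module.finrank_zero_iff.mp (Nat.le_zero.mp hV)
    exact Subsingleton.elim _ _
  | succ n ih =>
    obtain ⟨d, hd⟩ := ih
    refine ⟨d + 1 + (n+1).factorial + (((n + 1) * (n + 1)).factorial + 2), ?_⟩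
    intro K V G _ _ _ _ _ _ hG ρ hV g hg
    by_cases hnt : Nontrivial V
    swap
    · have := not_nontrivial_iff_subsingleton.mp hnt
      exact Subsingleton.elim _ _
    by_cases hirr : ∀ W : Submodule K V, W ≠ ⊥ → (∀ g, ∀ w ∈ W, ρ g w ∈ W) → W = ⊤
    swap
    · push Not at hirr
      obtain ⟨W, h0, hW, h1⟩ := hirr
      exact reducible_case hd hG ρ hV W h0 h1 hW g (derivedSeries_antitone G (by omega) hg)
    by_cases hsc : ∀ A : Subgroup G, A.Normal → (∀ a ∈ A, ∀ b ∈ A, ρ a * ρ b = ρ b * ρ a) →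
      ∀ a ∈ A, ∃ c : K, ρ a = c • 1
    · exact primitive_case hG ρ hV hsc g (derivedSeries_antitone G (by omega) hg)
    · push Not at hsc
      obtain ⟨A, hN, hA, a, ha, hns⟩ := hsc
      refine imprimitive_case hd hG ρ hV hirr A hN hA a ha ?_ g
        (derivedSeries_antitone G (by omega) hg)
      rintro ⟨c, hc⟩
      exact hns c (by ext v; simp [hc])
end

theorem exists_prime_hom (N : Type) [Group N] [Finite N] [Nontrivial N]
    (hN : Group.IsSolvable N) :
    ∃ p : ℕ, p.Prime ∧ ∃ φ : N → ZMod p, (∀ x y, φ (x * y) = φ x + φ y) ∧ ∃ x, φ x ≠ 0 := by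
  have hlt := Group.IsSolvable.commutator_lt_top_of_nontrivial N
  have hnt : Nontrivial (Abelianization N) := QuotientGroup.nontrivial_iff.mpr hlt.ne
  have hfin : Finite (Abelianization N) := Quotient.finite _
  obtain ⟨H, hH⟩ := IsCoatomic.exists_coatom (Subgroup (Abelianization N))
  have hsimple : IsSimpleGroup (Abelianization N ⧸ H) := by
    have : Nontrivial (Abelianization N ⧸ H) := QuotientGroup.nontrivial_iff.mpr hH.1
    refine ⟨fun J _ => ?_⟩
    have hle : H ≤ J.comap (QuotientGroup.mk' H) := by
      intro x hx
      rw [Subgroup.mem_comap]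
      have : (QuotientGroup.mk' H) x = 1 := (QuotientGroup.eq_one_iff x).mpr hx
      rw [this]; exact one_mem J
    have hJ : J = (J.comap (QuotientGroup.mk' H)).map (QuotientGroup.mk' H) :=
      (Subgroup.map_comap_eq_self_of_surjective (QuotientGroup.mk'_surjective H) J).symm
    rcases hH.le_iff.mp hle with h | h
    · right
      rw [hJ, h, ← MonoidHom.range_eq_map, MonoidHom.range_eq_top]
      exact QuotientGroup.mk'_surjective H
    · left
      rw [hJ, h, Subgroup.map_eq_bot_iff, QuotientGroup.ker_mk']
  obtain ⟨p, hp, ⟨e⟩⟩ := exists_prime_addEquiv_ZMod (G := Abelianization N ⧸ H)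
  let ψ : N →* Abelianization N ⧸ H := (QuotientGroup.mk' H).comp Abelianization.of
  have hψ : Function.Surjective ψ :=
    (QuotientGroup.mk'_surjective H).comp (QuotientGroup.mk'_surjective _)
  refine ⟨p, hp, fun x => e (Additive.ofMul (ψ x)), fun x y => by simp, ?_⟩
  obtain ⟨q, hq⟩ := exists_ne (1 : Abelianization N ⧸ H)
  obtain ⟨x, rfl⟩ := hψ q
  refine ⟨x, fun h => hq ?_⟩
  rw [EmbeddingLike.map_eq_zero_iff] at h
  exact h

/-- additive characters of `N` with values in `K` -/
def homSpace (K N : Type) [Field K] [Group N] : Submodule K (N → K) where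
  carrier := {f | ∀ x y, f (x * y) = f x + f y}
  zero_mem' := by intro x y; simp
  add_mem' := by
    intro f g hf hg x y
    have h1 := hf x y
    have h2 := hg x y
    simp only [Pi.add_apply, h1, h2]; ring
  smul_mem' := by
    intro c f hf x y
    have h1 := hf x y
    simp only [Pi.smul_apply, h1, smul_add]

theorem commutator_lt {G : Type} [Group G] [Finite G] (hG : Group.IsSolvable G) {r d : ℕ}
    (hr : HasRankLE G r) (hd : SolvBound r d) (N : Subgroup G) (hN : N.Normal) (hb : N ≠ ⊥) :
    ⁅N, derivedSeries G d⁆ < N := by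
  have hnt : Nontrivial N := (Subgroup.nontrivial_iff_ne_bot N).mpr hb
  obtain ⟨p, hp, φ, hφ, x₀, hx₀⟩ := exists_prime_hom N inferInstance
  have := Fact.mk hp
  let K := AlgebraicClosure (ZMod p)
  obtain ⟨S, hS, hcl⟩ := hr N ((Group.fg_iff_subgroup_fg N).mp inferInstance)
  have hSN : ∀ s : S, (s : G) ∈ N := fun s => hcl ▸ Subgroup.subset_closure s.2
  let res : homSpace K N →ₗ[K] (S → K) :=
    { toFun := fun f s => f.1 ⟨s, hSN s⟩
      map_add' := fun _ _ => rfl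
      map_smul' := fun _ _ => rfl }
  have hinj : Function.Injective res := by
    rw [← LinearMap.ker_eq_bot, LinearMap.ker_eq_bot']
    intro f hf
    have hf1 : f.1 1 = 0 := by
      have := f.2 1 1
      simpa using this
    have : ∀ g (hg : g ∈ Subgroup.closure (S : Set G)), ∀ h : g ∈ N, f.1 ⟨g, h⟩ = 0 := by
      intro g hg
      induction hg using Subgroup.closure_induction with
      | mem x hx => intro h; exact congrFun hf ⟨x, hx⟩
      | one => intro h; exact hf1
      | mul x y hx hy ihx ihy =>
        intro h
        have hx' : x ∈ N := hcl ▸ hx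
        have hy' : y ∈ N := hcl ▸ hy
        have := f.2 ⟨x, hx'⟩ ⟨y, hy'⟩
        rw [ihx, ihy, add_zero] at this
        exact this
      | inv x hx ihx =>
        intro h
        have hx' : x ∈ N := hcl ▸ hx
        have := f.2 ⟨x, hx'⟩ ⟨x⁻¹, h⟩
        rw [ihx, zero_add] at this
        rw [← this, ← hf1]
        exact congrArg f.1 (Subtype.ext (mul_inv_cancel x))
    ext x
    exact this x (hcl ▸ x.2) x.2
  have hfd : FiniteDimensional K (homSpace K N) := Module.Finite.of_injective res hinj
  have hrank : Module.finrank K (homSpace K N) ≤ r := by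
    have := LinearMap.finrank_le_finrank_of_injective hinj
    rw [Module.finrank_fintype_fun_eq_card, Fintype.card_coe] at this
    exact this.trans hS
  have hcj : ∀ (g : G) (x : N), g⁻¹ * x * g ∈ N := fun g x => by
    simpa using hN.conj_mem x x.2 g⁻¹
  let ρ : G →* Module.End K (homSpace K N) :=
    { toFun := fun g =>
        { toFun := fun f => ⟨fun x => f.1 ⟨g⁻¹ * x * g, hcj g x⟩, by
            intro x y
            rw [← f.2]
            refine congrArg f.1 (Subtype.ext ?_)
            simp [mul_assoc]⟩
          map_add' := fun _ _ => rfl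
          map_smul' := fun _ _ => rfl }
      map_one' := by
        ext f x
        simp
      map_mul' := by
        intro g h
        ext f x
        simp [mul_assoc] }
  have htriv := hd K (homSpace K N) G hG ρ hrank
  let f₀ : homSpace K N := ⟨fun x => algebraMap (ZMod p) K (φ x), by
    intro x y; simp [hφ]⟩
  have hf1 : f₀.1 1 = 0 := by
    have := f₀.2 1 1
    simpa using this
  let M : Subgroup N :=
    { carrier := {x | f₀.1 x = 0}
      one_mem' := hf1
      mul_mem' := by
        intro x y hx hy
        have := f₀.2 x y
        rw [Set.mem_ofPred_eq] at hx hy ⊢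
        rw [this, hx, hy, add_zero]
      inv_mem' := by
        intro x hx
        have := f₀.2 x x⁻¹
        rw [Set.mem_ofPred_eq] at hx ⊢
        rw [hx, zero_add, mul_inv_cancel, hf1] at this
        exact this.symm }
  have hle : ⁅N, derivedSeries G d⁆ ≤ M.map N.subtype := by
    rw [Subgroup.commutator_le]
    intro x hx g hg
    have hg' := htriv g⁻¹ (inv_mem hg)
    have h1 : f₀.1 ⟨g⁻¹⁻¹ * x⁻¹ * g⁻¹, hcj g⁻¹ ⟨x⁻¹, inv_mem hx⟩⟩ = f₀.1 ⟨x⁻¹, inv_mem hx⟩ :=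
      congrArg (fun e : Module.End K (homSpace K N) => (e f₀).1 ⟨x⁻¹, inv_mem hx⟩) hg'
    refine ⟨⟨x, hx⟩ * ⟨g⁻¹⁻¹ * x⁻¹ * g⁻¹, hcj g⁻¹ ⟨x⁻¹, inv_mem hx⟩⟩, ?_, ?_⟩
    · show f₀.1 _ = 0
      have h2 := f₀.2 ⟨x, hx⟩ ⟨g⁻¹⁻¹ * x⁻¹ * g⁻¹, hcj g⁻¹ ⟨x⁻¹, inv_mem hx⟩⟩
      have h3 := f₀.2 ⟨x, hx⟩ ⟨x⁻¹, inv_mem hx⟩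
      rw [h2, h1, ← h3, ← hf1]
      exact congrArg f₀.1 (Subtype.ext (mul_inv_cancel x))
    · simp [commutatorElement_def, mul_assoc]
  refine lt_of_le_of_ne (Subgroup.commutator_le_left N _) fun he => ?_
  rw [he] at hle
  obtain ⟨y, hy, hyx⟩ := hle x₀.2
  have hyx' : y = x₀ := Subtype.ext hyx
  have h0 : f₀.1 x₀ = 0 := hyx' ▸ hy
  exact hx₀ ((map_eq_zero (algebraMap (ZMod p) K)).mp h0)

theorem derivedSeries_nilpotent {G : Type} [Group G] [Finite G] (hG : Group.IsSolvable G) {r d : ℕ}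
    (hr : HasRankLE G r) (hd : SolvBound r d) : Group.IsNilpotent (derivedSeries G d) := by
  rw [Subgroup.isNilpotent_iff_lowerCentralSeries]
  have hDn : (derivedSeries G d).Normal := derivedSeries_normal G d
  have hnorm : ∀ i, ((derivedSeries G d).lowerCentralSeries i).Normal := by
    intro i
    induction i with
    | zero => exact hDn
    | succ i ih => exact Subgroup.commutator_normal _ _
  by_contra hc
  push Not at hc
  have hlt : ∀ i, (derivedSeries G d).lowerCentralSeries (i+1)
      < (derivedSeries G d).lowerCentralSeries i := fun i =>
    commutator_lt hG hr hd _ (hnorm i) (hc i)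
  exact not_strictAnti_of_wellFoundedLT _ (strictAnti_nat_of_succ_lt hlt)

/-- If `G` is a finite soluble group of rank `r`, then the derived length
of `G/F(G)` is `r`-bounded; equivalently, the `f r`-th derived subgroup of `G` is
contained in the Fitting subgroup `F(G)` (the largest normal nilpotent subgroup). -/
theorem derived_length_mod_fitting_bounded :
    ∃ f : ℕ → ℕ, ∀ (G : Type) [Group G] [Fintype G], IsSolvable G →
      ∀ r : ℕ, HasRankLE G r →
        ∀ F : Subgroup G, F.Normal → Group.IsNilpotent F →
          (∀ H : Subgroup G, H.Normal → Group.IsNilpotent H → H ≤ F) →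
          derivedSeries G (f r) ≤ F := by
  choose f hf using solvBound_exists
  refine ⟨f, ?_⟩
  intro G _ _ hG r hr F _ _ hmax
  exact hmax _ (derivedSeries_normal G (f r)) (derivedSeries_nilpotent hG hr (hf r))
end

section
/- If G is a finite group such that G/Z(G) has rank r, then the rank of the derived subgroup G' is bounded by a function of r only. -/
namespace RankSchur

open Subgroup
open scoped commutatorElement

/-- `S` is generated by `n` of its elements modulo `C`. -/
def GenMod {G : Type*} [Group G] (S C : Subgroup G) (n : ℕ) : Prop :=
  ∃ f : Fin n → G, (∀ i, f i ∈ S) ∧ S ≤ closure (Set.range f) ⊔ C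

/-- Every subgroup of `B` is generated by `n` elements modulo `C`. -/
def RkMod {G : Type*} [Group G] (B C : Subgroup G) (n : ℕ) : Prop :=
  ∀ S ≤ B, GenMod S C n

section basics

variable {G : Type*} [Group G] {H : Type*} [Group H]

lemma closure_range_le {n : ℕ} {f : Fin n → G} {S : Subgroup G} (h : ∀ i, f i ∈ S) :
    closure (Set.range f) ≤ S := by
  rw [closure_le]; rintro _ ⟨i, rfl⟩; exact h i

lemma RkMod.mono {B B' C C' : Subgroup G} {n : ℕ} (h : RkMod B C n) (hB : B' ≤ B) (hC : C ≤ C') :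
    RkMod B' C' n := by
  intro S hS
  obtain ⟨f, hf, hg⟩ := h S (hS.trans hB)
  exact ⟨f, hf, hg.trans (sup_le_sup_left hC _)⟩

lemma GenMod.mono_n {B C : Subgroup G} {m n : ℕ} (h : GenMod B C n) (hn : n ≤ m) :
    GenMod B C m := by
  obtain ⟨f, hf, hg⟩ := h
  refine ⟨fun i => if h : (i : ℕ) < n then f ⟨i, h⟩ else 1, ?_, ?_⟩
  · intro i
    dsimp only
    split_ifs
    · exact hf _
    · exact B.one_mem
  · refine hg.trans (sup_le_sup_right ?_ _)
    apply closure_range_le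
    intro i
    apply Subgroup.subset_closure
    exact ⟨⟨i, i.2.trans_le hn⟩, by simp⟩

lemma RkMod.mono_n {B C : Subgroup G} {m n : ℕ} (h : RkMod B C n) (hn : n ≤ m) :
    RkMod B C m := fun S hS => (h S hS).mono_n hn

lemma RkMod.trans {B C E : Subgroup G} [C.Normal] {m n : ℕ} (h1 : RkMod B C m)
    (h2 : RkMod C E n) : RkMod B E (m + n) := by
  intro S hS
  obtain ⟨f, hf, hfg⟩ := h1 S hS
  obtain ⟨g, hg, hgg⟩ := h2 (S ⊓ C) inf_le_right
  refine ⟨Fin.append f g, ?_, ?_⟩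
  · intro i
    refine Fin.addCases (fun i => ?_) (fun i => ?_) i
    · simpa using hf i
    · simpa using (hg i).1
  · intro s hs
    obtain ⟨u, hu, c, hc, rfl⟩ := mem_sup_of_normal_right.1 (hfg hs)
    have huS : u ∈ S := closure_range_le hf hu
    have hcS : c ∈ S ⊓ C := ⟨by simpa using S.mul_mem (S.inv_mem huS) hs, hc⟩
    refine mul_mem ?_ ?_
    · refine (le_trans ?_ le_sup_left : closure (Set.range f) ≤ _) hu
      apply closure_range_le
      intro i
      exact Subgroup.subset_closure ⟨Fin.castAdd n i, by simp⟩
    · refine (sup_le_sup_right ?_ _ : closure (Set.range g) ⊔ E ≤ _) (hgg hcS)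
      apply closure_range_le
      intro i
      exact Subgroup.subset_closure ⟨Fin.natAdd m i, by simp⟩

lemma RkMod.map {B C : Subgroup G} {n : ℕ} (h : RkMod B C n) (φ : G →* H) :
    RkMod (B.map φ) (C.map φ) n := by
  intro S hS
  obtain ⟨f, hf, hg⟩ := h (B ⊓ S.comap φ) inf_le_left
  refine ⟨fun i => φ (f i), fun i => (hf i).2, ?_⟩
  intro s hs
  obtain ⟨b, hb, rfl⟩ := hS hs
  have := mem_map_of_mem φ (hg ⟨hb, hs⟩)
  rw [Subgroup.map_sup, MonoidHom.map_closure, ← Set.range_comp] at this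
  exact this

lemma RkMod.comap {B C : Subgroup H} [C.Normal] {n : ℕ} (h : RkMod B C n) (φ : G →* H) :
    RkMod (B.comap φ) (C.comap φ) n := by
  intro S hS
  obtain ⟨f, hf, hg⟩ := h (S.map φ) (map_le_iff_le_comap.2 hS)
  choose g hgS hgf using hf
  refine ⟨g, hgS, ?_⟩
  intro s hs
  obtain ⟨u, hu, c, hc, e⟩ := mem_sup_of_normal_right.1 (hg (mem_map_of_mem φ hs))
  have : f = φ ∘ g := by ext i; exact (hgf i).symm
  rw [this, Set.range_comp, ← MonoidHom.map_closure] at hu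
  obtain ⟨v, hv, rfl⟩ := hu
  have : s = v * (v⁻¹ * s) := by group
  rw [this]
  refine mul_mem (mem_sup_left hv) (mem_sup_right ?_)
  rw [mem_comap, map_mul, map_inv, ← e]
  simpa using hc

lemma rkMod_one_of_cyclic {A : Type*} [CommGroup A] (C : Subgroup A) (x : A) :
    RkMod (zpowers x ⊔ C) C 1 := by
  intro S hS
  let φ : Multiplicative ℤ →* A := zpowersHom A x
  obtain ⟨d, hd⟩ := (inferInstance : IsCyclic ((S ⊔ C).comap φ)).exists_generator
  obtain ⟨s, hs, c, hc, e⟩ := mem_sup.1 (show φ d ∈ S ⊔ C from d.2)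
  refine ⟨fun _ => s, fun _ => hs, ?_⟩
  intro t ht
  obtain ⟨y, hy, c', hc', e'⟩ := mem_sup.1 (hS ht)
  obtain ⟨k, rfl⟩ := mem_zpowers_iff.1 hy
  have hk : Multiplicative.ofAdd k ∈ (S ⊔ C).comap φ := by
    rw [mem_comap]
    have : φ (Multiplicative.ofAdd k) = t * c'⁻¹ := by
      rw [← e']; simp [φ]
    rw [this]
    exact mul_mem (mem_sup_left ht) (mem_sup_right (inv_mem hc'))
  obtain ⟨j, hj⟩ := mem_zpowers_iff.1 (hd ⟨_, hk⟩)
  have hj' : φ d ^ j = x ^ k := by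
    have h : φ d ^ j = φ (Multiplicative.ofAdd k) := by
      rw [← map_zpow]
      exact congrArg (fun z : ((S ⊔ C).comap φ) => φ (z : Multiplicative ℤ)) hj
    rw [h]; simp [φ]
  rw [← e', ← hj', ← e, mul_zpow]
  refine mul_mem (mul_mem (mem_sup_left ?_) (mem_sup_right ?_)) (mem_sup_right hc')
  · exact zpow_mem (Subgroup.subset_closure (Set.mem_range_self (0 : Fin 1))) _
  · exact zpow_mem hc _

lemma rkMod_comm_type {A : Type*} [CommGroup A] (n : ℕ) (f : Fin n → A) :
    RkMod (closure (Set.range f)) ⊥ n := by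
  induction n with
  | zero =>
    intro S hS
    refine ⟨f, fun i => i.elim0, hS.trans le_sup_left⟩
  | succ n ih =>
    have h1 := ih (fun i => f i.succ)
    have h2 := (rkMod_one_of_cyclic (closure (Set.range fun i : Fin n => f i.succ)) (f 0)).trans h1
    refine (h2.mono ?_ le_rfl).mono_n (by omega)
    apply closure_range_le
    intro i
    refine Fin.cases ?_ (fun i => ?_) i
    · exact mem_sup_left (mem_zpowers _)
    · exact mem_sup_right (Subgroup.subset_closure ⟨i, rfl⟩)

/-- `n`-generated abelian groups have rank at most `n`. -/
lemma GenMod.rkMod_of_comm {B : Subgroup G} {n : ℕ} (h : GenMod B ⊥ n)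
    (hB : ∀ x ∈ B, ∀ y ∈ B, x * y = y * x) : RkMod B ⊥ n := by
  obtain ⟨f, hf, hg⟩ := h
  let _ : CommGroup B := { (inferInstance : Group B) with
    mul_comm := fun x y => Subtype.ext (hB x x.2 y y.2) }
  have := (rkMod_comm_type n (fun i => (⟨f i, hf i⟩ : B))).map B.subtype
  rw [MonoidHom.map_closure, ← Set.range_comp, Subgroup.map_bot] at this
  refine this.mono ?_ le_rfl
  rw [sup_bot_eq] at hg
  exact hg

/-- relative version -/
lemma GenMod.rkMod_of_commutator_le {B C : Subgroup G} [C.Normal] {n : ℕ} (h : GenMod B C n)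
    (hB : ⁅B, B⁆ ≤ C) : RkMod B C n := by
  have key : RkMod (B.map (QuotientGroup.mk' C)) ⊥ n := by
    apply GenMod.rkMod_of_comm
    · obtain ⟨f, hf, hg⟩ := h
      refine ⟨fun i => QuotientGroup.mk' C (f i), fun i => mem_map_of_mem _ (hf i), ?_⟩
      have := Subgroup.map_mono (f := QuotientGroup.mk' C) hg
      rw [Subgroup.map_sup, MonoidHom.map_closure, ← Set.range_comp,
        QuotientGroup.map_mk'_self] at this
      exact this
    · rintro _ ⟨x, hx, rfl⟩ _ ⟨y, hy, rfl⟩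
      rw [← commutatorElement_eq_one_iff_mul_comm, ← map_commutatorElement]
      rw [← MonoidHom.mem_ker, QuotientGroup.ker_mk']
      exact hB (commutator_mem_commutator hx hy)
  have := key.comap (QuotientGroup.mk' C)
  refine this.mono (le_comap_map _ _) ?_
  rw [MonoidHom.comap_bot, QuotientGroup.ker_mk']

lemma rkMod_of_hasRankLE [Finite G] {N : Subgroup G} [N.Normal] {r : ℕ} (h : HasRankLE (G ⧸ N) r) :
    RkMod ⊤ N r := by
  have key : RkMod (⊤ : Subgroup (G ⧸ N)) ⊥ r := by
    intro S _
    obtain ⟨T, hT, hTS⟩ := h S (by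
      rw [Subgroup.fg_iff]; exact ⟨S, by simp, Set.toFinite _⟩)
    have : GenMod S ⊥ T.card := by
      refine ⟨fun i => (T.equivFin.symm i : G ⧸ N), fun i => ?_, ?_⟩
      · rw [← hTS]; exact Subgroup.subset_closure (T.equivFin.symm i).2
      · rw [← hTS, sup_bot_eq]
        apply Subgroup.closure_mono
        intro x hx
        exact ⟨T.equivFin ⟨x, hx⟩, by simp⟩
    exact this.mono_n hT
  have := key.comap (QuotientGroup.mk' N)
  rw [MonoidHom.comap_bot, QuotientGroup.ker_mk'] at this
  exact this.mono (by simp) le_rfl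

lemma hasRankLE_of_rkMod {B : Subgroup G} {r : ℕ} (h : RkMod B ⊥ r) : HasRankLE B r := by
  classical
  intro S _
  have := h.comap B.subtype
  obtain ⟨f, hf, hg⟩ := this S (fun x _ => x.2)
  rw [MonoidHom.comap_bot, Subgroup.ker_subtype, sup_bot_eq] at hg
  refine ⟨Finset.univ.image f, ?_, ?_⟩
  · exact Finset.card_image_le.trans (by simp)
  · simp only [Finset.coe_image, Finset.coe_univ, Set.image_univ]
    exact le_antisymm (closure_range_le hf) hg

end basics

section pgroups

universe u

lemma map_mk_eq_bot_iff {G : Type*} [Group G] {E A : Subgroup G} [E.Normal] :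
    A.map (QuotientGroup.mk' E) = ⊥ ↔ A ≤ E := by
  rw [Subgroup.map_eq_bot_iff, QuotientGroup.ker_mk']

lemma map_top_mk {G : Type*} [Group G] {E : Subgroup G} [E.Normal] :
    (⊤ : Subgroup G).map (QuotientGroup.mk' E) = ⊤ :=
  Subgroup.map_top_of_surjective _ (QuotientGroup.mk'_surjective E)

lemma le_of_le_sup_commutator {G : Type*} [Group G] [Group.IsNilpotent G] {B E : Subgroup G}
    [E.Normal] (h : B ≤ E ⊔ ⁅B, (⊤ : Subgroup G)⁆) : B ≤ E := by
  obtain ⟨n, hn⟩ := Subgroup.nilpotent_iff_lowerCentralSeries.1 ‹Group.IsNilpotent G›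
  have key : ∀ k, B ≤ E ⊔ (⊤ : Subgroup G).lowerCentralSeries k := by
    intro k
    induction k with
    | zero => rw [Subgroup.lowerCentralSeries_zero]; simp
    | succ k ih =>
      refine h.trans (sup_le le_sup_left ?_)
      rw [commutator_le]
      intro b hb g _
      obtain ⟨e, he, c, hc, rfl⟩ := mem_sup_of_normal_left.1 (ih hb)
      rw [commutatorElement_mul_left_eq_conj_mul]
      have h1 : ⁅e, g⁆ ∈ E := commutator_le_left E ⊤ (commutator_mem_commutator he (mem_top g))
      have h2 : ⁅c, g⁆ ∈ (⊤ : Subgroup G).lowerCentralSeries (k + 1) :=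
        commutator_mem_commutator hc (mem_top g)
      have hN : ((⊤ : Subgroup G).lowerCentralSeries (k + 1)).Normal := inferInstance
      refine mul_mem (mem_sup_right ?_) (mem_sup_left h1)
      exact hN.conj_mem _ h2 _
  simpa [hn] using key n

lemma exists_central_mem {p : ℕ} [Fact p.Prime] {G : Type*} [Group G] [Finite G]
    (hG : IsPGroup p G) (M : Subgroup G) [hM : M.Normal] (hne : M ≠ ⊥) :
    ∃ a ∈ M, a ∈ center G ∧ a ≠ 1 := by
  have := hG.isNilpotent
  induction hk : Nat.card M using Nat.strong_induction_on generalizing M with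
  | _ k ih =>
    subst hk
    by_cases h : ⁅M, (⊤ : Subgroup G)⁆ = ⊥
    · rw [commutator_top_right_eq_bot_iff_le_center] at h
      obtain ⟨a, hne⟩ := Subgroup.ne_bot_iff_exists_ne_one.1 hne
      exact ⟨a, a.2, h a.2, fun e => hne (Subtype.ext e)⟩
    · have hle : ⁅M, (⊤ : Subgroup G)⁆ ≤ M := commutator_le_left M ⊤
      have hlt : ⁅M, (⊤ : Subgroup G)⁆ < M := by
        refine lt_of_le_of_ne hle fun e => hne ?_
        rw [← le_bot_iff]
        apply le_of_le_sup_commutator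
        rw [e]; exact le_sup_right
      obtain ⟨a, ha, h1⟩ := ih _ (Set.Finite.card_lt_card (Set.toFinite _) hlt)
        ⁅M, (⊤ : Subgroup G)⁆ h rfl
      exact ⟨a, hle ha, h1⟩

lemma normal_of_le_center {G : Type*} [Group G] {A : Subgroup G} (h : A ≤ center G) :
    A.Normal := by
  constructor
  intro a ha g
  rw [(mem_center_iff.1 (h ha) g)]
  simpa using ha

lemma derivedSeries_centralizes {p : ℕ} [hp : Fact p.Prime] (n : ℕ) : ∀ {G : Type u} [Group G]
    [Finite G] (_ : IsPGroup p G) (M : Subgroup G) [M.Normal] (_ : Nat.card M ≤ p ^ n),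
    ⁅derivedSeries G n, M⁆ = ⊥ := by
  induction n with
  | zero =>
    intro G _ _ hG M _ hM
    have : M = ⊥ := by
      rw [pow_zero] at hM
      exact Subgroup.eq_bot_of_card_le M hM
    rw [this, commutator_bot_right]
  | succ n ih =>
    intro G _ _ hG M _ hM
    by_cases hne : M = ⊥
    · rw [hne, commutator_bot_right]
    obtain ⟨a, haM, haZ, ha1⟩ := exists_central_mem hG M hne
    have hAZ : zpowers a ≤ center G := by rwa [zpowers_le]
    have hAM : zpowers a ≤ M := by rwa [zpowers_le]
    have hAn : (zpowers a).Normal := normal_of_le_center hAZ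
    have hcard : Nat.card (M.map (QuotientGroup.mk' (zpowers a))) ≤ p ^ n := by
      rw [← relIndex_ker, QuotientGroup.ker_mk']
      have h1 := Subgroup.relIndex_mul_relIndex ⊥ (zpowers a) M bot_le hAM
      rw [relIndex_bot_left, relIndex_bot_left] at h1
      have h2 : p ≤ Nat.card (zpowers a) := by
        obtain ⟨k, hk⟩ := IsPGroup.iff_card.1 (hG.to_subgroup (zpowers a))
        have : k ≠ 0 := by
          rintro rfl
          rw [pow_zero, Subgroup.card_eq_one, zpowers_eq_bot] at hk
          exact ha1 hk
        rw [hk]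
        exact Nat.le_self_pow this p
      have h3 : p * (zpowers a).relIndex M ≤ p * p ^ n := by
        calc _ ≤ Nat.card (zpowers a) * (zpowers a).relIndex M := Nat.mul_le_mul_right _ h2
          _ ≤ _ := by rw [h1, ← pow_succ']; exact hM
      exact Nat.le_of_mul_le_mul_left h3 hp.out.pos
    have hMn : (M.map (QuotientGroup.mk' (zpowers a))).Normal :=
      Subgroup.Normal.map ‹_› _ (QuotientGroup.mk'_surjective _)
    have h1 := ih (hG.to_quotient (zpowers a)) (M.map (QuotientGroup.mk' (zpowers a))) hcard
    rw [← map_derivedSeries_eq (QuotientGroup.mk'_surjective (zpowers a)), ← map_commutator,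
      map_mk_eq_bot_iff] at h1
    rw [derivedSeries_succ]
    have h2 : ⁅⁅derivedSeries G n, M⁆, derivedSeries G n⁆ = ⊥ := by
      rw [← le_bot_iff]
      refine (commutator_mono (h1.trans hAZ) le_top).trans ?_
      rw [commutator_center_left]
    apply commutator_commutator_eq_bot_of_rotate
    · exact h2
    · rw [commutator_comm M]; exact h2

lemma card_closure_le {A : Type*} [CommGroup A] {n q : ℕ} (hq : 0 < q) (f : Fin n → A)
    (hf : ∀ i, f i ^ q = 1) : Nat.card (closure (Set.range f)) ≤ q ^ n := by
  classical
  let ψ : (∀ i, zpowers (f i)) →* A := MonoidHom.mk' (fun u => ∏ i, (u i : A)) (by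
    intro u v
    simp [Finset.prod_mul_distrib])
  have hle : closure (Set.range f) ≤ ψ.range := by
    apply closure_range_le
    intro i
    refine ⟨Pi.mulSingle i ⟨f i, mem_zpowers _⟩, ?_⟩
    change ∏ j, ((Pi.mulSingle i (⟨f i, mem_zpowers _⟩ : zpowers (f i)) :
      ∀ j, zpowers (f j)) j : A) = f i
    rw [Finset.prod_eq_single i]
    · simp
    · intro j _ hj
      simp [Pi.mulSingle_eq_of_ne hj]
    · simp
  have hfin : ∀ i, Finite (zpowers (f i)) := fun i => by
    refine Set.Finite.to_subtype (finite_zpowers.2 ?_)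
    exact isOfFinOrder_iff_pow_eq_one.2 ⟨q, hq, hf i⟩
  have hfr : Finite ψ.range := Finite.of_surjective _ ψ.rangeRestrict_surjective
  calc Nat.card (closure (Set.range f)) ≤ Nat.card ψ.range :=
        Nat.card_le_card_of_injective _ (Subgroup.inclusion_injective hle)
    _ ≤ Nat.card (∀ i, zpowers (f i)) :=
        Nat.card_le_card_of_surjective _ ψ.rangeRestrict_surjective
    _ = ∏ i, Nat.card (zpowers (f i)) := Nat.card_pi
    _ ≤ ∏ _i : Fin n, q := Finset.prod_le_prod' fun i _ => by
        rw [Nat.card_zpowers]; exact orderOf_le_of_pow_eq_one hq (hf i)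
    _ = q ^ n := by simp

lemma GenMod.card_le {G : Type*} [Group G] {B : Subgroup G} {n q : ℕ} (hq : 0 < q)
    (h : GenMod B ⊥ n) (hB : ∀ x ∈ B, ∀ y ∈ B, x * y = y * x) (hBq : ∀ x ∈ B, x ^ q = 1) :
    Nat.card B ≤ q ^ n := by
  obtain ⟨f, hf, hg⟩ := h
  let _ : CommGroup B := { (inferInstance : Group B) with
    mul_comm := fun x y => Subtype.ext (hB x x.2 y y.2) }
  have := card_closure_le hq (fun i => (⟨f i, hf i⟩ : B))
    (fun i => Subtype.ext (hBq _ (hf i)))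
  have htop : closure (Set.range (fun i => (⟨f i, hf i⟩ : B))) = ⊤ := by
    apply Subgroup.map_injective B.subtype_injective
    rw [MonoidHom.map_closure, ← Set.range_comp]
    apply le_antisymm
    · apply closure_range_le
      intro i
      exact ⟨⟨f i, hf i⟩, mem_top _, rfl⟩
    · rw [sup_bot_eq] at hg
      refine le_trans ?_ hg
      rintro _ ⟨x, _, rfl⟩
      exact x.2
  rw [htop] at this
  simpa using this

lemma genMod_of_index_le {p : ℕ} [hp : Fact p.Prime] {G : Type*} [Group G] [Finite G]
    (hG : IsPGroup p G) (n : ℕ) : ∀ (H : Subgroup G) (_ : H.index ≤ p ^ n), GenMod ⊤ H n := by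
  induction n with
  | zero =>
    intro H hH
    refine ⟨fun _ => 1, fun _ => mem_top _, ?_⟩
    have : H.index = 1 := by
      have := H.index_ne_zero_of_finite
      rw [pow_zero] at hH
      omega
    rw [Subgroup.index_eq_one] at this
    rw [this]; exact le_sup_right
  | succ n ih =>
    intro H hH
    by_cases htop : H = ⊤
    · exact ⟨fun _ => 1, fun _ => mem_top _, by rw [htop]; exact le_sup_right⟩
    obtain ⟨x, hx⟩ : ∃ x, x ∉ H := by
      by_contra hcon
      push Not at hcon
      exact htop (eq_top_iff.2 fun x _ => hcon x)
    have hlt : H < H ⊔ zpowers x := by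
      refine lt_of_le_of_ne le_sup_left fun e => hx ?_
      rw [e]; exact mem_sup_right (mem_zpowers x)
    have h1 := index_strictAnti hlt
    obtain ⟨k, hk⟩ := hG.index (H ⊔ zpowers x)
    have h2 : (H ⊔ zpowers x).index ≤ p ^ n := by
      have h3 := h1.trans_le hH
      rw [hk] at h3 ⊢
      have := (Nat.pow_lt_pow_iff_right hp.out.one_lt).1 h3
      exact Nat.pow_le_pow_right hp.out.pos (by omega)
    obtain ⟨f, -, hg⟩ := ih _ h2
    refine ⟨Fin.cons x f, fun _ => mem_top _, hg.trans (sup_le ?_ (sup_le le_sup_right ?_))⟩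
    · refine le_trans ?_ le_sup_left
      apply closure_range_le
      intro i
      exact Subgroup.subset_closure ⟨i.succ, by simp⟩
    · rw [zpowers_le]
      exact mem_sup_left (Subgroup.subset_closure ⟨0, by simp⟩)

lemma genMod_of_card_torsion {p : ℕ} [hp : Fact p.Prime] {A : Type*} [CommGroup A] [Finite A]
    (hA : IsPGroup p A) {n : ℕ} (h : Nat.card (powMonoidHom p : A →* A).ker ≤ p ^ n) :
    GenMod (⊤ : Subgroup A) ⊥ n := by
  have hidx : (powMonoidHom p : A →* A).range.index ≤ p ^ n := by
    have h1 := index_ker (powMonoidHom p : A →* A)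
    have h2 := card_mul_index (powMonoidHom p : A →* A).range
    have h3 := card_mul_index (powMonoidHom p : A →* A).ker
    rw [h1, ← h2, mul_comm] at h3
    have := Nat.eq_of_mul_eq_mul_left Nat.card_pos h3
    omega
  obtain ⟨f, hf, hg⟩ := genMod_of_index_le hA n _ hidx
  refine ⟨f, hf, ?_⟩
  have key : ∀ k, ∀ x : A, ∃ y, x * (y ^ p ^ k) ∈ closure (Set.range f) := by
    intro k
    induction k with
    | zero => intro x; exact ⟨x⁻¹, by simp⟩
    | succ k ih =>
      intro x
      obtain ⟨y, hy⟩ := ih x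
      obtain ⟨u, hu, _, ⟨z, rfl⟩, e⟩ := mem_sup.1 (hg (mem_top y))
      refine ⟨z, ?_⟩
      have : x * z ^ p ^ (k + 1) = x * y ^ p ^ k * (u ^ p ^ k)⁻¹ := by
        rw [← e, mul_pow, powMonoidHom_apply, ← pow_mul, pow_succ' p k, mul_comm (u ^ _)]
        group
      rw [this]
      exact mul_mem hy (inv_mem (pow_mem hu _))
  intro x _
  obtain ⟨k, hk⟩ := IsPGroup.iff_card.1 hA
  obtain ⟨y, hy⟩ := key k x
  rw [← hk, pow_card_eq_one', mul_one] at hy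
  exact mem_sup_left hy

end pgroups

section powers

universe u

/-- subgroup generated by `m`-th powers of elements of `B` -/
def pw {G : Type*} [Group G] (B : Subgroup G) (m : ℕ) : Subgroup G :=
  closure ((fun x => x ^ m) '' (B : Set G))

variable {G : Type u} [Group G]

lemma pow_mem_pw {B : Subgroup G} {m : ℕ} {x : G} (hx : x ∈ B) : x ^ m ∈ pw B m :=
  Subgroup.subset_closure ⟨x, hx, rfl⟩

lemma pw_le_iff {B E : Subgroup G} {m : ℕ} : pw B m ≤ E ↔ ∀ x ∈ B, x ^ m ∈ E := by
  unfold pw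
  rw [closure_le]
  constructor
  · intro h x hx; exact h ⟨x, hx, rfl⟩
  · rintro h _ ⟨x, hx, rfl⟩; exact h x hx

lemma pw_le (B : Subgroup G) (m : ℕ) : pw B m ≤ B := pw_le_iff.2 fun _ hx => pow_mem hx _

lemma pw_map {H : Type*} [Group H] (B : Subgroup G) (m : ℕ) (φ : G →* H) :
    (pw B m).map φ = pw (B.map φ) m := by
  unfold pw
  rw [MonoidHom.map_closure]
  congr 1
  ext y
  constructor
  · rintro ⟨_, ⟨x, hx, rfl⟩, rfl⟩
    exact ⟨φ x, ⟨x, hx, rfl⟩, (map_pow φ x m).symm⟩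
  · rintro ⟨_, ⟨x, hx, rfl⟩, rfl⟩
    exact ⟨x ^ m, ⟨x, hx, rfl⟩, map_pow φ x m⟩

instance pw_normal (B : Subgroup G) [hB : B.Normal] (m : ℕ) : (pw B m).Normal := by
  constructor
  intro n hn g
  have h : (pw B m).map (MulAut.conj g).toMonoidHom ≤ pw B m := by
    rw [pw_map, pw_le_iff]
    rintro _ ⟨x, hx, rfl⟩
    exact pow_mem_pw (hB.conj_mem x hx g)
  exact h ⟨n, hn, rfl⟩

lemma commutator_pow_left {x y : G} (h : Commute x ⁅x, y⁆) (n : ℕ) :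
    ⁅x ^ n, y⁆ = ⁅x, y⁆ ^ n := by
  induction n with
  | zero => simp
  | succ n ih =>
    rw [pow_succ', commutatorElement_mul_left_eq_conj_mul, ih, pow_succ]
    congr 1
    rw [(h.pow_right n).eq]; group

lemma commutator_pow_right {x y : G} (h : Commute y ⁅x, y⁆) (n : ℕ) :
    ⁅x, y ^ n⁆ = ⁅x, y⁆ ^ n := by
  have h' : Commute y ⁅y, x⁆ := by
    rw [← commutatorElement_inv]; exact h.inv_right
  rw [← commutatorElement_inv, commutator_pow_left h', ← commutatorElement_inv x y, inv_pow, inv_inv]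

lemma derived_comm {p : ℕ} [hp : Fact p.Prime] [Finite G] (hG : IsPGroup p G) {r k : ℕ}
    (hr : RkMod (⊤ : Subgroup G) ⊥ r)
    (hq : ∀ w ∈ derivedSeries G (k * r), w ^ (p ^ k) = 1) :
    ⁅derivedSeries G (k * r), derivedSeries G (k * r)⁆ = ⊥ := by
  set W := derivedSeries G (k * r) with hW
  let X : Set (Subgroup G) := {M | M.Normal ∧ M ≤ W ∧ ∀ x ∈ M, ∀ y ∈ M, x * y = y * x}
  obtain ⟨M, hMX, hmax⟩ := Set.exists_max_image X (fun M => Nat.card M) (Set.toFinite _)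
    ⟨⊥, inferInstance, bot_le, by
      intro x hx y hy
      rw [mem_bot] at hx hy
      rw [hx, hy]⟩
  obtain ⟨hMn, hMW, hMc⟩ := hMX
  have hcard : Nat.card M ≤ p ^ (k * r) := by
    rw [pow_mul]
    exact GenMod.card_le (pow_pos hp.out.pos k) (hr M le_top) hMc fun x hx => hq x (hMW hx)
  have hcent := derivedSeries_centralizes (k * r) hG M hcard
  rw [← hW, commutator_eq_bot_iff_le_centralizer] at hcent
  suffices hWM : W ≤ M by
    rw [commutator_eq_bot_iff_le_centralizer]
    refine hcent.trans (centralizer_le ?_)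
    exact hWM
  by_contra hnot
  have hne : W.map (QuotientGroup.mk' M) ≠ ⊥ := by
    rwa [Ne, map_mk_eq_bot_iff]
  have hWn : W.Normal := derivedSeries_normal _ _
  have hWn' : (W.map (QuotientGroup.mk' M)).Normal :=
    Subgroup.Normal.map hWn _ (QuotientGroup.mk'_surjective _)
  obtain ⟨y, ⟨x, hxW, hxy⟩, hyZ, hy1⟩ := exists_central_mem (hG.to_quotient M) _ hne
  have hyn : (zpowers y).Normal := normal_of_le_center (by rwa [zpowers_le])
  have hrep : ∀ g ∈ (zpowers y).comap (QuotientGroup.mk' M), ∃ i : ℤ, ∃ m ∈ M, g = x ^ i * m := by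
    intro g hg
    rw [mem_comap] at hg
    obtain ⟨i, hi⟩ := mem_zpowers_iff.1 hg
    refine ⟨i, x ^ (-i) * g, ?_, by group⟩
    rw [← QuotientGroup.ker_mk' M, MonoidHom.mem_ker, map_mul, map_zpow, hxy, ← hi]
    group
  have hMle : M ≤ (zpowers y).comap (QuotientGroup.mk' M) := by
    intro m hm
    rw [mem_comap]
    have : QuotientGroup.mk' M m = 1 := by
      rw [← MonoidHom.mem_ker, QuotientGroup.ker_mk']; exact hm
    rw [this]; exact one_mem _
  have hin : (zpowers y).comap (QuotientGroup.mk' M) ∈ X := by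
    refine ⟨inferInstance, ?_, ?_⟩
    · intro g hg
      obtain ⟨i, m, hm, rfl⟩ := hrep g hg
      exact mul_mem (zpow_mem hxW _) (hMW hm)
    · intro g hg h hh
      obtain ⟨i, m, hm, rfl⟩ := hrep g hg
      obtain ⟨j, l, hl, rfl⟩ := hrep h hh
      have c : ∀ m ∈ M, Commute x m := fun m hm => (mem_centralizer_iff.1 (hcent hxW) m hm).symm
      have c1 : Commute (x ^ i * m) (x ^ j) :=
        ((Commute.refl x).zpow_zpow i j).mul_left ((c m hm).zpow_left j).symm
      have c2 : Commute (x ^ i * m) l := ((c l hl).zpow_left i).mul_left (hMc m hm l hl)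
      exact c1.mul_right c2
  have hle := hmax _ hin
  have heq : M = (zpowers y).comap (QuotientGroup.mk' M) :=
    Subgroup.eq_of_le_of_card_ge hMle hle
  have hxM : x ∈ M := by
    rw [heq, mem_comap, hxy]; exact mem_zpowers y
  apply hy1
  rw [← hxy, ← MonoidHom.mem_ker, QuotientGroup.ker_mk']; exact hxM

/-- Step 1 -/
lemma derived_le_pw {p : ℕ} [hp : Fact p.Prime] [Finite G] (hG : IsPGroup p G) {r k : ℕ}
    (hr : RkMod (⊤ : Subgroup G) (center G) r) :
    ⁅derivedSeries G (k * r), derivedSeries G (k * r)⁆ ≤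
      pw (derivedSeries G (k * r)) (p ^ k) ⊔ center G := by
  have hWn : (derivedSeries G (k * r)).Normal := derivedSeries_normal _ _
  set F := pw (derivedSeries G (k * r)) (p ^ k) ⊔ center G with hF
  have hFn : F.Normal := inferInstance
  have h1 : RkMod (⊤ : Subgroup (G ⧸ F)) ⊥ r := by
    have := hr.map (QuotientGroup.mk' F)
    rw [map_top_mk] at this
    rwa [map_mk_eq_bot_iff.2 (le_sup_right : center G ≤ F)] at this
  have h2 := derived_comm (hG.to_quotient F) (k := k) h1 (by
    rw [← map_derivedSeries_eq (QuotientGroup.mk'_surjective F)]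
    rintro _ ⟨x, hx, rfl⟩
    rw [← map_pow, ← MonoidHom.mem_ker, QuotientGroup.ker_mk']
    exact mem_sup_left (pow_mem_pw hx))
  rwa [← map_derivedSeries_eq (QuotientGroup.mk'_surjective F), ← map_commutator,
    map_mk_eq_bot_iff] at h2

lemma le_center_of_commutator_eq_bot {B : Subgroup G} (h : ⁅B, (⊤ : Subgroup G)⁆ = ⊥) :
    B ≤ center G := commutator_top_right_eq_bot_iff_le_center.1 h

lemma commute_of_mem_center {z : G} (h : z ∈ center G) (x : G) : Commute x z :=
  mem_center_iff.1 h x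

lemma map_commutator_mk (F : Subgroup G) [F.Normal] :
    (commutator G).map (QuotientGroup.mk' F) = commutator (G ⧸ F) := by
  rw [_root_.commutator_def, _root_.commutator_def, map_commutator, map_top_mk]

lemma step2_core {q : ℕ}
    (hD : ∀ d ∈ commutator G, d ^ q = 1)
    (h3 : ⁅⁅commutator G, (⊤ : Subgroup G)⁆, (⊤ : Subgroup G)⁆ = ⊥)
    (hpw : commutator G ≤ pw ⊤ (q * q) ⊔ center G) :
    ⁅commutator G, (⊤ : Subgroup G)⁆ = ⊥ := by
  rw [commutator_top_right_eq_bot_iff_le_center]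
  refine hpw.trans (sup_le (pw_le_iff.2 fun x _ => ?_) le_rfl)
  rw [mem_center_iff]
  intro y
  symm
  rw [← commutatorElement_eq_one_iff_mul_comm]
  have hc := le_center_of_commutator_eq_bot h3
  have hmem : ∀ a b : G, ⁅a, b⁆ ∈ commutator G := fun a b =>
    commutator_mem_commutator (mem_top a) (mem_top b)
  have h1 : ⁅x ^ q, y⁆ ∈ ⁅commutator G, (⊤ : Subgroup G)⁆ := by
    set E := ⁅commutator G, (⊤ : Subgroup G)⁆ with hE
    rw [← QuotientGroup.ker_mk' E, MonoidHom.mem_ker, map_commutatorElement, map_pow,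
      commutator_pow_left, ← map_commutatorElement, ← map_pow, hD _ (hmem x y), map_one]
    symm
    rw [← commutatorElement_eq_one_iff_commute, ← map_commutatorElement, ← map_commutatorElement,
      ← MonoidHom.mem_ker, QuotientGroup.ker_mk']
    exact commutator_mem_commutator (hmem x y) (mem_top x)
  rw [pow_mul, commutator_pow_left (commute_of_mem_center (hc h1) _)]
  exact hD _ (hmem _ _)

/-- Step 2 -/
lemma step2 [Group.IsNilpotent G] {q : ℕ} (hpw : commutator G ≤ pw ⊤ (q * q) ⊔ center G) :
    ⁅commutator G, (⊤ : Subgroup G)⁆ ≤ pw (commutator G) q := by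
  apply le_of_le_sup_commutator
  set F := pw (commutator G) q ⊔ ⁅⁅commutator G, (⊤ : Subgroup G)⁆, (⊤ : Subgroup G)⁆ with hF
  have hmap : (commutator G).map (QuotientGroup.mk' F) = commutator (G ⧸ F) :=
    map_commutator_mk F
  have := step2_core (G := G ⧸ F) (q := q) (by
      rw [← hmap]
      rintro _ ⟨d, hd, rfl⟩
      rw [← map_pow, ← MonoidHom.mem_ker, QuotientGroup.ker_mk']
      exact mem_sup_left (pow_mem_pw hd))
    (by
      rw [← hmap, ← map_top_mk (E := F), ← map_commutator, ← map_commutator, map_mk_eq_bot_iff]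
      exact le_sup_right)
    (by
      rw [← hmap, ← map_top_mk (E := F), ← pw_map]
      refine (map_mono hpw).trans ?_
      rw [Subgroup.map_sup]
      refine sup_le_sup_left ?_ _
      rintro _ ⟨z, hz, rfl⟩
      rw [mem_center_iff]
      intro g
      obtain ⟨g, rfl⟩ := QuotientGroup.mk'_surjective F g
      rw [← map_mul, ← map_mul, mem_center_iff.1 hz])
  rwa [← hmap, ← map_top_mk (E := F), ← map_commutator, map_mk_eq_bot_iff] at this

lemma powerful_core {p : ℕ}
    (h3 : ⁅⁅pw (⊤ : Subgroup G) p, (⊤ : Subgroup G)⁆, (⊤ : Subgroup G)⁆ = ⊥)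
    (hx : ∀ x : G, ((x ^ p) ^ p) ^ p = 1)
    (hpw : commutator G ≤ pw ⊤ (p * p)) : ⁅pw (⊤ : Subgroup G) p, (⊤ : Subgroup G)⁆ = ⊥ := by
  have hc := le_center_of_commutator_eq_bot h3
  have hz : ∀ x y : G, ⁅x ^ p, y⁆ ∈ center G := fun x y =>
    hc (commutator_mem_commutator (pow_mem_pw (mem_top x)) (mem_top y))
  have e1 : ∀ x y : G, ∀ k, ⁅(x ^ p) ^ k, y⁆ = ⁅x ^ p, y⁆ ^ k := fun x y k =>
    commutator_pow_left (commute_of_mem_center (hz x y) _) k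
  have e2 : ∀ x y : G, ∀ k, ⁅x ^ p, y ^ k⁆ = ⁅x ^ p, y⁆ ^ k := fun x y k =>
    commutator_pow_right (commute_of_mem_center (hz x y) _) k
  have e3 : ∀ x y : G, Commute ((x ^ p) ^ p) (y ^ p) := by
    intro x y
    rw [← commutatorElement_eq_one_iff_commute, e1, e2, ← e1, ← e1, hx]
    simp
  have hVc : pw (⊤ : Subgroup G) (p * p) ≤ centralizer (pw (⊤ : Subgroup G) (p * p)) := by
    rw [pw_le_iff]
    intro x _
    have : pw (⊤ : Subgroup G) (p * p) ≤ centralizer {x ^ (p * p)} := by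
      rw [pw_le_iff]
      intro y _
      rw [mem_centralizer_singleton_iff]
      rw [pow_mul, pow_mul]
      exact (e3 x (y ^ p)).symm
    rw [mem_centralizer_iff]
    intro v hv
    exact mem_centralizer_singleton_iff.1 (this hv)
  have hVp : ∀ v ∈ pw (⊤ : Subgroup G) (p * p), v ^ p = 1 := by
    intro v hv
    refine Subgroup.closure_induction (p := fun v _ => v ^ p = 1) ?_ ?_ ?_ ?_ hv
    · rintro _ ⟨x, _, rfl⟩
      simp only [pow_mul]
      exact hx x
    · simp
    · intro a b ha hb ea eb
      have : Commute a b := mem_centralizer_iff.1 (hVc hb) a ha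
      rw [this.mul_pow, ea, eb, one_mul]
    · intro a _ ea
      rw [inv_pow, ea, inv_one]
  have hmem : ∀ a b : G, ⁅a, b⁆ ∈ pw (⊤ : Subgroup G) (p * p) := fun a b =>
    hpw (commutator_mem_commutator (mem_top a) (mem_top b))
  have hVz : pw (⊤ : Subgroup G) (p * p) ≤ center G := by
    rw [pw_le_iff]
    intro z _
    rw [mem_center_iff]
    intro w
    symm
    rw [← commutatorElement_eq_one_iff_mul_comm, pow_mul, e1]
    exact hVp _ (hmem _ _)
  rw [commutator_top_right_eq_bot_iff_le_center, pw_le_iff]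
  intro x _
  rw [mem_center_iff]
  intro y
  symm
  rw [← commutatorElement_eq_one_iff_mul_comm,
    commutator_pow_left (commute_of_mem_center (hVz (hmem x y)) _)]
  exact hVp _ (hmem _ _)

lemma powerful_step [Group.IsNilpotent G] {p : ℕ} (hpw : commutator G ≤ pw ⊤ (p * p)) :
    ⁅pw (⊤ : Subgroup G) p, (⊤ : Subgroup G)⁆ ≤ pw (pw ⊤ p) (p * p) := by
  apply le_of_le_sup_commutator
  set F := pw (pw ⊤ p) (p * p) ⊔ ⁅⁅pw (⊤ : Subgroup G) p, (⊤ : Subgroup G)⁆, (⊤ : Subgroup G)⁆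
    with hF
  have hmap : (commutator G).map (QuotientGroup.mk' F) = commutator (G ⧸ F) :=
    map_commutator_mk F
  have := powerful_core (G := G ⧸ F) (p := p) (by
      rw [← map_top_mk (E := F), ← pw_map, ← map_commutator, ← map_commutator, map_mk_eq_bot_iff]
      exact le_sup_right)
    (by
      intro x
      obtain ⟨x, rfl⟩ := QuotientGroup.mk'_surjective F x
      rw [← map_pow, ← map_pow, ← map_pow, ← MonoidHom.mem_ker, QuotientGroup.ker_mk', ← pow_mul]
      exact mem_sup_left (pow_mem_pw (pow_mem_pw (mem_top x))))
    (by
      rw [← hmap, ← map_top_mk (E := F), ← pw_map]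
      exact map_mono hpw)
  rwa [← map_top_mk (E := F), ← pw_map, ← map_commutator, map_mk_eq_bot_iff] at this

lemma trivial_of_pw_eq_top {p : ℕ} [hp : Fact p.Prime] [Finite G] (hG : IsPGroup p G)
    (h : pw (⊤ : Subgroup G) p = ⊤) : (⊤ : Subgroup G) = ⊥ := by
  have := hG.isNilpotent
  rw [← le_bot_iff]
  apply le_of_le_sup_commutator
  refine le_trans ?_ le_sup_right
  have h1 : pw (⊤ : Subgroup G) p ≤ (powMonoidHom p : Abelianization G →* _).range.comap
      Abelianization.of := by
    rw [pw_le_iff]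
    intro x _
    exact ⟨Abelianization.of x, by simp⟩
  have h2 : ∀ x : Abelianization G, ∃ y, y ^ p = x := by
    intro x
    obtain ⟨x, rfl⟩ := QuotientGroup.mk_surjective x
    have : x ∈ pw (⊤ : Subgroup G) p := by rw [h]; exact mem_top x
    obtain ⟨y, hy⟩ := h1 this
    exact ⟨y, hy⟩
  have h3 : ∀ k, ∀ x : Abelianization G, ∃ y, y ^ p ^ k = x := by
    intro k
    induction k with
    | zero => intro x; exact ⟨x, by simp⟩
    | succ k ih =>
      intro x
      obtain ⟨y, hy⟩ := h2 x
      obtain ⟨z, hz⟩ := ih y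
      exact ⟨z, by rw [pow_succ, pow_mul, hz, hy]⟩
  intro x _
  obtain ⟨k, hk⟩ := IsPGroup.iff_card.1 hG
  obtain ⟨y, hy⟩ := h3 k (Abelianization.of x)
  obtain ⟨y, rfl⟩ := QuotientGroup.mk_surjective y
  have h4 : Abelianization.of x = 1 := by
    rw [← hy, ← hk]
    change Abelianization.of y ^ Nat.card G = 1
    rw [← map_pow, pow_card_eq_one', map_one]
  rw [← MonoidHom.mem_ker, Abelianization.ker_of] at h4
  exact h4

/-- Step 4: counting elements of order `p` in powerful groups -/
lemma powerful_card {p : ℕ} [hp : Fact p.Prime] (N : ℕ) : ∀ {G : Type u} [Group G] [Finite G]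
    (_ : IsPGroup p G) (_ : Nat.card G ≤ N) (_ : commutator G ≤ pw ⊤ (p * p))
    (A : Subgroup G) (_ : ∀ a ∈ A, a ^ p = 1), Nat.card A ≤ (pw (⊤ : Subgroup G) p).index := by
  induction N with
  | zero =>
    intro G _ _ hG hcard
    have : 0 < Nat.card G := Nat.card_pos
    omega
  | succ N ih =>
    intro G _ _ hG hcard hpw A hA
    have := hG.isNilpotent
    set P1 := pw (⊤ : Subgroup G) p with hP1
    set P2 := pw P1 p with hP2
    have hP21 : P2 ≤ P1 := pw_le _ _
    by_cases htop : P1 = ⊤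
    · -- then `G` is trivial
      have hbot : (⊤ : Subgroup G) = ⊥ := trivial_of_pw_eq_top hG htop
      have : Nat.card A = 1 := by
        rw [Subgroup.card_eq_one, ← le_bot_iff, ← hbot]; exact le_top
      rw [this]
      exact Nat.one_le_iff_ne_zero.2 P1.index_ne_zero_of_finite
    have hlt : Nat.card P1 < Nat.card G := by
      refine lt_of_le_of_ne P1.card_le_card_group fun e => htop (P1.eq_top_of_card_eq e)
    have hsub : ∀ m, (pw (⊤ : Subgroup P1) m).map P1.subtype = pw P1 m := by
      intro m
      rw [pw_map, ← MonoidHom.range_eq_map, Subgroup.range_subtype]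
    have hcomm : commutator P1 ≤ pw ⊤ (p * p) := by
      have h1 : (commutator P1).map P1.subtype ≤ (pw ⊤ (p * p)).map P1.subtype := by
        rw [hsub, Subgroup.map_subtype_commutator]
        exact (commutator_mono le_rfl le_top).trans (powerful_step hpw)
      exact (Subgroup.map_le_map_iff_of_injective P1.subtype_injective).1 h1
    have hIH := ih (hG.to_subgroup P1) (by omega) hcomm (A.subgroupOf P1) (by
      intro a ha
      exact Subtype.ext (hA a ha))
    have hrel : (pw (⊤ : Subgroup P1) p).index = P2.relIndex P1 := by
      rw [Subgroup.relIndex, hP2, ← hsub, Subgroup.subgroupOf,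
        Subgroup.comap_map_eq_self_of_injective P1.subtype_injective]
    rw [hrel] at hIH
    -- power map on the abelian quotient
    have hcP2 : commutator G ≤ P2 := by
      refine hpw.trans (pw_le_iff.2 fun x hx => ?_)
      rw [pow_mul]
      exact pow_mem_pw (pow_mem_pw hx)
    let _ : CommGroup (G ⧸ P2) := { (inferInstance : Group (G ⧸ P2)) with
      mul_comm := by
        intro x y
        obtain ⟨x, rfl⟩ := QuotientGroup.mk'_surjective P2 x
        obtain ⟨y, rfl⟩ := QuotientGroup.mk'_surjective P2 y
        change QuotientGroup.mk' P2 x * QuotientGroup.mk' P2 y =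
          QuotientGroup.mk' P2 y * QuotientGroup.mk' P2 x
        rw [← commutatorElement_eq_one_iff_mul_comm, ← map_commutatorElement,
          ← MonoidHom.mem_ker, QuotientGroup.ker_mk']
        exact hcP2 (commutator_mem_commutator (mem_top x) (mem_top y)) }
    let f : G →* G ⧸ P2 := (powMonoidHom p).comp (QuotientGroup.mk' P2)
    have hf : ∀ x, f x = QuotientGroup.mk' P2 (x ^ p) := fun x => rfl
    have hker : ∀ x, x ∈ f.ker ↔ x ^ p ∈ P2 := by
      intro x
      rw [MonoidHom.mem_ker, hf, ← MonoidHom.mem_ker, QuotientGroup.ker_mk']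
    have hrange : f.range = P1.map (QuotientGroup.mk' P2) := by
      apply le_antisymm
      · rintro _ ⟨x, rfl⟩
        exact ⟨x ^ p, pow_mem_pw (mem_top x), (hf x).symm⟩
      · rw [map_le_iff_le_comap]
        refine pw_le_iff.2 ?_
        intro x _
        exact ⟨x, hf x⟩
    have h1 : f.ker.index = P2.relIndex P1 := by
      rw [index_ker, hrange, ← relIndex_ker, QuotientGroup.ker_mk']
    have hAP : A ⊔ P1 ≤ f.ker := by
      refine sup_le (fun a ha => ?_) (fun x hx => ?_)
      · rw [hker, hA a ha]; exact one_mem _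
      · rw [hker]; exact pow_mem_pw hx
    have hP2k : P2 ≤ f.ker := hP21.trans (le_sup_right.trans hAP)
    have h2 : P2.relIndex f.ker = P1.index := by
      have e1 := relIndex_mul_index hP2k
      have e2 := relIndex_mul_index hP21
      rw [h1, ← e2, mul_comm] at e1
      refine Nat.eq_of_mul_eq_mul_left (Nat.pos_of_ne_zero ?_) e1
      rw [← h1]
      exact f.ker.index_ne_zero_of_finite
    have h3 : Nat.card A = Nat.card (A.subgroupOf P1) * P1.relIndex A := by
      have e1 := relIndex_mul_relIndex ⊥ (A ⊓ P1) A bot_le inf_le_left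
      rw [relIndex_bot_left, relIndex_bot_left, inf_relIndex_left] at e1
      rw [← e1]
      congr 1
      rw [← Subgroup.subgroupOf_map_subtype]
      exact (Nat.card_congr ((A.subgroupOf P1).equivMapOfInjective _
        P1.subtype_injective).toEquiv).symm
    have h4 := relIndex_mul_relIndex P2 P1 (A ⊔ P1) hP21 le_sup_right
    rw [relIndex_sup_right] at h4
    calc Nat.card A ≤ P2.relIndex P1 * P1.relIndex A := by
          rw [h3]; exact Nat.mul_le_mul_right _ hIH
      _ = P2.relIndex (A ⊔ P1) := h4
      _ ≤ P2.relIndex f.ker := relIndex_le_of_le_right hAP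
          (by rw [h2]; exact P1.index_ne_zero_of_finite)
      _ = P1.index := h2

end powers

section assembly

universe u

variable {G : Type u} [Group G]

lemma commutator_elem_mem (a b : G) : ⁅a, b⁆ ∈ commutator G :=
  commutator_mem_commutator (mem_top a) (mem_top b)

lemma map_center_le (F : Subgroup G) [F.Normal] :
    (center G).map (QuotientGroup.mk' F) ≤ center (G ⧸ F) := by
  rintro _ ⟨z, hz, rfl⟩
  rw [mem_center_iff]
  intro g
  obtain ⟨g, rfl⟩ := QuotientGroup.mk'_surjective F g
  rw [← map_mul, ← map_mul, mem_center_iff.1 hz]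

lemma comap_center_le (L : Subgroup G) : (center G).comap L.subtype ≤ center L := by
  intro z hz
  rw [mem_comap] at hz
  rw [mem_center_iff]
  intro g
  exact Subtype.ext (mem_center_iff.1 hz g)

lemma RkMod.inf {B C : Subgroup G} [C.Normal] {n : ℕ} (h : RkMod B C n) : RkMod B (C ⊓ B) n := by
  intro S hS
  obtain ⟨f, hf, hg⟩ := h S hS
  refine ⟨f, hf, fun s hs => ?_⟩
  obtain ⟨u, hu, c, hc, rfl⟩ := mem_sup_of_normal_right.1 (hg hs)
  refine mul_mem (mem_sup_left hu) (mem_sup_right ⟨hc, ?_⟩)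
  have huS : u ∈ S := closure_range_le hf hu
  simpa using B.mul_mem (B.inv_mem (hS huS)) (hS hs)

lemma class_two {r : ℕ} (h2 : commutator G ≤ center G) (x : Fin r → G)
    (hx : ⊤ ≤ closure (Set.range x) ⊔ center G) :
    commutator G ≤ closure (Set.range fun k : Fin (r * r) =>
      ⁅x (finProdFinEquiv.symm k).1, x (finProdFinEquiv.symm k).2⁆) := by
  set R := closure (Set.range fun k : Fin (r * r) =>
      ⁅x (finProdFinEquiv.symm k).1, x (finProdFinEquiv.symm k).2⁆) with hR
  let φ : G → G →* G := fun (y : G) => MonoidHom.mk' (fun g : G => ⁅g, y⁆) (by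
    intro a b
    rw [commutatorElement_mul_left_eq_conj_mul,
      (commute_of_mem_center (h2 (commutator_elem_mem b y)) a).eq, mul_inv_cancel_right,
      (commute_of_mem_center (h2 (commutator_elem_mem b y)) _).eq])
  have hcen : ∀ y, center G ≤ R.comap (φ y) := by
    intro y z hz
    have : φ y z = 1 := by
      change ⁅z, y⁆ = 1
      rw [commutatorElement_eq_one_iff_commute]
      exact (commute_of_mem_center hz y).symm
    rw [mem_comap, this]; exact one_mem _
  have key : ∀ y : G, (∀ i, ⁅x i, y⁆ ∈ R) → ∀ g : G, ⁅g, y⁆ ∈ R := by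
    intro y hy g
    exact (hx.trans (sup_le (closure_range_le (S := R.comap (φ y)) hy) (hcen y))) (mem_top g)
  have k1 : ∀ (j : Fin r) (g : G), ⁅g, x j⁆ ∈ R := by
    intro j
    apply key
    intro i
    exact Subgroup.subset_closure ⟨finProdFinEquiv (i, j), by simp⟩
  rw [_root_.commutator_def, commutator_le]
  intro a _ b _
  apply key
  intro i
  rw [← commutatorElement_inv]
  exact inv_mem (k1 i b)

lemma genMod_commutator {r : ℕ} {E : Subgroup G} [E.Normal]
    (hE : ⁅commutator G, (⊤ : Subgroup G)⁆ ≤ E) (h : GenMod ⊤ (center G) r) :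
    GenMod (commutator G) E (r * r) := by
  obtain ⟨x, -, hx⟩ := h
  refine ⟨fun k : Fin (r * r) =>
      ⁅x (finProdFinEquiv.symm k).1, x (finProdFinEquiv.symm k).2⁆,
      fun k => commutator_elem_mem _ _, ?_⟩
  have h1 : commutator (G ⧸ E) ≤ center (G ⧸ E) := by
    rw [← commutator_top_right_eq_bot_iff_le_center, ← map_commutator_mk, ← map_top_mk,
      ← map_commutator, map_mk_eq_bot_iff]
    exact hE
  have h2 := class_two h1 (fun i => QuotientGroup.mk' E (x i)) (by
    have := Subgroup.map_mono (f := QuotientGroup.mk' E) hx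
    rw [map_top_mk, Subgroup.map_sup, MonoidHom.map_closure, ← Set.range_comp] at this
    exact this.trans (sup_le_sup_left (map_center_le E) _))
  rw [← map_commutator_mk] at h2
  simp only [← map_commutatorElement] at h2
  have h3 := (Subgroup.map_le_iff_le_comap).1 h2
  refine h3.trans ?_
  have e : (Set.range fun k : Fin (r * r) => QuotientGroup.mk' E
      ⁅x (finProdFinEquiv.symm k).1, x (finProdFinEquiv.symm k).2⁆) =
      QuotientGroup.mk' E '' (Set.range fun k : Fin (r * r) =>
      ⁅x (finProdFinEquiv.symm k).1, x (finProdFinEquiv.symm k).2⁆) := by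
    rw [← Set.range_comp]; rfl
  rw [e, ← MonoidHom.map_closure, Subgroup.comap_map_eq, QuotientGroup.ker_mk']

lemma metabelian {r : ℕ} (hc : ⁅commutator G, commutator G⁆ = ⊥)
    (hr : RkMod ⊤ (center G) r) : RkMod (commutator G) ⊥ (r * r + r * r) := by
  have hcomm : ∀ a ∈ commutator G, ∀ b ∈ commutator G, a * b = b * a := by
    intro a ha b hb
    rw [← commutatorElement_eq_one_iff_mul_comm, ← mem_bot, ← hc]
    exact commutator_mem_commutator ha hb
  have hVn : (commutator G).Normal := inferInstance
  set V := commutator G with hV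
  set U := ⁅V, (⊤ : Subgroup G)⁆ with hU
  have hUV : U ≤ V := commutator_le_left _ _
  have h1 : RkMod V U (r * r) := by
    apply GenMod.rkMod_of_commutator_le
    · exact genMod_commutator le_rfl (hr ⊤ le_rfl)
    · exact commutator_mono le_rfl le_top
  refine h1.trans ?_
  apply GenMod.rkMod_of_comm _ (fun a ha b hb => hcomm a (hUV ha) b (hUV hb))
  obtain ⟨x, -, hx⟩ := hr ⊤ le_rfl
  obtain ⟨f, hf, hfg⟩ := hr V le_top
  refine ⟨fun k : Fin (r * r) => ⁅f (finProdFinEquiv.symm k).1, x (finProdFinEquiv.symm k).2⁆,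
      fun k => commutator_mem_commutator (hf _) (mem_top _), ?_⟩
  rw [sup_bot_eq]
  set R := closure (Set.range fun k : Fin (r * r) =>
      ⁅f (finProdFinEquiv.symm k).1, x (finProdFinEquiv.symm k).2⁆) with hR
  have zl : ∀ z ∈ center G, ∀ g : G, ⁅z, g⁆ = 1 := fun z hz g => by
    rw [commutatorElement_eq_one_iff_commute]; exact (commute_of_mem_center hz g).symm
  have zr : ∀ z ∈ center G, ∀ g : G, ⁅g, z⁆ = 1 := fun z hz g => by
    rw [commutatorElement_eq_one_iff_commute]; exact commute_of_mem_center hz g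
  have s1 : ∀ i, ∀ v ∈ V, ⁅v, x i⁆ ∈ R := by
    intro i v hv
    obtain ⟨u, hu, z, hz, rfl⟩ := mem_sup_of_normal_right.1 (hfg hv)
    rw [commutatorElement_mul_left_eq_conj_mul, zl z hz, mul_one, mul_inv_cancel, one_mul]
    clear hv
    refine Subgroup.closure_induction (p := fun u _ => ⁅u, x i⁆ ∈ R) ?_ ?_ ?_ ?_ hu
    · rintro _ ⟨j, rfl⟩
      exact Subgroup.subset_closure ⟨finProdFinEquiv (j, i), by simp⟩
    · simp
    · intro a b ha hb ea eb
      have haV : a ∈ V := closure_range_le hf ha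
      rw [commutatorElement_mul_left_eq_conj_mul, hcomm a haV _ (commutator_elem_mem b (x i)),
        mul_inv_cancel_right]
      exact mul_mem eb ea
    · intro a ha ea
      have haV : a ∈ V := closure_range_le hf ha
      rw [commutatorElement_inv_left, hcomm a⁻¹ (inv_mem haV) _ (commutator_elem_mem (x i) a),
        inv_mul_cancel_right, ← commutatorElement_inv]
      exact inv_mem ea
  rw [hU, commutator_le]
  intro v hv g _
  obtain ⟨u, hu, z, hz, rfl⟩ := mem_sup_of_normal_right.1 (hx (mem_top g))
  rw [commutatorElement_mul_right_eq_mul_conj, zr z hz, mul_one, mul_inv_cancel_right]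
  revert v
  refine Subgroup.closure_induction (p := fun u _ => ∀ v ∈ V, ⁅v, u⁆ ∈ R) ?_ ?_ ?_ ?_ hu
  · rintro _ ⟨j, rfl⟩ v hv
    exact s1 j v hv
  · simp
  · intro a b _ _ ea eb v hv
    have : ⁅v, a * b⁆ = ⁅v, a⁆ * (⁅⁅v, b⁆, a⁆⁻¹ * ⁅v, b⁆) := by
      simp only [commutatorElement_def]; group
    rw [this]
    exact mul_mem (ea v hv) (mul_mem (inv_mem (ea _ (commutator_elem_mem v b))) (eb v hv))
  · intro a _ ea v hv
    have : ⁅v, a⁻¹⁆ = ⁅a⁻¹ * v * a, a⁆⁻¹ := by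
      simp only [commutatorElement_def]; group
    rw [this]
    refine inv_mem (ea _ ?_)
    simpa using hVn.conj_mem v hv a⁻¹

lemma derived_step_top {r : ℕ} (hr : RkMod ⊤ (center G) r) :
    RkMod (commutator G) ⁅commutator G, commutator G⁆ (r * r + r * r) := by
  set F := ⁅commutator G, commutator G⁆ with hF
  have h1 : RkMod ⊤ (center (G ⧸ F)) r := by
    have := hr.map (QuotientGroup.mk' F)
    rw [map_top_mk] at this
    exact this.mono le_rfl (map_center_le F)
  have h2 := metabelian (G := G ⧸ F) (by
    rw [← map_commutator_mk, ← map_commutator, map_mk_eq_bot_iff]) h1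
  have h3 := h2.comap (QuotientGroup.mk' F)
  rw [MonoidHom.comap_bot, QuotientGroup.ker_mk'] at h3
  refine h3.mono ?_ le_rfl
  rw [← map_commutator_mk]
  exact le_comap_map _ _

lemma rkMod_subtype {r : ℕ} (hr : RkMod ⊤ (center G) r) (L : Subgroup G) :
    RkMod ⊤ (center L) r := (hr.comap L.subtype).mono le_top (comap_center_le L)

lemma derived_step {r : ℕ} (hr : RkMod ⊤ (center G) r) (L : Subgroup G) :
    RkMod ⁅L, L⁆ ⁅⁅L, L⁆, ⁅L, L⁆⁆ (r * r + r * r) := by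
  have := (derived_step_top (rkMod_subtype hr L)).map L.subtype
  rwa [map_commutator, Subgroup.map_subtype_commutator] at this

lemma pw_subtype (L : Subgroup G) (m : ℕ) : (pw (⊤ : Subgroup L) m).map L.subtype = pw L m := by
  rw [pw_map, ← MonoidHom.range_eq_map, Subgroup.range_subtype]

lemma bottom_step {p : ℕ} [hp : Fact p.Prime] [Finite G] (hG : IsPGroup p G) {r : ℕ}
    (hr : RkMod ⊤ (center G) r) (hpw : commutator G ≤ pw ⊤ (p * p * (p * p)) ⊔ center G) :
    RkMod (commutator G) ⊥ (r + r * r) := by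
  have := hG.isNilpotent
  have hstep := step2 hpw
  have hsub : pw (commutator G) (p * p) ≤ pw (commutator G) p := by
    rw [pw_le_iff]
    intro x hx
    rw [pow_mul]
    exact pow_mem_pw (pow_mem hx p)
  have hgen := genMod_commutator (hstep.trans hsub) (hr ⊤ le_rfl)
  have hEn : (pw (commutator G) p).Normal := inferInstance
  have hidx : (pw (⊤ : Subgroup (commutator G)) p).index ≤ p ^ (r * r) := by
    have e : (pw (⊤ : Subgroup (commutator G)) p).index =
        (pw (commutator G) p).relIndex (commutator G) := by
      rw [Subgroup.relIndex, ← pw_subtype (commutator G) p, Subgroup.subgroupOf,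
        Subgroup.comap_map_eq_self_of_injective (commutator G).subtype_injective]
    rw [e]
    set C := commutator G with hC
    set E := pw C p with hE
    have e2 : E.relIndex C = Nat.card (C.map (QuotientGroup.mk' E)) := by
      rw [← relIndex_ker, QuotientGroup.ker_mk']
    rw [e2]
    apply GenMod.card_le hp.out.pos
    · obtain ⟨f, hf, hg⟩ := hgen
      refine ⟨fun i => QuotientGroup.mk' E (f i), fun i => mem_map_of_mem _ (hf i), ?_⟩
      have := Subgroup.map_mono (f := QuotientGroup.mk' E) hg
      rw [Subgroup.map_sup, MonoidHom.map_closure, ← Set.range_comp,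
        QuotientGroup.map_mk'_self] at this
      exact this
    · rintro _ ⟨x, hx, rfl⟩ _ ⟨y, hy, rfl⟩
      rw [← commutatorElement_eq_one_iff_mul_comm, ← map_commutatorElement]
      rw [← MonoidHom.mem_ker, QuotientGroup.ker_mk']
      exact hsub (hstep (commutator_mem_commutator hx (mem_top y)))
    · rintro _ ⟨x, hx, rfl⟩
      rw [← map_pow, ← MonoidHom.mem_ker, QuotientGroup.ker_mk']
      exact pow_mem_pw hx
  have hDpow : commutator (commutator G) ≤ pw ⊤ (p * p) := by
    have h1 : (commutator (commutator G)).map (commutator G).subtype ≤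
        (pw ⊤ (p * p)).map (commutator G).subtype := by
      rw [pw_subtype, Subgroup.map_subtype_commutator]
      exact (commutator_mono le_rfl le_top).trans hstep
    exact (Subgroup.map_le_map_iff_of_injective (commutator G).subtype_injective).1 h1
  have h1 : RkMod (commutator G) (center G ⊓ commutator G) r := (hr.mono le_top le_rfl).inf
  refine h1.trans ?_
  intro S hS
  have hSC : S ≤ commutator G := hS.trans inf_le_right
  let _ : CommGroup S := { (inferInstance : Group S) with
    mul_comm := fun x y => Subtype.ext (commute_of_mem_center (hS y.2).1 (x : G)) }
  have hinj : Function.Injective (Subgroup.inclusion hSC) := Subgroup.inclusion_injective hSC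
  have htor : Nat.card (powMonoidHom p : S →* S).ker ≤ p ^ (r * r) := by
    have e1 := powerful_card (p := p) _ (hG.to_subgroup (commutator G)) le_rfl hDpow
      ((powMonoidHom p : S →* S).ker.map (Subgroup.inclusion hSC)) (by
        rintro _ ⟨x, hx, rfl⟩
        have hx' : x ^ p = 1 := hx
        rw [← map_pow, hx', map_one])
    refine le_trans (le_of_eq ?_) (e1.trans hidx)
    exact Nat.card_congr (Subgroup.equivMapOfInjective _ _ hinj).toEquiv
  obtain ⟨f, -, hg⟩ := genMod_of_card_torsion (hG.to_subgroup S) htor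
  refine ⟨fun i => f i, fun i => (f i).2, ?_⟩
  have := Subgroup.map_mono (f := S.subtype) hg
  rw [Subgroup.map_sup, MonoidHom.map_closure, ← Set.range_comp, Subgroup.map_bot,
    ← MonoidHom.range_eq_map, Subgroup.range_subtype] at this
  exact this

/-- the bound -/
def bnd (r : ℕ) : ℕ := r + r * r + 4 * r * (r * r + r * r)

lemma pgroup_bound {p : ℕ} [hp : Fact p.Prime] [Finite G] (hG : IsPGroup p G) {r : ℕ}
    (hr : RkMod ⊤ (center G) r) : RkMod (commutator G) ⊥ (bnd r) := by
  have hbase : RkMod (derivedSeries G (4 * r + 1)) ⊥ (r + r * r) := by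
    have h1 := derived_le_pw (k := 4) hG hr
    rw [derivedSeries_succ]
    set N := derivedSeries G (4 * r) with hN
    have h2 := bottom_step (hG.to_subgroup N) (rkMod_subtype hr N) (by
      intro c hc
      have hc' : (c : G) ∈ ⁅N, N⁆ := by
        rw [← Subgroup.map_subtype_commutator]; exact ⟨c, hc, rfl⟩
      obtain ⟨u, hu, z, hz, e⟩ := mem_sup_of_normal_right.1 (h1 hc')
      rw [← pw_subtype] at hu
      obtain ⟨u, hu, rfl⟩ := hu
      have : c = u * (u⁻¹ * c) := by group
      rw [this]
      refine mul_mem (mem_sup_left ?_) (mem_sup_right (comap_center_le N ?_))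
      · rwa [show p * p * (p * p) = p ^ 4 by ring]
      · rw [mem_comap, map_mul, map_inv]
        change (N.subtype u)⁻¹ * (c : G) ∈ center G
        rw [← e]
        simpa using hz)
    have h3 := h2.map N.subtype
    rwa [Subgroup.map_subtype_commutator, Subgroup.map_bot] at h3
  have key : ∀ i ≤ 4 * r, RkMod (derivedSeries G (4 * r + 1 - i)) ⊥
      (r + r * r + i * (r * r + r * r)) := by
    intro i
    induction i with
    | zero => intro _; simpa using hbase
    | succ i ih =>
      intro hi
      have h1 := ih (by omega)
      obtain ⟨j, hj⟩ : ∃ j, 4 * r + 1 - i = j + 2 := ⟨4 * r + 1 - i - 2, by omega⟩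
      rw [hj] at h1
      have hj' : 4 * r + 1 - (i + 1) = j + 1 := by omega
      rw [hj']
      have h2 := derived_step hr (derivedSeries G j)
      rw [← derivedSeries_succ, ← derivedSeries_succ] at h2
      have : (derivedSeries G (j + 1 + 1)).Normal := derivedSeries_normal _ _
      exact (h2.trans h1).mono_n (by ring_nf; omega)
  have := key (4 * r) le_rfl
  rw [show 4 * r + 1 - 4 * r = 1 by omega, derivedSeries_one] at this
  exact this

lemma transfer_lemma {p : ℕ} [hp : Fact p.Prime] [Finite G] (P : Sylow p G) {z : G}
    (hzP : z ∈ P) (hz : z ∈ center G) (hzc : z ∈ commutator G) :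
    z ∈ (commutator P).map (P : Subgroup G).subtype := by
  have h1 := MonoidHom.transfer_eq_pow (H := (P : Subgroup G)) (Abelianization.of) z (by
    intro k g _
    rw [mul_assoc, ← (commute_of_mem_center (pow_mem hz k) g).eq, inv_mul_cancel_left])
  have h2 : MonoidHom.transfer (H := (P : Subgroup G)) (Abelianization.of) z = 1 := by
    rw [← MonoidHom.mem_ker]
    exact Abelianization.commutator_subset_ker _ hzc
  rw [h2] at h1
  have h3 := h1.symm
  rw [← MonoidHom.mem_ker, Abelianization.ker_of] at h3
  have h4 : z ^ (P : Subgroup G).index ∈ (commutator P).map (P : Subgroup G).subtype :=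
    ⟨_, h3, rfl⟩
  obtain ⟨k, hk⟩ := P.isPGroup' ⟨z, hzP⟩
  have hk' : z ^ p ^ k = 1 := congrArg Subtype.val hk
  have hcop : ((P : Subgroup G).index).Coprime (orderOf z) := by
    refine Nat.Coprime.coprime_dvd_right (orderOf_dvd_of_pow_eq_one hk') ?_
    apply Nat.Coprime.pow_right
    rw [Nat.coprime_comm, hp.out.coprime_iff_not_dvd]
    exact P.not_dvd_index
  obtain ⟨m, hm⟩ := exists_pow_eq_self_of_coprime hcop
  rw [← hm]
  exact pow_mem h4 m

lemma genMod_of_coprime_parts {A : Subgroup G} {n : ℕ} (hA : A ≤ center G)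
    (hp : ∀ p : ℕ, p.Prime → ∀ T ≤ A, IsPGroup p T → GenMod T ⊥ n) (m : ℕ) :
    0 < m → ∀ T ≤ A, (∀ x ∈ T, x ^ m = 1) → GenMod T ⊥ n := by
  induction m using Nat.recOnPosPrimePosCoprime with
  | zero => intro h; omega
  | one =>
    intro _ T _ hT
    refine ⟨fun _ => 1, fun _ => one_mem _, ?_⟩
    intro x hx
    have := hT x hx
    rw [pow_one] at this
    rw [this]; exact one_mem _
  | prime_pow q k hq hk =>
    intro _ T hTA hT
    exact hp q hq T hTA fun x => ⟨k, Subtype.ext (hT x x.2)⟩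
  | coprime a b ha hb hab iha ihb =>
    intro _ T hTA hT
    have hc : ∀ x ∈ T, ∀ y, Commute x y := fun x hx y =>
      (commute_of_mem_center (hA (hTA hx)) y).symm
    let part : ℕ → Subgroup G := fun a =>
      { carrier := {x | x ∈ T ∧ x ^ a = 1}
        one_mem' := ⟨one_mem _, one_pow _⟩
        mul_mem' := fun {x y} hx hy =>
          ⟨mul_mem hx.1 hy.1, by rw [(hc x hx.1 y).mul_pow, hx.2, hy.2, one_mul]⟩
        inv_mem' := fun {x} hx => ⟨inv_mem hx.1, by rw [inv_pow, hx.2, inv_one]⟩ }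
    obtain ⟨f, hf, hfg⟩ := iha (by omega) (part a) (fun x hx => hTA hx.1) fun x hx => hx.2
    obtain ⟨g, hg, hgg⟩ := ihb (by omega) (part b) (fun x hx => hTA hx.1) fun x hx => hx.2
    rw [sup_bot_eq] at hfg hgg
    refine ⟨fun i => f i * g i, fun i => mul_mem (hf i).1 (hg i).1, ?_⟩
    rw [sup_bot_eq]
    set R := closure (Set.range fun i => f i * g i) with hR
    have hmem : ∀ i, f i * g i ∈ R := fun i => Subgroup.subset_closure ⟨i, rfl⟩
    have hpa : part a ≤ R := by
      refine hfg.trans (closure_range_le fun i => ?_)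
      have h1 : f i ^ b ∈ R := by
        have := pow_mem (hmem i) b
        rwa [(hc _ (hf i).1 _).mul_pow, (hg i).2, mul_one] at this
      obtain ⟨k, hk⟩ := exists_pow_eq_self_of_coprime (x := f i) (n := b)
        (Nat.Coprime.coprime_dvd_right (orderOf_dvd_of_pow_eq_one (hf i).2) hab.symm)
      rw [← hk]; exact pow_mem h1 k
    have hpb : part b ≤ R := by
      refine hgg.trans (closure_range_le fun i => ?_)
      have h1 : g i ^ a ∈ R := by
        have := pow_mem (hmem i) a
        rwa [(hc _ (hf i).1 _).mul_pow, (hf i).2, one_mul] at this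
      obtain ⟨k, hk⟩ := exists_pow_eq_self_of_coprime (x := g i) (n := a)
        (Nat.Coprime.coprime_dvd_right (orderOf_dvd_of_pow_eq_one (hg i).2) hab)
      rw [← hk]; exact pow_mem h1 k
    intro x hx
    have hbez : x = (x ^ a) ^ (a.gcdA b) * (x ^ b) ^ (a.gcdB b) := by
      rw [← zpow_natCast, ← zpow_natCast, ← zpow_mul, ← zpow_mul, ← zpow_add,
        ← Nat.gcd_eq_gcd_ab, hab.gcd_eq_one]
      simp
    rw [hbez]
    refine mul_mem (zpow_mem (hpb ⟨pow_mem hx _, ?_⟩) _) (zpow_mem (hpa ⟨pow_mem hx _, ?_⟩) _)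
    · rw [← pow_mul]; exact hT x hx
    · rw [← pow_mul, mul_comm]; exact hT x hx

theorem main_bound [Finite G] {r : ℕ} (hr : RkMod ⊤ (center G) r) :
    RkMod (commutator G) ⊥ (r + bnd r) := by
  have h1 : RkMod (commutator G) (center G ⊓ commutator G) r := (hr.mono le_top le_rfl).inf
  refine h1.trans ?_
  intro S hS
  refine genMod_of_coprime_parts (A := center G ⊓ commutator G) inf_le_left ?_ (Nat.card G)
    Nat.card_pos S hS (fun x _ => pow_card_eq_one')
  intro p hp T hT hTp
  have : Fact p.Prime := ⟨hp⟩
  obtain ⟨P, hP⟩ := hTp.exists_le_sylow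
  have h2 := (pgroup_bound P.isPGroup' (rkMod_subtype hr (P : Subgroup G))).map
    (P : Subgroup G).subtype
  rw [Subgroup.map_bot] at h2
  exact h2 T fun z hz => transfer_lemma P (hP hz) (hT hz).1 (hT hz).2

end assembly

end RankSchur

/-- rank version of Schur's theorem: If `G` is a finite group such that
`G/Z(G)` has rank `r`, then the rank of `G'` is bounded in terms of `r` only. -/
theorem rank_derived_bounded_of_rank_central_quotient :
    ∃ f : ℕ → ℕ, ∀ (G : Type) [Group G] [Fintype G], ∀ r : ℕ,
      HasRankLE (G ⧸ Subgroup.center G) r → HasRankLE (commutator G) (f r) := by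
  refine ⟨fun r => r + RankSchur.bnd r, ?_⟩
  intro G _ _ r h
  exact RankSchur.hasRankLE_of_rkMod (RankSchur.main_bound (RankSchur.rkMod_of_hasRankLE h))
end
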